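/- Let I and I' be ideals generated by monomials of degree at least 2 in k[x] and k[x'] respectively, where x and x' are finite sets of variables and k is a field, and let R = k[x]/I, R' = k[x']/I'. If f : L_I → L_{I'} is an isomorphism of partially ordered graphs (an equivalence of lcm-lattices), then b_{R'}(x',z) = f(b_R(x,z)), where f(b_R(x,z)) denotes the result of applying f to the coefficients of b_R(x,z) regarded as a polynomial in z. -/

import Mathlib

noncomputable section
attribute [local instance] Classical.propDecidable

namespace MonomialRings

/-- Monomials in variables indexed by `σ`, represented by their exponent vectors. -/
abbrev Mon (σ : Type*) := σ → ℕ

/-- Two monomials have a non-trivial common factor. -/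
def NCF {σ : Type*} (a b : Mon σ) : Prop := ∃ i, a i ≠ 0 ∧ b i ≠ 0

/-- Adjacency in the graph associated to a set of monomials: edges go between distinct
monomials having a non-trivial common factor. -/
def mAdj {σ : Type*} (a b : Mon σ) : Prop := a ≠ b ∧ NCF a b

/-- `a` and `b` are joined by a path inside `S`. -/
def ConnIn {σ : Type*} (S : Finset (Mon σ)) (a b : Mon σ) : Prop :=
  a ∈ S ∧ b ∈ S ∧ Relation.ReflTransGen (fun u v => u ∈ S ∧ v ∈ S ∧ mAdj u v) a b

/-- A monomial set is connected (in particular nonempty). -/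
def IsConnected {σ : Type*} (S : Finset (Mon σ)) : Prop :=
  S.Nonempty ∧ ∀ a ∈ S, ∀ b ∈ S, ConnIn S a b

/-- The connected component of `a` in `S`. -/
def compOf {σ : Type*} (S : Finset (Mon σ)) (a : Mon σ) : Finset (Mon σ) :=
  S.filter (fun b => ConnIn S a b)

/-- The set of connected components of a monomial set. -/
def components {σ : Type*} (S : Finset (Mon σ)) : Finset (Finset (Mon σ)) :=
  S.image (compOf S)

/-- The number of connected components of a monomial set. -/
def ncomp {σ : Type*} (S : Finset (Mon σ)) : ℕ := (components S).card

/-- The least common multiple `m_S` of a finite set of monomials (`m_∅ = 1`). -/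
def mlcm {σ : Type*} (S : Finset (Mon σ)) : Mon σ := S.sup id

/-- `S` is saturated in `M`: for all `m ∈ M` and every connected subset `T ⊆ S`,
`m ∣ m_T` implies `m ∈ S`. -/
def Saturated {σ : Type*} (M S : Finset (Mon σ)) : Prop :=
  S ⊆ M ∧ ∀ m ∈ M, ∀ T ⊆ S, IsConnected T → m ≤ mlcm T → m ∈ S

/-- The set `sat M` of non-empty saturated subsets of `M`. -/
def satSets {σ : Type*} (M : Finset (Mon σ)) : Finset (Finset (Mon σ)) :=
  M.powerset.filter (fun S => S.Nonempty ∧ Saturated M S)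

/-- The saturation `S̄` of `S` in `M`. -/
def saturation {σ : Type*} (M S : Finset (Mon σ)) : Finset (Mon σ) :=
  M.filter (fun m => ∃ C ∈ components S, m ≤ mlcm C)

/-- The simplicial complex `Δ'_S`: faces are the `T ⊆ S` with `m_T ≠ m_S`, or such that
`S_i ∩ T` is disconnected for some connected component `S_i` of `S`. -/
def dprime {σ : Type*} (S : Finset (Mon σ)) : Set (Finset (Mon σ)) :=
  {T | T ⊆ S ∧ (mlcm T ≠ mlcm S ∨ ∃ C ∈ components S, ¬ IsConnected (C ∩ T))}

/-- The simplicial complex `Δ_N`: faces are the `S ⊆ N` with `m_S ≠ m_N` or `S`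
disconnected. -/
def dcomplex {σ : Type*} (N : Finset (Mon σ)) : Set (Finset (Mon σ)) :=
  {T | T ⊆ N ∧ (mlcm T ≠ mlcm N ∨ ¬ IsConnected T)}

/-- A discrete monomial set: the monomials are pairwise without common factors. -/
def Discrete {σ : Type*} (S : Finset (Mon σ)) : Prop :=
  ∀ a ∈ S, ∀ b ∈ S, a ≠ b → ¬ NCF a b

/-- The lcm-lattice of the monomial set `M` (as a finite set of monomials,
ordered by divisibility i.e. by `≤` on exponent vectors). -/
def lcmLattice {σ : Type*} (M : Finset (Mon σ)) : Finset (Mon σ) :=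
  M.powerset.image mlcm

/-- `M_l`: the set of monomials in `M` dividing the monomial `l`. -/
def divisorsIn {σ : Type*} (M : Finset (Mon σ)) (l : Mon σ) : Finset (Mon σ) :=
  M.filter (fun m => m ≤ l)

/-- `M_N`: the set of monomials in `M` dividing some monomial of `N`. -/
def divisorsInSet {σ : Type*} (M N : Finset (Mon σ)) : Finset (Mon σ) :=
  M.filter (fun m => ∃ l ∈ N, m ≤ l)

/-- An antichain of monomials (the minimal generating set of the monomial ideal
it generates). -/
def IsAntichain' {σ : Type*} (M : Finset (Mon σ)) : Prop :=
  ∀ m ∈ M, ∀ n ∈ M, m ≤ n → m = n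

/-- total degree of a monomial -/
def mdeg {t : ℕ} (m : Mon (Fin t)) : ℕ := ∑ i, m i

end MonomialRings
namespace MonomialRings

/-! ### The multigraded Poincaré series, via the bar resolution

For a monomial ring `R = k[x₁,…,x_t]/I`, the multigraded vector spaces `Tor^R_{i,α}(k,k)`
are computed by the (normalized) bar resolution of `k` over `R`.  The monomial ring is
determined by the set `J` of exponents of monomials lying in `I`; `R` has `k`-basis the
monomials `x^β` with `β ∉ J`, and the degree-`(i,α)` part of the bar complex has basis the
lists `[β₁,…,β_i]` of nonzero exponent vectors not in `J` with `β₁ + ⋯ + β_i = α`. -/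

/-- Lists forming the basis of the multigraded piece of the bar complex. -/
def barBasis {σ : Type*} (J : Set (Mon σ)) (i : ℕ) (α : Mon σ) : Set (List (Mon σ)) :=
  {l | l.length = i ∧ l.sum = α ∧ ∀ β ∈ l, β ≠ 0 ∧ β ∉ J}

/-- Merging the entries at positions `j` and `j+1` of a list. -/
def mergeAt {σ : Type*} (l : List (Mon σ)) (j : ℕ) : List (Mon σ) :=
  l.take j ++ [l.getD j 0 + l.getD (j + 1) 0] ++ l.drop (j + 2)

/-- The bar differential on a basis element. -/
def barAux (k : Type*) [Field k] {σ : Type*} (J : Set (Mon σ)) (l : List (Mon σ)) :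
    List (Mon σ) →₀ k :=
  ∑ j ∈ Finset.range (l.length - 1),
    if l.getD j 0 + l.getD (j + 1) 0 ∉ J then
      ((-1 : k) ^ (j + 1)) • Finsupp.single (mergeAt l j) (1 : k)
    else 0

/-- The bar differential. -/
def barD (k : Type*) [Field k] {σ : Type*} (J : Set (Mon σ)) :
    (List (Mon σ) →₀ k) →ₗ[k] (List (Mon σ) →₀ k) :=
  Finsupp.linearCombination k (barAux k J)

/-- The degree-`(i,α)` part of the bar complex. -/
def barSub (k : Type*) [Field k] {σ : Type*} (J : Set (Mon σ)) (i : ℕ) (α : Mon σ) :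
    Submodule k (List (Mon σ) →₀ k) :=
  Submodule.span k ((fun l => Finsupp.single l (1 : k)) '' barBasis J i α)

/-- `dim_k Tor^R_{i,α}(k,k)` for the monomial ring `R` determined by `J`. -/
def torDim (k : Type*) [Field k] {σ : Type*} (J : Set (Mon σ)) (i : ℕ) (α : Mon σ) : ℕ :=
  Module.finrank k ↥(barSub k J i α ⊓ LinearMap.ker (barD k J))
    - Module.finrank k ↥(Submodule.map (barD k J) (barSub k J (i + 1) α))

/-- The set of exponent vectors of monomials lying in the ideal `I`. -/
def expSet {t : ℕ} {k : Type*} [Field k] (I : Ideal (MvPolynomial (Fin t) k)) :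
    Set (Mon (Fin t)) :=
  {β | MvPolynomial.monomial (Finsupp.equivFunOnFinite.symm β) (1 : k) ∈ I}

/-- The exponent (in `ℕ^t × ℕ`) of the monomial `x^α z^d`; the extra variable `none`
is the homological variable `z`. -/
def expOf {t : ℕ} (α : Mon (Fin t)) (d : ℕ) : Option (Fin t) →₀ ℕ :=
  Finsupp.equivFunOnFinite.symm (fun o => Option.elim o d α)

/-- The multigraded Poincaré series
`P^R_k(x,z) = ∑_{i,α} dim_k Tor^R_{i,α}(k,k) x^α z^i` of the monomial ring `R`
determined by `J`, as a formal power series in `x₁,…,x_t` and `z` (the variable `none`). -/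
def poincareSeries (k : Type*) [Field k] {t : ℕ} (J : Set (Mon (Fin t))) :
    MvPowerSeries (Option (Fin t)) ℤ :=
  fun e => (torDim k J (e none) (fun i => e (some i)) : ℤ)

/-- The statement that `b` is the Backelin denominator of the Poincaré series:
`P^R_k(x,z) = ∏ᵢ(1+xᵢz) / b(x,z)`. -/
def IsDenominator (k : Type*) [Field k] {t : ℕ} (J : Set (Mon (Fin t)))
    (b : MvPolynomial (Option (Fin t)) ℤ) : Prop :=
  (b : MvPowerSeries (Option (Fin t)) ℤ) * poincareSeries k J
    = ∏ i : Fin t, (1 + MvPowerSeries.X (some i) * MvPowerSeries.X none)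

/-- The multigraded ideal of a monomial set: the exponents `β` with `x^m ∣ x^β` for some
`m ∈ M`. -/
def upperSet {σ : Type*} (M : Finset (Mon σ)) : Set (Mon σ) :=
  {β | ∃ m ∈ M, m ≤ β}

/-- `I` is the monomial ideal generated by the monomial set `M`. -/
def IsMonomialIdealOf {t : ℕ} {k : Type*} [Field k] (M : Finset (Mon (Fin t)))
    (I : Ideal (MvPolynomial (Fin t) k)) : Prop :=
  I = Ideal.span ((fun m => MvPolynomial.monomial (Finsupp.equivFunOnFinite.symm m) (1 : k)) '' ↑M)

/-- The specialization `b(z) = b(1,…,1,z)` of a polynomial in `x₁,…,x_t,z`. -/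
def zSpecialize {t : ℕ} (b : MvPolynomial (Option (Fin t)) ℤ) : Polynomial ℤ :=
  MvPolynomial.aeval (fun o : Option (Fin t) => Option.elim o Polynomial.X (fun _ => 1)) b

end MonomialRings
namespace MonomialRings

/-- `f` is an equivalence of lcm-lattices: a bijection `L_M → L_N` which is simultaneously
an isomorphism of posets (divisibility) and of graphs (non-trivial common factors). -/
def IsEquivalence {σ σ' : Type*} (M : Finset (Mon σ)) (N : Finset (Mon σ'))
    (f : Mon σ → Mon σ') : Prop :=
  Set.BijOn f ↑(lcmLattice M) ↑(lcmLattice N) ∧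
    (∀ a ∈ lcmLattice M, ∀ b ∈ lcmLattice M, a ≤ b ↔ f a ≤ f b) ∧
    (∀ a ∈ lcmLattice M, ∀ b ∈ lcmLattice M, mAdj a b ↔ mAdj (f a) (f b))

end MonomialRings
namespace MonomialRings

/-- The result of applying `f` to the coefficients of a polynomial in `x` and `z`,
regarded as a polynomial in `z` whose coefficients are `ℤ`-linear combinations of
monomials `x^α`: every monomial `x^α z^d` is replaced by `f(x^α) z^d`. -/
def applyEquiv {t t' : ℕ} (f : Mon (Fin t) → Mon (Fin t'))
    (b : MvPolynomial (Option (Fin t)) ℤ) : MvPolynomial (Option (Fin t')) ℤ :=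
  ∑ e ∈ b.support,
    MvPolynomial.monomial (expOf (f (fun i => e (some i))) (e none)) (b.coeff e)

end MonomialRings
namespace MonomialRings

section LinearAlgebra
variable {k : Type*} [Field k]

/-- The dimension of the homology in degree `i` of the graded subspaces `C` under `D`. -/
def homDim {E : Type*} [AddCommGroup E] [Module k E] (C : ℕ → Submodule k E) (D : E →ₗ[k] E)
    (i : ℕ) : ℕ :=
  Module.finrank k ↥(C i ⊓ LinearMap.ker D) - Module.finrank k ↥(Submodule.map D (C (i + 1)))

theorem finrank_map_add_inf_ker {E E' : Type*} [AddCommGroup E] [Module k E] [AddCommGroup E']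
    [Module k E'] (p : E →ₗ[k] E') (Z : Submodule k E) [FiniteDimensional k Z] :
    Module.finrank k ↥(Z.map p) + Module.finrank k ↥(Z ⊓ LinearMap.ker p) =
      Module.finrank k Z := by
  have h := LinearMap.finrank_range_add_finrank_ker (p.domRestrict Z)
  have h1 : LinearMap.range (p.domRestrict Z) = Z.map p := LinearMap.range_domRestrict Z p
  have h2 : (LinearMap.ker (p.domRestrict Z)).map Z.subtype = Z ⊓ LinearMap.ker p := by
    ext x
    simp only [Submodule.mem_map, LinearMap.mem_ker, Submodule.mem_inf]
    constructor
    · rintro ⟨y, hy, rfl⟩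
      exact ⟨y.2, hy⟩
    · rintro ⟨hx, hp⟩
      exact ⟨⟨x, hx⟩, hp, rfl⟩
  rw [← h, h1, ← h2, Submodule.finrank_map_subtype_eq]

/-- A surjective chain map whose kernel is exact preserves the dimensions of homology. -/
theorem homDim_eq_of_exact {E E' : Type*} [AddCommGroup E] [Module k E] [AddCommGroup E']
    [Module k E'] {C : ℕ → Submodule k E} {D : E →ₗ[k] E} {C' : ℕ → Submodule k E'}
    {D' : E' →ₗ[k] E'} (p : E →ₗ[k] E') (hfin : ∀ i, FiniteDimensional k (C i))
    (hD : ∀ i, ∀ c ∈ C (i + 1), D c ∈ C i) (hD0 : ∀ c ∈ C 0, D c = 0)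
    (hDD : ∀ i, ∀ c ∈ C i, D (D c) = 0) (hp : ∀ i, (C i).map p = C' i)
    (hcomm : ∀ i, ∀ c ∈ C i, p (D c) = D' (p c))
    (hex : ∀ i, ∀ c ∈ C i, D c = 0 → p c = 0 → ∃ e ∈ C (i + 1), p e = 0 ∧ D e = c) (i : ℕ) :
    homDim C D i = homDim C' D' i := by
  have hZ : (C i ⊓ LinearMap.ker D).map p = C' i ⊓ LinearMap.ker D' := by
    ext x
    simp only [Submodule.mem_map, Submodule.mem_inf, LinearMap.mem_ker]
    constructor
    · rintro ⟨c, ⟨hc, hDc⟩, rfl⟩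
      exact ⟨hp i ▸ Submodule.mem_map_of_mem hc, by rw [← hcomm i c hc, hDc, map_zero]⟩
    · rintro ⟨hx, hDx⟩
      rw [← hp i] at hx
      obtain ⟨c, hc, rfl⟩ := hx
      rw [← hcomm i c hc] at hDx
      cases i with
      | zero => exact ⟨c, ⟨hc, hD0 c hc⟩, rfl⟩
      | succ i =>
        obtain ⟨e, he, hpe, hDe⟩ := hex i (D c) (hD i c hc) (hDD _ c hc) hDx
        exact ⟨c - e, ⟨Submodule.sub_mem _ hc he, by rw [map_sub, hDe, sub_self]⟩,
          by rw [map_sub, hpe, sub_zero]⟩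
  have hB : ((C (i + 1)).map D).map p = (C' (i + 1)).map D' := by
    rw [← hp (i + 1)]
    ext x
    simp only [Submodule.mem_map]
    constructor
    · rintro ⟨_, ⟨c, hc, rfl⟩, rfl⟩
      exact ⟨p c, ⟨c, hc, rfl⟩, (hcomm _ c hc).symm⟩
    · rintro ⟨_, ⟨c, hc, rfl⟩, rfl⟩
      exact ⟨D c, ⟨c, hc, rfl⟩, hcomm _ c hc⟩
  have hK : (C i ⊓ LinearMap.ker D) ⊓ LinearMap.ker p = (C (i + 1)).map D ⊓ LinearMap.ker p := by
    ext x
    simp only [Submodule.mem_map, Submodule.mem_inf, LinearMap.mem_ker]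
    constructor
    · rintro ⟨⟨hx, hDx⟩, hpx⟩
      obtain ⟨e, he, -, hDe⟩ := hex i x hx hDx hpx
      exact ⟨⟨e, he, hDe⟩, hpx⟩
    · rintro ⟨⟨e, he, rfl⟩, hpx⟩
      exact ⟨⟨hD i e he, hDD _ e he⟩, hpx⟩
  have := hfin i
  have := hfin (i + 1)
  have h1 := finrank_map_add_inf_ker p (C i ⊓ LinearMap.ker D)
  have h2 := finrank_map_add_inf_ker p ((C (i + 1)).map D)
  rw [hZ, hK] at h1
  rw [hB] at h2
  unfold homDim
  omega

/-- Exactness from an acyclic matching `R` (with `R u v` meaning that `u` is matched to `v` in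
the boundary of `u`). -/
theorem exact_of_matching {X ρ : Type*} [LinearOrder ρ] [WellFoundedLT ρ]
    (D : (X →₀ k) →ₗ[k] (X →₀ k)) (K : ℕ → Set X) (R : X → X → Prop) (rank : X → ρ)
    (hD : ∀ i, ∀ c ∈ Finsupp.supported k k (K (i + 1)), D c ∈ Finsupp.supported k k (K i))
    (hDD : ∀ i, ∀ c ∈ Finsupp.supported k k (K i), D (D c) = 0)
    (htot : ∀ i, ∀ x ∈ K i, (∃ y ∈ K (i + 1), R y x) ∨ ∃ y, R x y)
    (hinj : ∀ i, ∀ u ∈ K i, ∀ u' ∈ K i, ∀ v, R u v → R u' v → u = u')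
    (hne : ∀ i, ∀ u ∈ K i, ∀ v, R u v → D (Finsupp.single u 1) v ≠ 0)
    (hrank : ∀ i, ∀ u ∈ K i, ∀ u' ∈ K i, ∀ v v', R u v → R u' v' → v' ≠ v →
      D (Finsupp.single u 1) v' ≠ 0 → rank u' < rank u)
    (i : ℕ) (c : X →₀ k) (hc : c ∈ Finsupp.supported k k (K i)) (hDc : D c = 0) :
    ∃ e ∈ Finsupp.supported k k (K (i + 1)), D e = c := by
  let N : Submodule k (X →₀ k) :=
    { carrier := {c | ∃ e ∈ Finsupp.supported k k (K (i + 1)),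
        ∀ v, (∃ u ∈ K (i + 1), R u v) → D e v = c v}
      zero_mem' := ⟨0, Submodule.zero_mem _, by simp⟩
      add_mem' := by
        rintro a b ⟨e, he, h⟩ ⟨e', he', h'⟩
        exact ⟨e + e', Submodule.add_mem _ he he', fun v hv => by simp [h v hv, h' v hv]⟩
      smul_mem' := by
        rintro a b ⟨e, he, h⟩
        exact ⟨a • e, Submodule.smul_mem _ _ he, fun v hv => by simp [h v hv]⟩ }
  have hdown : ∀ r : ρ, ∀ u ∈ K (i + 1), rank u = r → ∀ v, R u v →
      Finsupp.single v (1 : k) ∈ N := by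
    intro r
    induction r using WellFoundedLT.induction with
    | ind r ih =>
      intro u hu hr v huv
      have hsu : Finsupp.single u (1 : k) ∈ Finsupp.supported k k (K (i + 1)) :=
        Finsupp.single_mem_supported k 1 hu
      have h1 : D (Finsupp.single u 1) ∈ N := ⟨_, hsu, fun _ _ => rfl⟩
      have h2 : (D (Finsupp.single u 1)).erase v ∈ N := by
        rw [← Finsupp.sum_single ((D (Finsupp.single u 1)).erase v)]
        refine Submodule.sum_mem _ fun v' hv' => ?_
        rw [Finsupp.support_erase, Finset.mem_erase, Finsupp.mem_support_iff] at hv'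
        rw [← mul_one (Finsupp.erase v _ v'), ← smul_eq_mul, ← Finsupp.smul_single]
        refine Submodule.smul_mem _ _ ?_
        by_cases hd : ∃ u' ∈ K (i + 1), R u' v'
        · obtain ⟨u', hu', huv'⟩ := hd
          exact ih _ (hr ▸ hrank _ u hu u' hu' v v' huv huv' hv'.1 hv'.2) u' hu' rfl v' huv'
        · refine ⟨0, Submodule.zero_mem _, fun w hw => ?_⟩
          have : v' ≠ w := by
            rintro rfl
            exact hd hw
          simp [this]
      have h3 := Submodule.sub_mem _ h1 h2
      have h4 : D (Finsupp.single u 1) - (D (Finsupp.single u 1)).erase v =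
          D (Finsupp.single u 1) v • Finsupp.single v 1 := by
        rw [sub_eq_iff_eq_add, Finsupp.smul_single, smul_eq_mul, mul_one,
          Finsupp.single_add_erase]
      rw [h4] at h3
      exact (Submodule.smul_mem_iff _ (hne _ u hu v huv)).1 h3
  have hall : ∀ v, Finsupp.single v (1 : k) ∈ N := by
    intro v
    by_cases hd : ∃ u ∈ K (i + 1), R u v
    · obtain ⟨u, hu, huv⟩ := hd
      exact hdown _ u hu rfl v huv
    · refine ⟨0, Submodule.zero_mem _, fun w hw => ?_⟩
      have : v ≠ w := by
        rintro rfl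
        exact hd hw
      simp [this]
  have hcN : c ∈ N := by
    rw [← Finsupp.sum_single c]
    refine Submodule.sum_mem _ fun v _ => ?_
    rw [← mul_one (c v), ← smul_eq_mul, ← Finsupp.smul_single]
    exact Submodule.smul_mem _ _ (hall v)
  obtain ⟨e, he, hec⟩ := hcN
  refine ⟨e, he, ?_⟩
  by_contra hne'
  have hg : c - D e ≠ 0 := fun h => hne' (sub_eq_zero.1 h).symm
  set g := c - D e with hgdef
  have hgK : g ∈ Finsupp.supported k k (K i) := Submodule.sub_mem _ hc (hD i e he)
  have hDg : D g = 0 := by rw [hgdef, map_sub, hDc, hDD _ e he, sub_zero]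
  have hup : ∀ u ∈ g.support, u ∈ K i ∧ ∃ v, R u v := by
    intro u hu
    have huK : u ∈ K i := (Finsupp.mem_supported k g).1 hgK hu
    refine ⟨huK, ?_⟩
    rcases htot i u huK with h | h
    · rw [Finsupp.mem_support_iff] at hu
      exact absurd (by simp [hgdef, hec u h]) hu
    · exact h
  obtain ⟨u, hu, hmax⟩ := Finset.exists_max_image g.support rank
    (Finsupp.support_nonempty_iff.2 hg)
  obtain ⟨huK, v, huv⟩ := hup u hu
  have h0 : D g v = 0 := by rw [hDg]; rfl
  have hsum : D g v = ∑ w ∈ g.support, g w * D (Finsupp.single w 1) v := by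
    conv_lhs => rw [← Finsupp.sum_single g]
    rw [Finsupp.sum, map_sum, Finsupp.finsetSum_apply]
    refine Finset.sum_congr rfl fun w _ => ?_
    rw [← mul_one (g w), ← smul_eq_mul, ← Finsupp.smul_single, map_smul]
    simp
  rw [hsum, Finset.sum_eq_single u] at h0
  · rcases mul_eq_zero.1 h0 with h | h
    · exact Finsupp.mem_support_iff.1 hu h
    · exact hne i u huK v huv h
  · intro w hw hwu
    obtain ⟨hwK, v', hwv⟩ := hup w hw
    by_contra hcon
    have hco := right_ne_zero_of_mul hcon
    by_cases hvv : v = v'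
    · subst hvv
      exact hwu (hinj i w hwK u huK v hwv huv)
    · exact absurd (hrank i w hwK u huK v' v hwv huv hvv hco) (not_lt.2 (hmax w hw))
  · intro h
    exact absurd hu h

end LinearAlgebra

section BarConstruction
variable {k : Type*} [Field k] {X : Type*}

/-- Structure constants of a differential graded algebra with basis `X`. -/
structure BarData (k X : Type*) [Field k] where
  /-- The internal differential. -/
  d : X → X →₀ k
  /-- The sign of a basis element. -/
  sg : X → k
  /-- The product of basis elements. -/
  mul : X → X → X →₀ k

namespace BarData
variable (A : BarData k X)

/-- The internal differential as a linear map. -/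
def dL : (X →₀ k) →ₗ[k] (X →₀ k) := Finsupp.linearCombination k A.d

/-- The sign as a linear map. -/
def sL : (X →₀ k) →ₗ[k] (X →₀ k) :=
  Finsupp.linearCombination k fun a => Finsupp.single a (A.sg a)

/-- The product as a bilinear map. -/
def mulL : (X →₀ k) →ₗ[k] (X →₀ k) →ₗ[k] (X →₀ k) :=
  Finsupp.linearCombination k fun a => Finsupp.linearCombination k (A.mul a)

variable (k X) in
/-- Prepending a letter, as a bilinear map. -/
def consL : (X →₀ k) →ₗ[k] (List X →₀ k) →ₗ[k] (List X →₀ k) :=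
  Finsupp.linearCombination k fun a => Finsupp.lmapDomain k k (List.cons a)

/-- Multiplying a letter into the first letter of a word. -/
def starAux (a : X) : List X → List X →₀ k
  | [] => 0
  | b :: w => consL k X (A.mul a b) (Finsupp.single w 1)

/-- Multiplying into the first letter of a word, as a bilinear map. -/
def starL : (X →₀ k) →ₗ[k] (List X →₀ k) →ₗ[k] (List X →₀ k) :=
  Finsupp.linearCombination k fun a => Finsupp.linearCombination k (A.starAux a)

/-- The bar differential of a word. -/
def BD : List X → List X →₀ k
  | [] => 0
  | a :: w => -consL k X (A.d a) (Finsupp.single w 1) + A.sg a • A.starAux a w +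
      A.sg a • consL k X (Finsupp.single a 1) (BD w)

/-- The bar differential. -/
def D : (List X →₀ k) →ₗ[k] (List X →₀ k) := Finsupp.linearCombination k A.BD

/-- The laws of a differential graded algebra with shifted signs. -/
structure Laws : Prop where
  dd : ∀ a, A.dL (A.d a) = 0
  sg_sg : ∀ a, A.sg a * A.sg a = 1
  sg_d : ∀ a, A.sL (A.d a) = -(A.sg a • A.d a)
  sg_mul : ∀ a b, A.sL (A.mul a b) = -((A.sg a * A.sg b) • A.mul a b)
  leibniz : ∀ a b, A.dL (A.mul a b) =
    A.mulL (A.d a) (Finsupp.single b 1) - A.sg a • A.mulL (Finsupp.single a 1) (A.d b)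
  assoc : ∀ a b c, A.mulL (A.mul a b) (Finsupp.single c 1) =
    A.mulL (Finsupp.single a 1) (A.mul b c)

@[simp] theorem dL_single (a : X) (r : k) : A.dL (Finsupp.single a r) = r • A.d a := by
  simp [dL]

@[simp] theorem sL_single (a : X) (r : k) :
    A.sL (Finsupp.single a r) = r • Finsupp.single a (A.sg a) := by
  simp [sL]

@[simp] theorem mulL_single (a b : X) (r s : k) :
    A.mulL (Finsupp.single a r) (Finsupp.single b s) = r • s • A.mul a b := by
  simp [mulL]

@[simp] theorem consL_single (a : X) (w : List X) (r s : k) :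
    consL k X (Finsupp.single a r) (Finsupp.single w s) = Finsupp.single (a :: w) (r * s) := by
  simp [consL]

@[simp] theorem starL_single (a : X) (w : List X) (r s : k) :
    A.starL (Finsupp.single a r) (Finsupp.single w s) = r • s • A.starAux a w := by
  simp [starL]

@[simp] theorem D_single (w : List X) (r : k) :
    A.D (Finsupp.single w r) = r • A.BD w := by
  simp [D]

theorem starL_nil (x : X →₀ k) (r : k) : A.starL x (Finsupp.single [] r) = 0 := by
  induction x using Finsupp.induction_linear with
  | zero => simp
  | add x y hx hy => simp [hx, hy]
  | single a r => simp [starAux]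

theorem starL_cons (x y : X →₀ k) (V : List X →₀ k) :
    A.starL x (consL k X y V) = consL k X (A.mulL x y) V := by
  induction x using Finsupp.induction_linear with
  | zero => simp
  | add x y hx hy => simp [hx, hy]
  | single a r =>
    induction y using Finsupp.induction_linear with
    | zero => simp
    | add x y hx hy => simp [hx, hy]
    | single b s =>
      induction V using Finsupp.induction_linear with
      | zero => simp
      | add x y hx hy => simp only [map_add, hx, hy]
      | single w t =>
        have : Finsupp.single w t = t • Finsupp.single w (1 : k) := by simp
        rw [this, map_smul, map_smul, map_smul]
        simp [starAux]

theorem D_cons (x : X →₀ k) (V : List X →₀ k) :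
    A.D (consL k X x V) = -consL k X (A.dL x) V + A.starL (A.sL x) V
      + consL k X (A.sL x) (A.D V) := by
  induction x using Finsupp.induction_linear with
  | zero => simp
  | add x y hx hy => simp only [map_add, LinearMap.add_apply, hx, hy]; abel
  | single a r =>
    induction V using Finsupp.induction_linear with
    | zero => simp
    | add x y hx hy => simp only [map_add, hx, hy]; abel
    | single w t =>
      have h1 : Finsupp.single w t = t • Finsupp.single w (1 : k) := by simp
      have h2 : Finsupp.single a r = r • Finsupp.single a (1 : k) := by simp
      have h3 : Finsupp.single a (A.sg a) = A.sg a • Finsupp.single a (1 : k) := by simp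
      rw [h1, h2]
      simp only [map_smul, LinearMap.smul_apply, consL_single, D_single, dL_single, sL_single,
        one_smul, mul_one, BD, h3, starL_single, smul_add, smul_neg]

variable {A}

theorem Laws.dL_dL (h : A.Laws) (x : X →₀ k) : A.dL (A.dL x) = 0 := by
  induction x using Finsupp.induction_linear with
  | zero => simp
  | add x y hx hy => simp [hx, hy]
  | single a r => simp [h.dd]

theorem Laws.sL_sL (h : A.Laws) (x : X →₀ k) : A.sL (A.sL x) = x := by
  induction x using Finsupp.induction_linear with
  | zero => simp
  | add x y hx hy => simp [hx, hy]
  | single a r =>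
    rw [sL_single, map_smul, sL_single, Finsupp.smul_single, Finsupp.smul_single, smul_eq_mul,
      smul_eq_mul, h.sg_sg, mul_one]

theorem Laws.sL_dL (h : A.Laws) (x : X →₀ k) : A.sL (A.dL x) = -A.dL (A.sL x) := by
  induction x using Finsupp.induction_linear with
  | zero => simp
  | add x y hx hy => simp [hx, hy]; abel
  | single a r => simp only [dL_single, map_smul, h.sg_d, sL_single, smul_neg]

theorem Laws.sL_mulL (h : A.Laws) (x y : X →₀ k) :
    A.sL (A.mulL x y) = -A.mulL (A.sL x) (A.sL y) := by
  induction x using Finsupp.induction_linear with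
  | zero => simp
  | add x y hx hy => simp [hx, hy]; abel
  | single a r =>
    induction y using Finsupp.induction_linear with
    | zero => simp
    | add x y hx hy => simp [hx, hy]; abel
    | single b s =>
      simp only [mulL_single, map_smul, h.sg_mul, sL_single, smul_neg, LinearMap.smul_apply,
        smul_smul]
      ring_nf

theorem Laws.dL_mulL (h : A.Laws) (x y : X →₀ k) :
    A.dL (A.mulL x y) = A.mulL (A.dL x) y - A.mulL (A.sL x) (A.dL y) := by
  induction x using Finsupp.induction_linear with
  | zero => simp
  | add x y hx hy => simp [hx, hy]; abel
  | single a r =>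
    induction y using Finsupp.induction_linear with
    | zero => simp
    | add x y hx hy => simp [hx, hy]; abel
    | single b s =>
      have h1 : Finsupp.single b s = s • Finsupp.single b (1 : k) := by simp
      have h2 : Finsupp.single a r = r • Finsupp.single a (1 : k) := by simp
      have h3 : Finsupp.single a (A.sg a) = A.sg a • Finsupp.single a (1 : k) := by simp
      rw [h1, h2]
      simp only [mulL_single, map_smul, LinearMap.smul_apply, one_smul, h.leibniz, dL_single,
        sL_single, h3, smul_sub]

theorem Laws.mulL_assoc (h : A.Laws) (x y z : X →₀ k) :
    A.mulL (A.mulL x y) z = A.mulL x (A.mulL y z) := by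
  induction x using Finsupp.induction_linear with
  | zero => simp
  | add x y hx hy => simp [hx, hy]
  | single a r =>
    induction y using Finsupp.induction_linear with
    | zero => simp
    | add x y hx hy => simp [hx, hy]
    | single b s =>
      induction z using Finsupp.induction_linear with
      | zero => simp
      | add x y hx hy => simp only [map_add, hx, hy]
      | single c t =>
        have h1 : Finsupp.single c t = t • Finsupp.single c (1 : k) := by simp
        have h2 : Finsupp.single a r = r • Finsupp.single a (1 : k) := by simp
        rw [h1, h2]
        simp only [mulL_single, map_smul, LinearMap.smul_apply, one_smul, h.assoc]
        simp only [smul_smul, mul_comm, mul_left_comm]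

theorem word_induction {P : (List X →₀ k) → Prop} (V : List X →₀ k) (h0 : P 0)
    (hadd : ∀ U V, P U → P V → P (U + V)) (hnil : ∀ r, P (Finsupp.single [] r))
    (hcons : ∀ a w, P (Finsupp.single w 1) → ∀ r, P (consL k X (Finsupp.single a r)
      (Finsupp.single w 1))) : P V := by
  induction V using Finsupp.induction_linear with
  | zero => exact h0
  | add U V hU hV => exact hadd U V hU hV
  | single w r =>
    induction w generalizing r with
    | nil => exact hnil r
    | cons a w ih => simpa using hcons a w (ih 1) r

theorem Laws.starL_starL (h : A.Laws) (x y : X →₀ k) (V : List X →₀ k) :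
    A.starL x (A.starL y V) = A.starL (A.mulL x y) V := by
  induction V using word_induction with
  | h0 => simp
  | hadd U V hU hV => simp only [map_add, hU, hV]
  | hnil r => simp [starL_nil]
  | hcons a w _ r => rw [starL_cons, starL_cons, starL_cons, h.mulL_assoc]

theorem D_nil (r : k) : A.D (Finsupp.single [] r) = 0 := by simp [BD]

theorem Laws.D_starL (h : A.Laws) (x : X →₀ k) (V : List X →₀ k) :
    A.D (A.starL x V) = -A.starL (A.dL x) V - A.starL (A.sL x) (A.D V) := by
  induction V using word_induction with
  | h0 => simp
  | hadd U V hU hV => simp only [map_add, hU, hV]; abel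
  | hnil r => simp only [starL_nil, D_nil, map_zero, neg_zero, sub_zero]
  | hcons a w _ r =>
    rw [starL_cons, D_cons, D_cons, starL_cons, h.dL_mulL, h.sL_mulL]
    simp only [map_add, map_sub, map_neg, starL_cons, h.starL_starL, LinearMap.sub_apply,
      LinearMap.neg_apply]
    abel

/-- The bar differential squares to zero. -/
theorem Laws.D_D (h : A.Laws) (V : List X →₀ k) : A.D (A.D V) = 0 := by
  induction V using word_induction with
  | h0 => simp
  | hadd U V hU hV => simp only [map_add, hU, hV, add_zero]
  | hnil r => rw [D_nil, map_zero]
  | hcons a w ih r =>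
    rw [D_cons]
    simp only [map_add, map_neg, D_cons, h.D_starL, h.dL_dL, h.sL_dL, h.sL_sL, ih, map_zero,
      LinearMap.neg_apply, LinearMap.zero_apply]
    abel

variable (A) in
/-- The words which can occur in the bar differential of a word. -/
inductive Step : List X → List X → Prop
  | int {a b : X} (w : List X) (h : A.d a b ≠ 0) : Step (a :: w) (b :: w)
  | mul {a b c : X} (w : List X) (h : A.mul a b c ≠ 0) : Step (a :: b :: w) (c :: w)
  | cons (a : X) {w v : List X} (h : Step w v) : Step (a :: w) (a :: v)

theorem consL_apply_nil (x : X →₀ k) (V : List X →₀ k) : consL k X x V [] = 0 := by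
  induction x using Finsupp.induction_linear with
  | zero => simp
  | add x y hx hy => simp [hx, hy]
  | single a r =>
    induction V using Finsupp.induction_linear with
    | zero => simp
    | add x y hx hy => simp [hx, hy]
    | single w t => simp

theorem consL_apply_cons (x : X →₀ k) (V : List X →₀ k) (b : X) (v : List X) :
    consL k X x V (b :: v) = x b * V v := by
  induction x using Finsupp.induction_linear with
  | zero => simp
  | add x y hx hy => simp [hx, hy, add_mul]
  | single a r =>
    induction V using Finsupp.induction_linear with
    | zero => simp
    | add x y hx hy => simp [hx, hy, mul_add]
    | single w t =>
      by_cases h1 : a = b <;> by_cases h2 : w = v <;> simp [h1, h2]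

theorem starAux_apply_nil (a : X) (w : List X) : A.starAux a w [] = 0 := by
  cases w <;> simp [starAux, consL_apply_nil]

theorem BD_apply_nil (w : List X) : A.BD w [] = 0 := by
  cases w <;> simp [BD, consL_apply_nil, starAux_apply_nil]

theorem BD_apply_cons (a b : X) (w v : List X) :
    A.BD (a :: w) (b :: v) = -(A.d a b * Finsupp.single w (1 : k) v) +
      A.sg a * A.starAux a w (b :: v) + A.sg a * (Finsupp.single a (1 : k) b * A.BD w v) := by
  simp [BD, consL_apply_cons]

theorem starAux_apply_cons (a b c : X) (w v : List X) :
    A.starAux a (b :: w) (c :: v) = A.mul a b c * Finsupp.single w (1 : k) v := by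
  simp [starAux, consL_apply_cons]

theorem Step.of_BD {w v : List X} (h : A.BD w v ≠ 0) : A.Step w v := by
  induction w generalizing v with
  | nil => simp [BD] at h
  | cons a w ih =>
    cases v with
    | nil => exact absurd (BD_apply_nil _) h
    | cons b v =>
      by_contra hs
      apply h
      rw [BD_apply_cons]
      have h1 : A.d a b * Finsupp.single w (1 : k) v = 0 := by
        by_contra h1
        obtain ⟨h2, h3⟩ := mul_ne_zero_iff.1 h1
        obtain rfl : w = v := by
          by_contra h4
          exact h3 (Finsupp.single_eq_of_ne (Ne.symm h4))
        exact hs (.int _ h2)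
      have h2 : A.starAux a w (b :: v) = 0 := by
        cases w with
        | nil => simp [starAux]
        | cons c w =>
          rw [starAux_apply_cons]
          by_contra h1
          obtain ⟨h2, h3⟩ := mul_ne_zero_iff.1 h1
          obtain rfl : w = v := by
            by_contra h4
            exact h3 (Finsupp.single_eq_of_ne (Ne.symm h4))
          exact hs (.mul _ h2)
      have h3 : Finsupp.single a (1 : k) b * A.BD w v = 0 := by
        by_contra h1
        obtain ⟨h2, h3⟩ := mul_ne_zero_iff.1 h1
        obtain rfl : a = b := by
          by_contra h4
          exact h2 (Finsupp.single_eq_of_ne (Ne.symm h4))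
        exact hs (.cons _ (ih h3))
      rw [h1, h2, h3]
      simp

theorem D_apply (c : List X →₀ k) (v : List X) : A.D c v = c.sum fun w r => r * A.BD w v := by
  rw [D, Finsupp.linearCombination_apply, Finsupp.sum_apply]
  rfl

theorem D_mem_supported {K K' : Set (List X)} (h : ∀ w ∈ K, ∀ v, A.Step w v → v ∈ K')
    {c : List X →₀ k} (hc : c ∈ Finsupp.supported k k K) : A.D c ∈ Finsupp.supported k k K' := by
  rw [Finsupp.mem_supported] at hc ⊢
  intro v hv
  rw [Finset.mem_coe, Finsupp.mem_support_iff, D_apply] at hv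
  obtain ⟨w, hw, hwv⟩ := Finset.exists_ne_zero_of_sum_ne_zero hv
  exact h w (hc hw) v (Step.of_BD (right_ne_zero_of_mul hwv))

end BarData
end BarConstruction

section Taylor
variable {k : Type*} [Field k] {σ : Type*}

/-- Letters of the bar construction of the Taylor algebra: a multidegree and an exterior
monomial. -/
abbrev Ltr (σ : Type*) := Mon σ × Finset (Mon σ)

/-- The number of inversions between two finite sets. -/
def inv (o : Mon σ → ℕ) (S U : Finset (Mon σ)) : ℕ :=
  ∑ s ∈ S, ∑ u ∈ U, if o u < o s then 1 else 0

variable {o : Mon σ → ℕ}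

theorem inv_union_left {S S' U : Finset (Mon σ)} (h : Disjoint S S') :
    inv o (S ∪ S') U = inv o S U + inv o S' U := Finset.sum_union h

theorem inv_union_right {S U U' : Finset (Mon σ)} (h : Disjoint U U') :
    inv o S (U ∪ U') = inv o S U + inv o S U' := by
  simp only [inv, Finset.sum_union h, Finset.sum_add_distrib]

theorem inv_erase_left {S U : Finset (Mon σ)} {s : Mon σ} (h : s ∈ S) :
    inv o S U = inv o (S.erase s) U + inv o {s} U := by
  rw [← inv_union_left (by simp)]
  congr 1
  ext x
  by_cases hx : x = s <;> simp [hx, h]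

theorem inv_erase_right {S U : Finset (Mon σ)} {s : Mon σ} (h : s ∈ U) :
    inv o S U = inv o S (U.erase s) + inv o S {s} := by
  rw [← inv_union_right (by simp)]
  congr 1
  ext x
  by_cases hx : x = s <;> simp [hx, h]

theorem inv_add_inv_singleton (ho : Function.Injective o) {s u : Mon σ} (h : s ≠ u) :
    inv o {s} {u} + inv o {u} {s} = 1 := by
  have := ho.ne h
  simp only [inv, Finset.sum_singleton]
  split_ifs <;> omega

theorem inv_self_singleton (s : Mon σ) : inv o {s} {s} = 0 := by simp [inv]

theorem inv_add_inv_mem (ho : Function.Injective o) {S : Finset (Mon σ)} {s : Mon σ}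
    (h : s ∈ S) : inv o {s} S + inv o S {s} + 1 = S.card := by
  have h1 : ∀ T : Finset (Mon σ), s ∉ T → inv o {s} T + inv o T {s} = T.card := by
    intro T hT
    rw [inv, inv, Finset.sum_singleton, Finset.card_eq_sum_ones]
    simp only [Finset.sum_singleton]
    rw [← Finset.sum_add_distrib]
    refine Finset.sum_congr rfl fun u hu => ?_
    have : o u ≠ o s := ho.ne (by rintro rfl; exact hT hu)
    split_ifs <;> omega
  rw [inv_erase_left (S := S) h, inv_erase_right (U := S) h, inv_self_singleton]
  have := h1 (S.erase s) (by simp)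
  have := Finset.card_erase_add_one h
  omega

variable (k o) in
/-- The bar data of the Taylor algebra. -/
def taylor : BarData k (Ltr σ) where
  d a := ∑ s ∈ a.2, Finsupp.single (a.1, a.2.erase s) ((-1 : k) ^ inv o {s} a.2)
  sg a := (-1) ^ (a.2.card + 1)
  mul a b := if Disjoint a.2 b.2 then
    Finsupp.single (a.1 + b.1, a.2 ∪ b.2) ((-1 : k) ^ inv o a.2 b.2) else 0

theorem taylor_d (a : Ltr σ) : (taylor k o).d a =
    ∑ s ∈ a.2, Finsupp.single (a.1, a.2.erase s) ((-1 : k) ^ inv o {s} a.2) := rfl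

theorem taylor_sg (a : Ltr σ) : (taylor k o).sg a = (-1) ^ (a.2.card + 1) := rfl

theorem taylor_mul (a b : Ltr σ) : (taylor k o).mul a b = if Disjoint a.2 b.2 then
    Finsupp.single (a.1 + b.1, a.2 ∪ b.2) ((-1 : k) ^ inv o a.2 b.2) else 0 := rfl

theorem neg_one_pow_cancel {m n : ℕ} (h : (m + n) % 2 = 1) : (-1 : k) ^ m + (-1 : k) ^ n = 0 := by
  rcases Nat.even_or_odd m with hm | hm
  · have hn : Odd n := by rw [Nat.odd_iff]; rw [Nat.even_iff] at hm; omega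
    rw [hm.neg_one_pow, hn.neg_one_pow, add_neg_cancel]
  · have hn : Even n := by rw [Nat.even_iff]; rw [Nat.odd_iff] at hm; omega
    rw [hm.neg_one_pow, hn.neg_one_pow, neg_add_cancel]

theorem neg_one_pow_eq {m n : ℕ} (h : (m + n) % 2 = 0) : (-1 : k) ^ m = (-1 : k) ^ n := by
  rcases Nat.even_or_odd m with hm | hm
  · have hn : Even n := by rw [Nat.even_iff] at *; omega
    rw [hm.neg_one_pow, hn.neg_one_pow]
  · have hn : Odd n := by rw [Nat.odd_iff] at *; omega
    rw [hm.neg_one_pow, hn.neg_one_pow]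

theorem taylor_dd (ho : Function.Injective o) (a : Ltr σ) :
    (taylor k o).dL ((taylor k o).d a) = 0 := by
  obtain ⟨γ, S⟩ := a
  have : (taylor k o).dL ((taylor k o).d (γ, S)) =
      ∑ p ∈ S.sigma fun s => S.erase s, Finsupp.single (γ, (S.erase p.1).erase p.2)
        ((-1 : k) ^ (inv o {p.1} S + inv o {p.2} (S.erase p.1))) := by
    rw [Finset.sum_sigma]
    simp only [taylor, map_sum]
    refine Finset.sum_congr rfl fun s _ => ?_
    rw [BarData.dL_single, Finset.smul_sum]
    refine Finset.sum_congr rfl fun u _ => ?_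
    rw [Finsupp.smul_single, smul_eq_mul, pow_add]
  rw [this]
  refine Finset.sum_involution (fun p _ => ⟨p.2, p.1⟩) ?_ ?_ ?_ ?_
  · rintro ⟨s, u⟩ hp
    simp only [Finset.mem_sigma, Finset.mem_erase] at hp
    have h1 := inv_erase_right (o := o) (S := {u}) hp.1
    have h2 := inv_erase_right (o := o) (S := {s}) hp.2.2
    have h3 := inv_add_inv_singleton ho hp.2.1
    simp only
    rw [Finset.erase_right_comm, ← Finsupp.single_add, neg_one_pow_cancel, Finsupp.single_zero]
    omega
  · rintro ⟨s, u⟩ hp _ h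
    simp only [Finset.mem_sigma, Finset.mem_erase] at hp
    simp only [Sigma.mk.injEq] at h
    exact hp.2.1 h.1
  · rintro ⟨s, u⟩ hp
    simp only [Finset.mem_sigma, Finset.mem_erase] at hp ⊢
    exact ⟨hp.2.2, fun h => hp.2.1 h.symm, hp.1⟩
  · rintro ⟨s, u⟩ hp
    rfl

theorem taylor_leibniz (ho : Function.Injective o) (a b : Ltr σ) :
    (taylor k o).dL ((taylor k o).mul a b) =
      (taylor k o).mulL ((taylor k o).d a) (Finsupp.single b 1) -
        (taylor k o).sg a • (taylor k o).mulL (Finsupp.single a 1) ((taylor k o).d b) := by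
  obtain ⟨γ, S⟩ := a
  obtain ⟨δ, U⟩ := b
  have hL : (taylor k o).mulL ((taylor k o).d (γ, S)) (Finsupp.single (δ, U) 1) =
      ∑ s ∈ S, if Disjoint (S.erase s) U then Finsupp.single (γ + δ, S.erase s ∪ U)
        ((-1 : k) ^ (inv o {s} S + inv o (S.erase s) U)) else 0 := by
    simp only [taylor_d, map_sum, LinearMap.coe_sum, Finset.sum_apply]
    refine Finset.sum_congr rfl fun s _ => ?_
    rw [BarData.mulL_single, one_smul, taylor_mul, smul_ite, smul_zero, Finsupp.smul_single,
      smul_eq_mul, pow_add]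
  have hR : (taylor k o).sg (γ, S) • (taylor k o).mulL (Finsupp.single (γ, S) 1)
      ((taylor k o).d (δ, U)) =
      ∑ s ∈ U, if Disjoint S (U.erase s) then Finsupp.single (γ + δ, S ∪ U.erase s)
        ((-1 : k) ^ (S.card + 1 + inv o {s} U + inv o S (U.erase s))) else 0 := by
    simp only [taylor_d, map_sum, Finset.smul_sum]
    refine Finset.sum_congr rfl fun s _ => ?_
    rw [BarData.mulL_single, one_smul, taylor_mul, taylor_sg, smul_ite, smul_zero, smul_ite,
      smul_zero, Finsupp.smul_single, Finsupp.smul_single, smul_eq_mul, smul_eq_mul, ← pow_add,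
      ← pow_add, ← add_assoc]
  rw [hL, hR]
  by_cases hd : Disjoint S U
  · have hM : (taylor k o).dL ((taylor k o).mul (γ, S) (δ, U)) =
        ∑ s ∈ S ∪ U, Finsupp.single (γ + δ, (S ∪ U).erase s)
          ((-1 : k) ^ (inv o {s} (S ∪ U) + inv o S U)) := by
      simp only [taylor, if_pos hd, BarData.dL_single, Finset.smul_sum, Finsupp.smul_single,
        smul_eq_mul, pow_add]
      refine Finset.sum_congr rfl fun s _ => by rw [mul_comm]
    rw [hM, Finset.sum_union hd, sub_eq_add_neg, ← Finset.sum_neg_distrib]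
    congr 1
    · refine Finset.sum_congr rfl fun s hs => ?_
      have hsU : s ∉ U := Finset.disjoint_left.1 hd hs
      rw [if_pos (hd.mono_left (Finset.erase_subset _ _)),
        show (S ∪ U).erase s = S.erase s ∪ U by
          ext x; by_cases hx : x = s <;> simp [hx, hsU]]
      congr 1
      apply neg_one_pow_eq
      have h1 := inv_union_right (o := o) (S := {s}) hd
      have h2 := inv_erase_left (o := o) (U := U) hs
      omega
    · refine Finset.sum_congr rfl fun s hs => ?_
      have hsS : s ∉ S := Finset.disjoint_right.1 hd hs
      rw [if_pos (hd.mono_right (Finset.erase_subset _ _)),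
        show (S ∪ U).erase s = S ∪ U.erase s by
          ext x; by_cases hx : x = s <;> simp [hx, hsS],
        ← Finsupp.single_neg]
      congr 1
      rw [eq_neg_iff_add_eq_zero]
      apply neg_one_pow_cancel
      have h1 := inv_union_right (o := o) (S := {s}) hd
      have h2 := inv_erase_right (o := o) (S := S) hs
      have h3 : inv o {s} S + inv o S {s} = S.card := by
        have := inv_add_inv_mem ho (Finset.mem_insert_self s S)
        rw [Finset.card_insert_of_notMem hsS, Finset.insert_eq,
          inv_union_right (by simpa using hsS), inv_union_left (by simpa using hsS),
          inv_self_singleton] at this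
        omega
      omega
  · have hM : (taylor k o).dL ((taylor k o).mul (γ, S) (δ, U)) = 0 := by
      simp [taylor, if_neg hd]
    rw [hM]
    obtain ⟨s, hsS, hsU⟩ := Finset.not_disjoint_iff.1 hd
    rw [Finset.sum_eq_single_of_mem s hsS, Finset.sum_eq_single_of_mem s hsU]
    · have hiff : Disjoint (S.erase s) U ↔ Disjoint S (U.erase s) := by
        simp only [Finset.disjoint_left, Finset.mem_erase]
        grind
      by_cases h : Disjoint (S.erase s) U
      · have e1 : S.erase s ∪ U = S ∪ U := by ext x; by_cases hx : x = s <;> simp [hx, hsU, hsS]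
        have e2 : S ∪ U.erase s = S ∪ U := by ext x; by_cases hx : x = s <;> simp [hx, hsU, hsS]
        rw [if_pos h, if_pos (hiff.1 h), e1, e2, ← Finsupp.single_sub, eq_comm]
        have : (-1 : k) ^ (inv o {s} S + inv o (S.erase s) U) =
            (-1 : k) ^ (S.card + 1 + inv o {s} U + inv o S (U.erase s)) := by
          apply neg_one_pow_eq
          have h1 := inv_erase_left (o := o) (U := U) hsS
          have h2 := inv_erase_right (o := o) (S := S) hsU
          have h3 := inv_add_inv_mem ho hsS
          omega
        rw [this, sub_self, Finsupp.single_zero]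
      · rw [if_neg h, if_neg (fun h' => h (hiff.2 h')), sub_zero]
    · intro u hu hus
      rw [if_neg]
      intro h
      exact Finset.disjoint_left.1 h hsS (Finset.mem_erase.2 ⟨hus.symm, hsU⟩)
    · intro u hu hus
      rw [if_neg]
      intro h
      exact Finset.disjoint_left.1 h (Finset.mem_erase.2 ⟨hus.symm, hsS⟩) hsU

theorem taylor_assoc (a b c : Ltr σ) :
    (taylor k o).mulL ((taylor k o).mul a b) (Finsupp.single c 1) =
      (taylor k o).mulL (Finsupp.single a 1) ((taylor k o).mul b c) := by
  obtain ⟨γ, S⟩ := a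
  obtain ⟨δ, U⟩ := b
  obtain ⟨ε, V⟩ := c
  simp only [taylor]
  by_cases h1 : Disjoint S U <;> by_cases h2 : Disjoint U V <;> by_cases h3 : Disjoint S V <;>
    simp [h1, h2, h3, add_assoc, Finset.union_assoc, Finset.disjoint_union_left,
      Finset.disjoint_union_right, ← pow_add, BarData.mulL_single, inv_union_left,
      inv_union_right]
  congr 1
  ring

theorem taylor_laws (ho : Function.Injective o) : (taylor k o).Laws where
  dd := taylor_dd ho
  sg_sg a := by
    rw [taylor_sg, ← pow_add]
    exact Even.neg_one_pow ⟨_, rfl⟩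
  sg_d a := by
    simp only [taylor_d, map_sum, Finset.smul_sum, ← Finset.sum_neg_distrib]
    refine Finset.sum_congr rfl fun s hs => ?_
    rw [BarData.sL_single, Finsupp.smul_single, Finsupp.smul_single, ← Finsupp.single_neg,
      taylor_sg, taylor_sg, Finset.card_erase_add_one hs, pow_succ, smul_eq_mul, smul_eq_mul]
    congr 1
    ring
  sg_mul a b := by
    rw [taylor_mul]
    split_ifs with h
    · rw [BarData.sL_single, Finsupp.smul_single, Finsupp.smul_single, ← Finsupp.single_neg,
        taylor_sg, taylor_sg, taylor_sg, Finset.card_union_of_disjoint h, smul_eq_mul, smul_eq_mul]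
      congr 1
      ring
    · simp
  leibniz := taylor_leibniz ho
  assoc := taylor_assoc

end Taylor

section Graded
variable {k : Type*} [Field k] {X : Type*} {σ : Type*}

/-- The degree of a word. -/
def wdeg (deg : X → ℕ) (w : List X) : ℕ := (w.map deg).sum

/-- The multidegree of a word. -/
def wlab (lab : X → Mon σ) (w : List X) : Mon σ := (w.map lab).sum

/-- Words in the letters `V` with given degree and multidegree. -/
def piece (V : Set X) (lab : X → Mon σ) (deg : X → ℕ) (α : Mon σ) (i : ℕ) : Set (List X) :=
  {w | (∀ a ∈ w, a ∈ V) ∧ wdeg deg w = i ∧ wlab lab w = α}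

theorem wdeg_cons (deg : X → ℕ) (a : X) (w : List X) :
    wdeg deg (a :: w) = deg a + wdeg deg w := by simp [wdeg]

theorem wlab_cons (lab : X → Mon σ) (a : X) (w : List X) :
    wlab lab (a :: w) = lab a + wlab lab w := by simp [wlab]

/-- Compatibility of bar data with gradings. -/
structure BarData.Graded (A : BarData k X) (V : Set X) (lab : X → Mon σ) (deg : X → ℕ) :
    Prop where
  d : ∀ {a b}, a ∈ V → A.d a b ≠ 0 → b ∈ V ∧ lab b = lab a ∧ deg b + 1 = deg a
  mul : ∀ {a b c}, a ∈ V → b ∈ V → A.mul a b c ≠ 0 →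
    c ∈ V ∧ lab c = lab a + lab b ∧ deg c + 1 = deg a + deg b

theorem BarData.Graded.step {A : BarData k X} {V : Set X} {lab : X → Mon σ} {deg : X → ℕ}
    (h : A.Graded V lab deg) {w v : List X} (hwv : A.Step w v) (hw : ∀ a ∈ w, a ∈ V) :
    (∀ a ∈ v, a ∈ V) ∧ wlab lab v = wlab lab w ∧ wdeg deg v + 1 = wdeg deg w := by
  induction hwv with
  | int w hd =>
    obtain ⟨h1, h2, h3⟩ := h.d (hw _ (by simp)) hd
    refine ⟨?_, by simp [wlab_cons, h2], by rw [wdeg_cons, wdeg_cons]; omega⟩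
    intro c hc
    rcases List.mem_cons.1 hc with rfl | hc
    · exact h1
    · exact hw _ (by simp [hc])
  | mul w hd =>
    obtain ⟨h1, h2, h3⟩ := h.mul (hw _ (by simp)) (hw _ (by simp)) hd
    refine ⟨?_, by simp [wlab_cons, h2, add_assoc], by simp only [wdeg_cons]; omega⟩
    intro c hc
    rcases List.mem_cons.1 hc with rfl | hc
    · exact h1
    · exact hw _ (by simp [hc])
  | cons a _ ih =>
    obtain ⟨h1, h2, h3⟩ := ih fun b hb => hw b (by simp [hb])
    refine ⟨?_, by simp [wlab_cons, h2], by simp only [wdeg_cons]; omega⟩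
    intro c hc
    rcases List.mem_cons.1 hc with rfl | hc
    · exact hw _ (by simp)
    · exact h1 c hc

theorem BarData.Graded.step_piece {A : BarData k X} {V : Set X} {lab : X → Mon σ} {deg : X → ℕ}
    (h : A.Graded V lab deg) {α : Mon σ} {i : ℕ} {w v : List X}
    (hw : w ∈ piece V lab deg α (i + 1)) (hwv : A.Step w v) : v ∈ piece V lab deg α i := by
  obtain ⟨h1, h2, h3⟩ := h.step hwv hw.1
  have := hw.2.1
  exact ⟨h1, by omega, h2.trans hw.2.2⟩

theorem wlab_apply_le {lab : X → Mon σ} {w : List X} {a : X} (ha : a ∈ w) :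
    lab a ≤ wlab lab w := by
  induction w with
  | nil => simp at ha
  | cons b w ih =>
    rw [wlab_cons]
    rcases List.mem_cons.1 ha with rfl | h
    · exact le_self_add
    · exact (ih h).trans le_add_self

theorem length_le_wlab [Fintype σ] {lab : X → Mon σ} {w : List X} (h : ∀ a ∈ w, lab a ≠ 0) :
    w.length ≤ ∑ i, wlab lab w i := by
  induction w with
  | nil => simp
  | cons b w ih =>
    have h1 := ih fun a ha => h a (by simp [ha])
    have h2 : 1 ≤ ∑ i, lab b i := by
      by_contra h2
      apply h b (by simp)
      funext i
      have h3 : ∑ i, lab b i = 0 := by omega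
      exact Finset.sum_eq_zero_iff.1 h3 i (Finset.mem_univ i)
    rw [wlab_cons]
    simp only [Pi.add_apply, Finset.sum_add_distrib, List.length_cons]
    omega

theorem finite_words {V : Set X} (hV : V.Finite) (n : ℕ) :
    {w : List X | (∀ a ∈ w, a ∈ V) ∧ w.length ≤ n}.Finite := by
  have : Finite V := hV
  refine ((List.finite_length_le V n).image (List.map Subtype.val)).subset ?_
  rintro w ⟨h1, h2⟩
  exact ⟨w.attachWith (· ∈ V) h1, by simpa using h2, by simp⟩

/-- The letters of `V` are nonunits, and finitely many divide each monomial. -/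
structure FinLetters (V : Set X) (lab : X → Mon σ) : Prop where
  ne_zero : ∀ a ∈ V, lab a ≠ 0
  finite : ∀ α, {a ∈ V | lab a ≤ α}.Finite

theorem FinLetters.finite_wlab [Fintype σ] {V : Set X} {lab : X → Mon σ} (h : FinLetters V lab)
    (α : Mon σ) : {w : List X | (∀ a ∈ w, a ∈ V) ∧ wlab lab w = α}.Finite := by
  refine (finite_words (h.finite α) (∑ i, α i)).subset ?_
  rintro w ⟨h1, rfl⟩
  exact ⟨fun a ha => ⟨h1 a ha, wlab_apply_le ha⟩,
    length_le_wlab fun a ha => h.ne_zero a (h1 a ha)⟩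

theorem FinLetters.finite_piece [Fintype σ] {V : Set X} {lab : X → Mon σ}
    (h : FinLetters V lab) (deg : X → ℕ) (α : Mon σ) (i : ℕ) :
    (piece V lab deg α i).Finite :=
  (h.finite_wlab α).subset fun _ hw => ⟨hw.1, hw.2.2⟩

theorem finiteDimensional_supported {Y : Type*} {K : Set Y} (hK : K.Finite) :
    FiniteDimensional k (Finsupp.supported k k K) := by
  have : Finite K := hK
  exact Module.Finite.equiv (Finsupp.supportedEquivFinsupp K).symm

end Graded

section WordMap
variable {k : Type*} [Field k] {X X' : Type*}
open BarData

/-- Applying a linear map letterwise to a word. -/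
def wordMap (p : X → X' →₀ k) : List X → List X' →₀ k
  | [] => Finsupp.single [] 1
  | a :: w => consL k X' (p a) (wordMap p w)

/-- The linear extension of `wordMap`. -/
def wordMapL (p : X → X' →₀ k) : (List X →₀ k) →ₗ[k] (List X' →₀ k) :=
  Finsupp.linearCombination k (wordMap p)

@[simp] theorem wordMapL_single (p : X → X' →₀ k) (w : List X) (r : k) :
    wordMapL p (Finsupp.single w r) = r • wordMap p w := by simp [wordMapL]

theorem wordMapL_consL (p : X → X' →₀ k) (x : X →₀ k) (W : List X →₀ k) :
    wordMapL p (consL k X x W) =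
      consL k X' (Finsupp.linearCombination k p x) (wordMapL p W) := by
  induction x using Finsupp.induction_linear with
  | zero => simp
  | add x y hx hy => simp [hx, hy]
  | single a r =>
    induction W using Finsupp.induction_linear with
    | zero => simp
    | add x y hx hy => simp only [map_add, hx, hy]
    | single w t =>
      rw [consL_single, wordMapL_single, wordMapL_single, Finsupp.linearCombination_single, wordMap,
        mul_smul, map_smul, map_smul, LinearMap.smul_apply, smul_comm r t]

theorem wordMapL_BD {A : BarData k X} {B : BarData k X'} {p : X → X' →₀ k} {V : Set X}
    (hd : ∀ a ∈ V, Finsupp.linearCombination k p (A.d a) = B.dL (p a))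
    (hs : ∀ a ∈ V, A.sg a • p a = B.sL (p a))
    (hm : ∀ a ∈ V, ∀ b ∈ V, Finsupp.linearCombination k p (A.mul a b) = B.mulL (p a) (p b))
    (w : List X) (hw : ∀ a ∈ w, a ∈ V) : wordMapL p (A.BD w) = B.D (wordMap p w) := by
  induction w with
  | nil => rw [BarData.BD, wordMap, D_nil, map_zero]
  | cons a w ih =>
    have ha := hw a (by simp)
    rw [BarData.BD, wordMap, D_cons, map_add, map_add, map_neg, map_smul, map_smul,
      wordMapL_consL, wordMapL_consL, ih fun b hb => hw b (by simp [hb]), hd a ha, ← hs a ha]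
    rw [wordMapL_single, one_smul, Finsupp.linearCombination_single, one_smul, map_smul,
      map_smul]
    congr 2
    rw [LinearMap.smul_apply]
    congr 1
    cases w with
    | nil => rw [wordMap, starL_nil, starAux, map_zero]
    | cons b w =>
      rw [wordMap, starL_cons, starAux, wordMapL_consL, hm a ha b (hw b (by simp)),
        wordMapL_single, one_smul]

end WordMap

section TaylorBar
variable {k : Type*} [Field k] {σ : Type*} {o : Mon σ → ℕ} {M : Finset (Mon σ)}
open BarData

/-- The letters of the bar construction of the Taylor algebra of `M`. -/
def validL (M : Finset (Mon σ)) : Set (Ltr σ) :=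
  {a | a.1 ≠ 0 ∧ a.2 ⊆ M ∧ ∀ s ∈ a.2, s ≤ a.1}

/-- The degree of a letter. -/
def tdeg (a : Ltr σ) : ℕ := a.2.card + 1

theorem taylor_d_ne {a b : Ltr σ} (h : (taylor k o).d a b ≠ 0) :
    ∃ s ∈ a.2, b = (a.1, a.2.erase s) := by
  rw [taylor_d, Finsupp.finsetSum_apply] at h
  obtain ⟨s, hs, h⟩ := Finset.exists_ne_zero_of_sum_ne_zero h
  refine ⟨s, hs, ?_⟩
  by_contra hb
  exact h (Finsupp.single_eq_of_ne hb)

theorem taylor_mul_ne {a b c : Ltr σ} (h : (taylor k o).mul a b c ≠ 0) :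
    Disjoint a.2 b.2 ∧ c = (a.1 + b.1, a.2 ∪ b.2) := by
  rw [taylor_mul] at h
  split_ifs at h with hd
  · refine ⟨hd, ?_⟩
    by_contra hb
    exact h (Finsupp.single_eq_of_ne hb)
  · simp at h

theorem taylor_d_erase_ne {a : Ltr σ} {s : Mon σ} (hs : s ∈ a.2) :
    (taylor k o).d a (a.1, a.2.erase s) ≠ 0 := by
  rw [taylor_d, Finsupp.finsetSum_apply, Finset.sum_eq_single_of_mem s hs]
  · simp
  · intro u hu hus
    refine Finsupp.single_eq_of_ne fun h => ?_
    have h2 := (Prod.ext_iff.1 h).2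
    simp only at h2
    have : s ∈ a.2.erase u := Finset.mem_erase.2 ⟨hus.symm, hs⟩
    rw [← h2] at this
    simp at this

theorem taylor_mul_self_ne {a b : Ltr σ} (h : Disjoint a.2 b.2) :
    (taylor k o).mul a b (a.1 + b.1, a.2 ∪ b.2) ≠ 0 := by
  rw [taylor_mul, if_pos h]
  simp

theorem taylor_graded : (taylor k o).Graded (validL M) Prod.fst tdeg where
  d := by
    intro a b ha h
    obtain ⟨s, hs, rfl⟩ := taylor_d_ne h
    refine ⟨⟨ha.1, (Finset.erase_subset _ _).trans ha.2.1, fun u hu =>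
      ha.2.2 u (Finset.mem_of_mem_erase hu)⟩, rfl, ?_⟩
    simp only [tdeg]
    rw [Finset.card_erase_add_one hs]
  mul := by
    intro a b c ha hb h
    obtain ⟨hd, rfl⟩ := taylor_mul_ne h
    refine ⟨⟨fun h0 => ha.1 ?_, Finset.union_subset ha.2.1 hb.2.1, ?_⟩, rfl, ?_⟩
    · exact (add_eq_zero.1 h0).1
    · intro s hs
      rcases Finset.mem_union.1 hs with hs | hs
      · exact (ha.2.2 s hs).trans le_self_add
      · exact (hb.2.2 s hs).trans le_add_self
    · simp only [tdeg]
      rw [Finset.card_union_of_disjoint hd]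
      omega

theorem finLetters_validL [Fintype σ] : FinLetters (validL M) Prod.fst where
  ne_zero a ha := ha.1
  finite α := by
    refine ((Set.finite_Iic α).prod (M.powerset.finite_toSet)).subset ?_
    rintro ⟨γ, S⟩ ⟨h1, h2⟩
    exact ⟨h2, by simpa using h1.2.1⟩

/-- Letters of the bar construction of the monomial ring. -/
def GoodL (J : Set (Mon σ)) (a : Ltr σ) : Prop := a.2 = ∅ ∧ a.1 ∉ J

variable (k) in
/-- The bar data of the monomial ring. -/
def ringBar (J : Set (Mon σ)) : BarData k (Mon σ) where
  d _ := 0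
  sg _ := -1
  mul a b := if a + b ∉ J then Finsupp.single (a + b) 1 else 0

theorem mergeAt_cons (a : Mon σ) (l : List (Mon σ)) (j : ℕ) :
    mergeAt (a :: l) (j + 1) = a :: mergeAt l j := by
  simp [mergeAt]

theorem barAux_cons_cons (J : Set (Mon σ)) (a b : Mon σ) (w : List (Mon σ)) :
    barAux k J (a :: b :: w) =
      -(if a + b ∉ J then Finsupp.single ((a + b) :: w) (1 : k) else 0)
        - Finsupp.lmapDomain k k (List.cons a) (barAux k J (b :: w)) := by
  rw [barAux, show (a :: b :: w).length - 1 = (b :: w).length - 1 + 1 by simp,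
    Finset.sum_range_succ', add_comm, sub_eq_add_neg, barAux, map_sum, ← Finset.sum_neg_distrib]
  congr 1
  · by_cases h : a + b ∈ J <;> simp [mergeAt, h]
  · refine Finset.sum_congr rfl fun j _ => ?_
    rw [List.getD_cons_succ, List.getD_cons_succ, mergeAt_cons]
    split_ifs with h
    · simp
    · rw [map_smul, Finsupp.lmapDomain_apply, Finsupp.mapDomain_single, pow_succ, mul_neg_one,
        neg_smul]

theorem ringBar_BD (J : Set (Mon σ)) (w : List (Mon σ)) : (ringBar k J).BD w = barAux k J w := by
  induction w with
  | nil => simp [BD, barAux]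
  | cons a w ih =>
    cases w with
    | nil => simp [BD, barAux, starAux, ringBar]
    | cons b w =>
      rw [BD, ih, barAux_cons_cons]
      simp only [ringBar, starAux, map_zero, LinearMap.zero_apply, neg_zero, zero_add, neg_smul,
        one_smul, sub_eq_add_neg, consL, Finsupp.linearCombination_single]
      congr 2
      split_ifs <;> simp [Finsupp.mapDomain_single]

theorem ringBar_D (J : Set (Mon σ)) : (ringBar k J).D = barD k J := by
  rw [BarData.D, barD]
  congr 1
  funext w
  exact ringBar_BD J w

variable (k) in
/-- The augmentation of the Taylor algebra, on letters. -/
def goodMap (J : Set (Mon σ)) (a : Ltr σ) : Mon σ →₀ k :=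
  if GoodL J a then Finsupp.single a.1 1 else 0

theorem wordMap_goodMap (J : Set (Mon σ)) (w : List (Ltr σ)) :
    wordMap (goodMap k J) w =
      if ∀ a ∈ w, GoodL J a then Finsupp.single (w.map Prod.fst) (1 : k) else 0 := by
  induction w with
  | nil => simp [wordMap]
  | cons a w ih =>
    rw [wordMap, ih, goodMap]
    simp only [List.forall_mem_cons]
    by_cases h1 : GoodL J a
    · by_cases h2 : ∀ a ∈ w, GoodL J a
      · rw [if_pos h1, if_pos h2, if_pos ⟨h1, h2⟩, consL_single, List.map_cons, mul_one]
      · rw [if_neg h2, if_neg (fun h => h2 h.2 : ¬ (GoodL J a ∧ _)), map_zero]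
    · rw [if_neg h1, if_neg (fun h => h1 h.1 : ¬ (GoodL J a ∧ _)), map_zero,
        LinearMap.zero_apply]

theorem upperSet_add {a b : Mon σ} (h : a + b ∉ upperSet M) :
    a ∉ upperSet M ∧ b ∉ upperSet M :=
  ⟨fun ⟨m, hm, hl⟩ => h ⟨m, hm, hl.trans le_self_add⟩,
    fun ⟨m, hm, hl⟩ => h ⟨m, hm, hl.trans le_add_self⟩⟩

theorem not_goodL_of_mem {a : Ltr σ} (ha : a ∈ validL M) (h : ¬ GoodL (upperSet M) a) :
    a.1 ∈ upperSet M := by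
  by_contra hJ
  apply h
  refine ⟨?_, hJ⟩
  by_contra hne
  obtain ⟨s, hs⟩ := Finset.nonempty_iff_ne_empty.2 hne
  exact hJ ⟨s, ha.2.1 hs, ha.2.2 s hs⟩

theorem goodMap_BD (w : List (Ltr σ)) (hw : ∀ a ∈ w, a ∈ validL M) :
    wordMapL (goodMap k (upperSet M)) ((taylor k o).BD w) =
      (ringBar k (upperSet M)).D (wordMap (goodMap k (upperSet M)) w) := by
  refine wordMapL_BD (V := validL M) ?_ ?_ ?_ w hw
  · intro a ha
    have : (ringBar k (upperSet M)).dL = 0 := by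
      ext
      simp [ringBar]
    rw [this, LinearMap.zero_apply, taylor_d, map_sum]
    refine Finset.sum_eq_zero fun s hs => ?_
    rw [Finsupp.linearCombination_single, goodMap, if_neg, smul_zero]
    rintro ⟨-, h⟩
    exact h ⟨s, ha.2.1 hs, ha.2.2 s hs⟩
  · intro a ha
    rw [goodMap]
    split_ifs with h
    · rw [sL_single, taylor_sg, h.1]
      simp [ringBar]
    · simp
  · intro a ha b hb
    rw [taylor_mul]
    by_cases hg : GoodL (upperSet M) (a.1 + b.1, a.2 ∪ b.2)
    · obtain ⟨h1, h2⟩ := hg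
      obtain ⟨h3, h4⟩ := Finset.union_eq_empty.1 h1
      obtain ⟨h5, h6⟩ := upperSet_add h2
      have h7 : GoodL (upperSet M) a := ⟨h3, h5⟩
      have h8 : GoodL (upperSet M) b := ⟨h4, h6⟩
      have h9 : Disjoint a.2 b.2 := by simp [h3]
      rw [if_pos h9, Finsupp.linearCombination_single, goodMap, goodMap, goodMap, if_pos h7,
        if_pos h8, if_pos ⟨h1, h2⟩, mulL_single, h3, h4]
      simp only [ringBar, if_pos h2]
      simp [inv]
    · have h0 : Finsupp.linearCombination k (goodMap k (upperSet M))
          (if Disjoint a.2 b.2 then Finsupp.single (a.1 + b.1, a.2 ∪ b.2)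
            ((-1 : k) ^ inv o a.2 b.2) else 0) = 0 := by
        split_ifs
        · rw [Finsupp.linearCombination_single, goodMap, if_neg hg, smul_zero]
        · simp
      rw [h0, goodMap, goodMap]
      split_ifs with h1 h2
      · rw [mulL_single]
        simp only [ringBar]
        rw [if_neg, smul_zero, smul_zero]
        intro h
        exact hg ⟨by rw [h1.1, h2.1, Finset.empty_union], h⟩
      · simp
      · simp
      · simp

/-- A chosen generator dividing a monomial. -/
def genOf (M : Finset (Mon σ)) (γ : Mon σ) : Mon σ :=
  if h : γ ∈ upperSet M then h.choose else 0

theorem genOf_spec {γ : Mon σ} (h : γ ∈ upperSet M) : genOf M γ ∈ M ∧ genOf M γ ≤ γ := by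
  rw [genOf, dif_pos h]
  exact h.choose_spec

/-- The matching on words having a bad letter, toggling a generator in the first one. -/
inductive BadMatch (M : Finset (Mon σ)) : List (Ltr σ) → List (Ltr σ) → Prop
  | head (γ : Mon σ) (S : Finset (Mon σ)) (w : List (Ltr σ)) (hγ : γ ∈ upperSet M)
      (h : genOf M γ ∈ S) : BadMatch M ((γ, S) :: w) ((γ, S.erase (genOf M γ)) :: w)
  | cons (a : Ltr σ) {u v : List (Ltr σ)} (ha : GoodL (upperSet M) a) (h : BadMatch M u v) :
      BadMatch M (a :: u) (a :: v)

theorem BadMatch.length {u v : List (Ltr σ)} (h : BadMatch M u v) : u.length = v.length := by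
  induction h with
  | head => simp
  | cons a ha h ih => simp [ih]

theorem BadMatch.bad_left {u v : List (Ltr σ)} (h : BadMatch M u v) :
    ∃ a ∈ u, ¬ GoodL (upperSet M) a := by
  induction h with
  | head γ S w hγ h => exact ⟨(γ, S), by simp, fun hg => hg.2 hγ⟩
  | cons a ha h ih =>
    obtain ⟨b, hb, hb'⟩ := ih
    exact ⟨b, by simp [hb], hb'⟩

theorem BadMatch.inj {u u' v : List (Ltr σ)} (h : BadMatch M u v) (h' : BadMatch M u' v) :
    u = u' := by
  induction h generalizing u' with
  | head γ S w hγ h =>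
    generalize hv : (γ, S.erase (genOf M γ)) :: w = v at h'
    cases h' with
    | head γ' S' w' hγ' h2 =>
      simp only [List.cons.injEq, Prod.mk.injEq] at hv
      obtain ⟨⟨rfl, hS⟩, rfl⟩ := hv
      rw [← Finset.insert_erase h, ← Finset.insert_erase h2, hS]
    | cons a ha h2 =>
      simp only [List.cons.injEq] at hv
      rw [← hv.1] at ha
      exact absurd hγ ha.2
  | cons a ha h ih =>
    rename_i u v
    generalize hv : a :: v = v' at h'
    cases h' with
    | head γ' S' w' hγ' h2 =>
      simp only [List.cons.injEq] at hv
      rw [hv.1] at ha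
      exact absurd hγ' ha.2
    | cons b hb h2 =>
      simp only [List.cons.injEq] at hv
      obtain ⟨rfl, rfl⟩ := hv
      rw [ih h2]

theorem BadMatch.step {u v v' u' : List (Ltr σ)} (h : BadMatch M u v)
    (hs : (taylor k o).Step u v') (h' : BadMatch M u' v') : v' = v ∨ v'.length < u.length := by
  induction h generalizing v' u' with
  | head γ S w hγ h =>
    cases hs with
    | int w hd =>
      obtain ⟨s, hs, rfl⟩ := taylor_d_ne hd
      by_cases hsm : s = genOf M γ
      · left
        rw [hsm]
      · generalize hv : ((γ, S).1, (γ, S).2.erase s) :: w = v at h'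
        cases h' with
        | head γ' S' w' hγ' h2 =>
          simp only [List.cons.injEq, Prod.mk.injEq] at hv
          obtain ⟨⟨rfl, hS⟩, rfl⟩ := hv
          have : genOf M γ ∈ S.erase s := Finset.mem_erase.2 ⟨fun h => hsm h.symm, h⟩
          rw [hS] at this
          simp at this
        | cons a ha h2 =>
          simp only [List.cons.injEq] at hv
          rw [← hv.1] at ha
          exact absurd hγ ha.2
    | mul w hd => right; simp
    | cons a hs =>
      rename_i v
      generalize hv : (γ, S) :: v = v' at h'
      cases h' with
      | head γ' S' w' hγ' h2 =>
        simp only [List.cons.injEq, Prod.mk.injEq] at hv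
        obtain ⟨⟨rfl, hS⟩, rfl⟩ := hv
        rw [hS] at h
        simp at h
      | cons a ha h2 =>
        simp only [List.cons.injEq] at hv
        rw [← hv.1] at ha
        exact absurd hγ ha.2
  | cons a ha h ih =>
    cases hs with
    | int w hd =>
      obtain ⟨s, hs, rfl⟩ := taylor_d_ne hd
      rw [ha.1] at hs
      simp at hs
    | mul w hd => right; simp
    | cons a hs =>
      rename_i v2
      generalize hv : a :: v2 = v' at h'
      cases h' with
      | head γ' S' w' hγ' h2 =>
        simp only [List.cons.injEq] at hv
        rw [hv.1] at ha
        exact absurd hγ' ha.2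
      | cons b hb h2 =>
        simp only [List.cons.injEq] at hv
        obtain ⟨rfl, rfl⟩ := hv
        rcases ih hs h2 with h3 | h3
        · left; rw [h3]
        · right; simpa using h3

theorem BadMatch.coeff {u v : List (Ltr σ)} (h : BadMatch M u v) :
    (taylor k o).BD u v ≠ 0 := by
  induction h with
  | head γ S w hγ h =>
    rw [BD_apply_cons]
    have h1 : (taylor k o).starAux (γ, S) w ((γ, S.erase (genOf M γ)) :: w) = 0 := by
      cases w with
      | nil => rfl
      | cons b w => rw [starAux_apply_cons, Finsupp.single_eq_of_ne (by simp), mul_zero]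
    have h2 : Finsupp.single (γ, S) (1 : k) (γ, S.erase (genOf M γ)) = 0 := by
      refine Finsupp.single_eq_of_ne fun h3 => ?_
      have h4 := (Prod.ext_iff.1 h3).2
      simp only at h4
      rw [← h4] at h
      simp at h
    rw [h1, h2]
    simpa using taylor_d_erase_ne (k := k) (o := o) (a := (γ, S)) h
  | cons a ha h ih =>
    rename_i u v
    rw [BD_apply_cons]
    have h1 : (taylor k o).starAux a u (a :: v) = 0 := by
      cases u with
      | nil => rfl
      | cons b w =>
        rw [starAux_apply_cons, Finsupp.single_eq_of_ne, mul_zero]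
        intro h2
        have := h.length
        rw [h2] at this
        simp at this
    have h2 : (taylor k o).d a = 0 := by rw [taylor_d, ha.1]; simp
    rw [h1, h2]
    simpa [taylor_sg] using ih

theorem BadMatch.total {w : List (Ltr σ)} (hw : ∀ a ∈ w, a ∈ validL M)
    (hb : ∃ a ∈ w, ¬ GoodL (upperSet M) a) :
    (∃ u, (∀ a ∈ u, a ∈ validL M) ∧ BadMatch M u w) ∨ ∃ v, BadMatch M w v := by
  induction w with
  | nil => simp at hb
  | cons a w ih =>
    have haV := hw a (by simp)
    have hwV : ∀ b ∈ w, b ∈ validL M := fun b hb => hw b (by simp [hb])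
    by_cases ha : GoodL (upperSet M) a
    · have : ∃ a ∈ w, ¬ GoodL (upperSet M) a := by
        obtain ⟨b, hb, hb'⟩ := hb
        rcases List.mem_cons.1 hb with rfl | h
        · exact absurd ha hb'
        · exact ⟨b, h, hb'⟩
      rcases ih hwV this with ⟨u, hu, h⟩ | ⟨v, h⟩
      · refine .inl ⟨a :: u, ?_, .cons a ha h⟩
        intro b hb
        rcases List.mem_cons.1 hb with rfl | h
        · exact haV
        · exact hu b h
      · exact .inr ⟨a :: v, .cons a ha h⟩
    · have hJ := not_goodL_of_mem haV ha
      obtain ⟨hm1, hm2⟩ := genOf_spec hJ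
      obtain ⟨γ, S⟩ := a
      by_cases hm : genOf M γ ∈ S
      · exact .inr ⟨_, .head γ S w hJ hm⟩
      · refine .inl ⟨(γ, insert (genOf M γ) S) :: w, ?_, ?_⟩
        · intro b hb
          rcases List.mem_cons.1 hb with rfl | h
          · refine ⟨haV.1, Finset.insert_subset hm1 haV.2.1, ?_⟩
            intro s hs
            rcases Finset.mem_insert.1 hs with rfl | hs
            · exact hm2
            · exact haV.2.2 s hs
          · exact hwV b h
        · have := BadMatch.head γ (insert (genOf M γ) S) w hJ (Finset.mem_insert_self _ _)
          rwa [Finset.erase_insert hm] at this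

theorem step_bad {w v : List (Ltr σ)} (hw : ∀ a ∈ w, a ∈ validL M) (hs : (taylor k o).Step w v)
    (hv : ∀ a ∈ v, GoodL (upperSet M) a) : ∀ a ∈ w, GoodL (upperSet M) a := by
  induction hs with
  | int w hd =>
    rename_i a b
    obtain ⟨s, hs, rfl⟩ := taylor_d_ne hd
    have h1 := hw a (by simp)
    exact absurd ⟨s, h1.2.1 hs, h1.2.2 s hs⟩ (hv (a.1, a.2.erase s) (by simp)).2
  | mul w hd =>
    rename_i a b c
    obtain ⟨-, rfl⟩ := taylor_mul_ne hd
    obtain ⟨h1, h2⟩ := hv (a.1 + b.1, a.2 ∪ b.2) (by simp)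
    obtain ⟨h3, h4⟩ := Finset.union_eq_empty.1 h1
    obtain ⟨h5, h6⟩ := upperSet_add h2
    simp only [List.mem_cons]
    rintro c (rfl | rfl | hc)
    · exact ⟨h3, h5⟩
    · exact ⟨h4, h6⟩
    · exact hv c (by simp [hc])
  | cons a hs ih =>
    simp only [List.mem_cons]
    rintro c (rfl | hc)
    · exact hv c (by simp)
    · exact ih (fun b hb => hw b (by simp [hb])) (fun b hb => hv b (by simp [hb])) c hc

variable (k) in
/-- The graded pieces of the bar construction of the Taylor algebra. -/
def taylorSub (M : Finset (Mon σ)) (α : Mon σ) (i : ℕ) : Submodule k (List (Ltr σ) →₀ k) :=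
  Finsupp.supported k k (piece (validL M) Prod.fst tdeg α i)

theorem taylorSub_D {α : Mon σ} {i : ℕ} {c : List (Ltr σ) →₀ k}
    (hc : c ∈ taylorSub k M α (i + 1)) : (taylor k o).D c ∈ taylorSub k M α i :=
  D_mem_supported (fun _ hw _ hwv => taylor_graded.step_piece hw hwv) hc

theorem taylorSub_D_zero {α : Mon σ} {c : List (Ltr σ) →₀ k}
    (hc : c ∈ taylorSub k M α 0) : (taylor k o).D c = 0 := by
  have : (taylor k o).D c ∈ Finsupp.supported k k (∅ : Set (List (Ltr σ))) := by
    refine D_mem_supported (fun w hw v hwv => ?_) hc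
    have h1 := (taylor_graded.step hwv hw.1).2.2
    have h2 := hw.2.1
    omega
  simpa using this

theorem map_goodL {J : Set (Mon σ)} {w : List (Ltr σ)} (hw : ∀ a ∈ w, GoodL J a) :
    (w.map Prod.fst).map (fun γ => (γ, ∅)) = w := by
  rw [List.map_map]
  conv_rhs => rw [← List.map_id w]
  refine List.map_congr_left fun a ha => ?_
  rw [Function.comp_apply, ← (hw a ha).1]
  rfl

theorem wordMapL_goodMap_apply {J : Set (Mon σ)} (c : List (Ltr σ) →₀ k) {w : List (Ltr σ)}
    (hw : ∀ a ∈ w, GoodL J a) : wordMapL (goodMap k J) c (w.map Prod.fst) = c w := by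
  induction c using Finsupp.induction_linear with
  | zero => simp
  | add x y hx hy => simp only [map_add, Finsupp.add_apply, hx, hy]
  | single u r =>
    rw [wordMapL_single, wordMap_goodMap]
    split_ifs with hu
    · by_cases huw : w = u
      · simp [huw]
      · rw [Finsupp.smul_single, Finsupp.single_eq_of_ne huw, Finsupp.single_eq_of_ne]
        intro h
        apply huw
        rw [← map_goodL hw, h, map_goodL hu]
    · rw [Finsupp.single_eq_of_ne, smul_zero, Finsupp.zero_apply]
      rintro rfl
      exact hu hw

theorem map_taylorSub (α : Mon σ) (i : ℕ) :
    (taylorSub k M α i).map (wordMapL (goodMap k (upperSet M))) =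
      barSub k (upperSet M) i α := by
  rw [taylorSub, Finsupp.supported_eq_span_single, Submodule.map_span, barSub]
  apply le_antisymm
  · rw [Submodule.span_le]
    rintro _ ⟨_, ⟨w, hw, rfl⟩, rfl⟩
    rw [wordMapL_single, one_smul, wordMap_goodMap]
    split_ifs with h
    · refine Submodule.subset_span ⟨_, ⟨?_, hw.2.2, ?_⟩, rfl⟩
      · rw [← hw.2.1, List.length_map, wdeg,
          List.map_congr_left (g := fun _ => 1) fun a ha => by rw [tdeg, (h a ha).1]; rfl]
        simp
      · intro β hβ
        obtain ⟨a, ha, rfl⟩ := List.mem_map.1 hβ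
        exact ⟨(hw.1 a ha).1, (h a ha).2⟩
    · exact Submodule.zero_mem _
  · rw [Submodule.span_le]
    rintro _ ⟨l, ⟨h1, h2, h3⟩, rfl⟩
    refine Submodule.subset_span ⟨Finsupp.single (l.map fun γ => (γ, ∅)) 1, ⟨_, ⟨?_, ?_, ?_⟩, rfl⟩,
      ?_⟩
    · intro a ha
      obtain ⟨γ, hγ, rfl⟩ := List.mem_map.1 ha
      exact ⟨(h3 γ hγ).1, by simp, by simp⟩
    · rw [← h1, wdeg, List.map_map, List.map_congr_left (g := fun _ => 1) fun a ha => by simp [tdeg]]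
      simp
    · rw [← h2, wlab, List.map_map, List.map_congr_left (g := id) fun a ha => by simp]
      simp
    · rw [wordMapL_single, one_smul, wordMap_goodMap, if_pos]
      · rw [List.map_map, List.map_congr_left (g := id) fun a ha => by simp]
        simp
      · intro a ha
        obtain ⟨γ, hγ, rfl⟩ := List.mem_map.1 ha
        exact ⟨rfl, (h3 γ hγ).2⟩

/-- The words containing a letter that does not survive in the monomial ring. -/
def badPiece (M : Finset (Mon σ)) (α : Mon σ) (i : ℕ) : Set (List (Ltr σ)) :=
  {w | w ∈ piece (validL M) Prod.fst tdeg α i ∧ ∃ a ∈ w, ¬ GoodL (upperSet M) a}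

theorem badPiece_exact (ho : Function.Injective o) (α : Mon σ) (i : ℕ) (c : List (Ltr σ) →₀ k)
    (hc : c ∈ Finsupp.supported k k (badPiece M α i)) (hDc : (taylor k o).D c = 0) :
    ∃ e ∈ Finsupp.supported k k (badPiece M α (i + 1)), (taylor k o).D e = c := by
  refine exact_of_matching (ρ := ℕ) _ (badPiece M α) (BadMatch M) List.length ?_ ?_ ?_ ?_ ?_ ?_
    i c hc hDc
  · intro i c hc
    refine D_mem_supported (fun w hw v hwv => ?_) hc
    refine ⟨taylor_graded.step_piece hw.1 hwv, ?_⟩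
    by_contra hcon
    push Not at hcon
    obtain ⟨a, ha, hb⟩ := hw.2
    exact hb (step_bad hw.1.1 hwv hcon a ha)
  · intro i c _
    exact (taylor_laws ho).D_D c
  · intro i w hw
    rcases BadMatch.total hw.1.1 hw.2 with ⟨u, hu, h⟩ | h
    · have h1 := taylor_graded.step (Step.of_BD (h.coeff (k := k) (o := o))) hu
      have h2 := hw.1.2.1
      exact .inl ⟨u, ⟨⟨hu, by omega, h1.2.1.symm.trans hw.1.2.2⟩, h.bad_left⟩, h⟩
    · exact .inr h
  · intro i u _ u' _ v h h'
    exact h.inj h'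
  · intro i u _ v h
    rw [D_single, one_smul]
    exact h.coeff
  · intro i u _ u' _ v v' h h' hne hco
    rw [D_single, one_smul] at hco
    rcases h.step (Step.of_BD hco) h' with h1 | h1
    · exact absurd h1 hne
    · rwa [h'.length]

/-- `Tor` of the monomial ring is the homology of the bar construction of the Taylor algebra. -/
theorem torDim_eq [Fintype σ] (ho : Function.Injective o) (α : Mon σ) (i : ℕ) :
    torDim k (upperSet M) i α = homDim (taylorSub k M α) (taylor k o).D i := by
  symm
  refine homDim_eq_of_exact (C' := fun i => barSub k (upperSet M) i α)
    (D' := barD k (upperSet M)) (wordMapL (goodMap k (upperSet M))) ?_ ?_ ?_ ?_ ?_ ?_ ?_ i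
  · intro i
    exact finiteDimensional_supported (finLetters_validL.finite_piece _ _ _)
  · intro i c hc
    exact taylorSub_D hc
  · intro c hc
    exact taylorSub_D_zero hc
  · intro i c _
    exact (taylor_laws ho).D_D c
  · intro i
    exact map_taylorSub α i
  · intro i c hc
    rw [← Finsupp.sum_single c, Finsupp.sum]
    simp only [map_sum]
    refine Finset.sum_congr rfl fun w hw => ?_
    have hwp := (Finsupp.mem_supported k c).1 hc hw
    rw [D_single, map_smul, goodMap_BD w hwp.1, wordMapL_single, map_smul, ringBar_D]
  · intro i c hc hDc hpc
    have hcb : c ∈ Finsupp.supported k k (badPiece M α i) := by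
      rw [Finsupp.mem_supported]
      intro w hw
      refine ⟨(Finsupp.mem_supported k c).1 hc hw, ?_⟩
      by_contra hcon
      push Not at hcon
      rw [Finset.mem_coe, Finsupp.mem_support_iff, ← wordMapL_goodMap_apply c hcon, hpc] at hw
      exact hw rfl
    obtain ⟨e, he, hDe⟩ := badPiece_exact ho α i c hcb hDc
    refine ⟨e, Finsupp.supported_mono (fun w hw => hw.1) he, ?_, hDe⟩
    rw [← Finsupp.sum_single e, Finsupp.sum, map_sum]
    refine Finset.sum_eq_zero fun w hw => ?_
    have hwp := (Finsupp.mem_supported k e).1 he hw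
    rw [wordMapL_single, wordMap_goodMap, if_neg, smul_zero]
    intro h
    obtain ⟨a, ha, hb⟩ := hwp.2
    exact hb (h a ha)

end TaylorBar

section Atoms
variable {σ : Type*} {M : Finset (Mon σ)}

/-- The monomials of `M` have degree at least two. -/
structure Gens (M : Finset (Mon σ)) : Prop where
  ne_zero : ∀ m ∈ M, m ≠ 0
  not_le : ∀ m ∈ M, ∀ i, ¬ m ≤ Pi.single i 1

/-- No element of `S` has a common factor with an element of `U`. -/
def Cop (S U : Finset (Mon σ)) : Prop := ∀ s ∈ S, ∀ u ∈ U, ¬ NCF s u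

theorem NCF.symm {a b : Mon σ} (h : NCF a b) : NCF b a := by
  obtain ⟨i, h1, h2⟩ := h
  exact ⟨i, h2, h1⟩

theorem ncf_self {a : Mon σ} (h : a ≠ 0) : NCF a a := by
  obtain ⟨i, hi⟩ := Function.ne_iff.1 h
  exact ⟨i, hi, hi⟩

theorem Cop.symm {S U : Finset (Mon σ)} (h : Cop S U) : Cop U S :=
  fun s hs u hu hn => h u hu s hs hn.symm

theorem Cop.mono {S U S' U' : Finset (Mon σ)} (h : Cop S U) (h1 : S' ⊆ S) (h2 : U' ⊆ U) :
    Cop S' U' := fun s hs u hu => h s (h1 hs) u (h2 hu)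

theorem cop_union_right {S U U' : Finset (Mon σ)} : Cop S (U ∪ U') ↔ Cop S U ∧ Cop S U' := by
  constructor
  · intro h
    exact ⟨h.mono subset_rfl Finset.subset_union_left, h.mono subset_rfl Finset.subset_union_right⟩
  · rintro ⟨h1, h2⟩ s hs u hu
    rcases Finset.mem_union.1 hu with hu | hu
    · exact h1 s hs u hu
    · exact h2 s hs u hu

theorem cop_empty_left (U : Finset (Mon σ)) : Cop ∅ U := fun s hs => by simp at hs

theorem cop_empty_right (U : Finset (Mon σ)) : Cop U ∅ := (cop_empty_left U).symm

theorem Cop.disjoint (hM : Gens M) {S U : Finset (Mon σ)} (h : Cop S U) (hS : S ⊆ M) :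
    Disjoint S U := by
  rw [Finset.disjoint_left]
  intro s hs hu
  exact h s hs s hu (ncf_self (hM.ne_zero s (hS hs)))

theorem le_mlcm {S : Finset (Mon σ)} {s : Mon σ} (h : s ∈ S) : s ≤ mlcm S :=
  Finset.le_sup (f := id) h

theorem mlcm_le_iff {S : Finset (Mon σ)} {γ : Mon σ} : mlcm S ≤ γ ↔ ∀ s ∈ S, s ≤ γ :=
  Finset.sup_le_iff

theorem mlcm_mono {S U : Finset (Mon σ)} (h : S ⊆ U) : mlcm S ≤ mlcm U := Finset.sup_mono h

theorem mlcm_union (S U : Finset (Mon σ)) : mlcm (S ∪ U) = mlcm S ⊔ mlcm U := Finset.sup_union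

theorem mlcm_empty : mlcm (∅ : Finset (Mon σ)) = 0 := rfl

theorem mlcm_apply_ne {S : Finset (Mon σ)} {i : σ} (h : mlcm S i ≠ 0) : ∃ s ∈ S, s i ≠ 0 := by
  by_contra hcon
  push Not at hcon
  apply h
  have : mlcm S ≤ fun j => if j = i then 0 else mlcm S j := by
    rw [mlcm_le_iff]
    intro s hs j
    simp only
    split_ifs with hj
    · rw [hj, hcon s hs]
    · exact le_mlcm hs j
  simpa using this i

theorem Cop.not_ncf {S U : Finset (Mon σ)} (h : Cop S U) : ¬ NCF (mlcm S) (mlcm U) := by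
  rintro ⟨i, h1, h2⟩
  obtain ⟨s, hs, hsi⟩ := mlcm_apply_ne h1
  obtain ⟨u, hu, hui⟩ := mlcm_apply_ne h2
  exact h s hs u hu ⟨i, hsi, hui⟩

theorem Cop.mlcm_union {S U : Finset (Mon σ)} (h : Cop S U) :
    mlcm (S ∪ U) = mlcm S + mlcm U := by
  rw [MonomialRings.mlcm_union]
  funext i
  have : mlcm S i = 0 ∨ mlcm U i = 0 := by
    by_contra hcon
    push Not at hcon
    exact h.not_ncf ⟨i, hcon⟩
  simp only [Pi.sup_apply, Pi.add_apply]
  rcases this with h | h <;> simp [h]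

theorem mlcm_eq_zero_iff (hM : Gens M) {S : Finset (Mon σ)} (hS : S ⊆ M) :
    mlcm S = 0 ↔ S = ∅ := by
  constructor
  · intro h
    by_contra hne
    obtain ⟨s, hs⟩ := Finset.nonempty_iff_ne_empty.2 hne
    have := le_mlcm hs
    rw [h] at this
    exact hM.ne_zero s (hS hs) (le_antisymm this zero_le)
  · rintro rfl
    rfl

/-- A connected monomial set: it has no proper nonempty subset coprime to the rest. -/
def Conn (S : Finset (Mon σ)) : Prop :=
  S.Nonempty ∧ ∀ C ⊆ S, C.Nonempty → Cop C (S \ C) → C = S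

theorem exists_conn {S : Finset (Mon σ)} (h : S.Nonempty) :
    ∃ C ⊆ S, Conn C ∧ Cop C (S \ C) := by
  have h1 : ∃ n, ∃ C ⊆ S, C.Nonempty ∧ Cop C (S \ C) ∧ C.card = n :=
    ⟨_, S, subset_rfl, h, by rw [Finset.sdiff_self]; exact cop_empty_right S, rfl⟩
  obtain ⟨C, hCS, hC, hcop, hn⟩ := Nat.find_spec h1
  refine ⟨C, hCS, ⟨hC, fun B hB hBn hBc => ?_⟩, hcop⟩
  by_contra hne
  have hlt := Finset.card_lt_card (hB.ssubset_of_ne hne)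
  rw [hn] at hlt
  refine Nat.find_min h1 hlt ⟨B, hB.trans hCS, hBn, ?_, rfl⟩
  have : S \ B ⊆ (C \ B) ∪ (S \ C) := by
    intro x
    simp only [Finset.mem_sdiff, Finset.mem_union]
    tauto
  exact (cop_union_right.2 ⟨hBc, hcop.mono hB subset_rfl⟩).mono subset_rfl this

theorem Conn.subset_or_subset {P S U : Finset (Mon σ)} (hP : Conn P) (h : P ⊆ S ∪ U)
    (hc : Cop S U) : P ⊆ S ∨ P ⊆ U := by
  by_cases hne : (P ∩ S).Nonempty
  · left
    have := hP.2 (P ∩ S) Finset.inter_subset_left hne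
      (hc.mono Finset.inter_subset_right fun x hx => ?_)
    · rw [← this]
      exact Finset.inter_subset_right
    · simp only [Finset.mem_sdiff, Finset.mem_inter, not_and] at hx
      exact (Finset.mem_union.1 (h hx.1)).resolve_left (hx.2 hx.1)
  · right
    intro x hx
    refine (Finset.mem_union.1 (h hx)).resolve_left fun hS => hne ⟨x, Finset.mem_inter.2 ⟨hx, hS⟩⟩

/-- The letters that cannot be factored: variables, and connected sets with their lcm. -/
def Pure (p : Ltr σ) : Prop :=
  (p.2 = ∅ ∧ ∃ i, p.1 = Pi.single i 1) ∨ (Conn p.2 ∧ p.1 = mlcm p.2)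

/-- The pure factors of a letter. -/
def AtomOf (p c : Ltr σ) : Prop :=
  (p.2 = ∅ ∧ ∃ i, p.1 = Pi.single i 1 ∧ mlcm c.2 i < c.1 i) ∨
    (Conn p.2 ∧ p.1 = mlcm p.2 ∧ p.2 ⊆ c.2 ∧ Cop p.2 (c.2 \ p.2))

/-- The product of two letters. -/
def merge (a b : Ltr σ) : Ltr σ := (a.1 + b.1, a.2 ∪ b.2)

variable {p q a b c d : Ltr σ}

theorem AtomOf.pure (h : AtomOf p c) : Pure p := by
  rcases h with ⟨h1, i, h2, -⟩ | ⟨h1, h2, -⟩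
  · exact .inl ⟨h1, i, h2⟩
  · exact .inr ⟨h1, h2⟩

theorem AtomOf.subset (h : AtomOf p c) : p.2 ⊆ c.2 := by
  rcases h with ⟨h1, -⟩ | ⟨-, -, h, -⟩
  · simp [h1]
  · exact h

theorem AtomOf.cop (h : AtomOf p c) : Cop p.2 (c.2 \ p.2) := by
  rcases h with ⟨h1, -⟩ | ⟨-, -, -, h⟩
  · rw [h1]
    exact cop_empty_left _
  · exact h

theorem AtomOf.add_le (hc : c ∈ validL M) (h : AtomOf p c) :
    p.1 + mlcm (c.2 \ p.2) ≤ c.1 := by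
  have hcl := mlcm_le_iff.2 hc.2.2
  rcases h with ⟨h1, i, h2, h3⟩ | ⟨h1, h2, h3, h4⟩
  · rw [h1, h2, Finset.sdiff_empty]
    intro j
    by_cases hj : j = i
    · subst hj
      simp only [Pi.add_apply, Pi.single_eq_same]
      omega
    · simpa [hj] using hcl j
  · rw [h2, ← h4.mlcm_union, Finset.union_sdiff_of_subset h3]
    exact hcl

theorem Pure.fst_ne_zero (hM : Gens M) (hp : Pure p) (h : p.2 ⊆ M) : p.1 ≠ 0 := by
  rcases hp with ⟨-, i, hi⟩ | ⟨h1, h2⟩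
  · rw [hi]
    exact fun h => by simpa using congrFun h i
  · rw [h2, Ne, mlcm_eq_zero_iff hM h]
    exact h1.1.ne_empty

theorem Pure.valid (hM : Gens M) (hp : Pure p) (h : p.2 ⊆ M) : p ∈ validL M := by
  refine ⟨hp.fst_ne_zero hM h, h, ?_⟩
  rcases hp with ⟨h1, -⟩ | ⟨h1, h2⟩
  · simp [h1]
  · intro s hs
    rw [h2]
    exact le_mlcm hs

theorem Pure.atomOf (hp : Pure p) : AtomOf p p := by
  rcases hp with ⟨h1, i, h2⟩ | ⟨h1, h2⟩
  · exact .inl ⟨h1, i, h2, by rw [h1, h2, mlcm_empty]; simp⟩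
  · exact .inr ⟨h1, h2, subset_rfl, by rw [Finset.sdiff_self]; exact cop_empty_right _⟩

theorem AtomOf.eq_of_pure (hp : Pure p) (h : AtomOf q p) : q = p := by
  rcases hp with ⟨h1, i, h2⟩ | ⟨h1, h2⟩
  · rcases h with ⟨h3, j, h4, h5⟩ | ⟨h3, h4, h5, -⟩
    · rw [h1, h2, mlcm_empty] at h5
      have : j = i := by
        by_contra hne
        simp [hne] at h5
      subst this
      exact Prod.ext (h4.trans h2.symm) (h3.trans h1.symm)
    · rw [h1, Finset.subset_empty] at h5
      exact absurd h5 h3.1.ne_empty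
  · rcases h with ⟨h3, j, h4, h5⟩ | ⟨h3, h4, h5, h6⟩
    · rw [h2] at h5
      exact absurd h5 (lt_irrefl _)
    · have := h1.2 _ h5 h3.1 h6
      exact Prod.ext (by rw [h4, h2, this]) this

theorem atomOf_merge (hc : c ∈ validL M) (hd : d ∈ validL M) (h : Cop c.2 d.2) :
    AtomOf p (merge c d) ↔ AtomOf p c ∨ AtomOf p d := by
  have hcl := mlcm_le_iff.2 hc.2.2
  have hdl := mlcm_le_iff.2 hd.2.2
  constructor
  · rintro (⟨h1, i, h2, h3⟩ | ⟨h1, h2, h3, h4⟩)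
    · rw [merge] at h3
      simp only [h.mlcm_union, Pi.add_apply] at h3
      by_cases hi : mlcm c.2 i < c.1 i
      · exact .inl (.inl ⟨h1, i, h2, hi⟩)
      · exact .inr (.inl ⟨h1, i, h2, by omega⟩)
    · rcases h1.subset_or_subset h3 h with h5 | h5
      · exact .inl (.inr ⟨h1, h2, h5, h4.mono subset_rfl
          (Finset.sdiff_subset_sdiff Finset.subset_union_left subset_rfl)⟩)
      · exact .inr (.inr ⟨h1, h2, h5, h4.mono subset_rfl
          (Finset.sdiff_subset_sdiff Finset.subset_union_right subset_rfl)⟩)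
  · rintro (h' | h')
    · rcases h' with ⟨h1, i, h2, h3⟩ | ⟨h1, h2, h3, h4⟩
      · refine .inl ⟨h1, i, h2, ?_⟩
        rw [merge]
        simp only [h.mlcm_union, Pi.add_apply]
        have : mlcm d.2 i ≤ d.1 i := hdl i
        change _ < c.1 i + d.1 i
        omega
      · refine .inr ⟨h1, h2, h3.trans Finset.subset_union_left, ?_⟩
        refine (cop_union_right.2 ⟨h4, h.mono h3 subset_rfl⟩).mono subset_rfl ?_
        rw [merge, Finset.union_sdiff_distrib]
        exact Finset.union_subset_union subset_rfl Finset.sdiff_subset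
    · rcases h' with ⟨h1, i, h2, h3⟩ | ⟨h1, h2, h3, h4⟩
      · refine .inl ⟨h1, i, h2, ?_⟩
        rw [merge]
        simp only [h.mlcm_union, Pi.add_apply]
        have : mlcm c.2 i ≤ c.1 i := hcl i
        change _ < c.1 i + d.1 i
        omega
      · refine .inr ⟨h1, h2, h3.trans Finset.subset_union_right, ?_⟩
        refine (cop_union_right.2 ⟨h.symm.mono h3 subset_rfl, h4⟩).mono subset_rfl ?_
        rw [merge, Finset.union_sdiff_distrib]
        exact Finset.union_subset_union Finset.sdiff_subset subset_rfl

theorem exists_atomOf (hc : c ∈ validL M) : ∃ p, AtomOf p c := by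
  by_cases h : c.2.Nonempty
  · obtain ⟨C, h1, h2, h3⟩ := exists_conn h
    exact ⟨(mlcm C, C), .inr ⟨h2, rfl, h1, h3⟩⟩
  · rw [Finset.not_nonempty_iff_eq_empty] at h
    obtain ⟨i, hi⟩ := Function.ne_iff.1 hc.1
    refine ⟨(Pi.single i 1, ∅), .inl ⟨rfl, i, rfl, ?_⟩⟩
    rw [h, mlcm_empty]
    exact Nat.pos_of_ne_zero hi

theorem merge_valid (hc : c ∈ validL M) (hd : d ∈ validL M) : merge c d ∈ validL M := by
  refine ⟨fun h0 => hc.1 (add_eq_zero.1 h0).1, Finset.union_subset hc.2.1 hd.2.1, ?_⟩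
  intro s hs
  rcases Finset.mem_union.1 hs with hs | hs
  · exact (hc.2.2 s hs).trans le_self_add
  · exact (hd.2.2 s hs).trans le_add_self

theorem AtomOf.factor (hM : Gens M) (hc : c ∈ validL M) (h : AtomOf p c) (hne : c ≠ p) :
    ∃ d ∈ validL M, Cop p.2 d.2 ∧ merge d p = c := by
  have hle := h.add_le hc
  have hple : p.1 ≤ c.1 := le_self_add.trans hle
  refine ⟨(c.1 - p.1, c.2 \ p.2), ⟨?_, Finset.sdiff_subset.trans hc.2.1, ?_⟩, h.cop, ?_⟩
  · intro h0
    have h1 : c.1 = p.1 := le_antisymm (tsub_eq_zero_iff_le.1 h0) hple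
    rw [h1] at hle
    have h2 : mlcm (c.2 \ p.2) = 0 := by
      have : mlcm (c.2 \ p.2) ≤ 0 := by
        intro i
        have := hle i
        simp only [Pi.add_apply, Pi.zero_apply] at this ⊢
        omega
      exact le_antisymm this zero_le
    rw [mlcm_eq_zero_iff hM (Finset.sdiff_subset.trans hc.2.1), Finset.sdiff_eq_empty_iff_subset]
      at h2
    exact hne (Prod.ext h1 (Finset.Subset.antisymm h2 h.subset))
  · intro s hs
    refine (le_mlcm hs).trans ?_
    intro i
    have := hle i
    simp only [Pi.add_apply, Pi.sub_apply] at this ⊢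
    omega
  · rw [merge]
    exact Prod.ext (tsub_add_cancel_of_le hple) (Finset.sdiff_union_of_subset h.subset)

theorem merge_cancel (hM : Gens M) (hp : p.2 ⊆ M) (h : Cop p.2 c.2) (h' : Cop p.2 d.2)
    (he : merge c p = merge d p) : c = d := by
  have h1 := (Prod.ext_iff.1 he).1
  have h2 := (Prod.ext_iff.1 he).2
  simp only [merge] at h1 h2
  refine Prod.ext (add_right_cancel h1) ?_
  have e1 := (h.disjoint hM hp).symm
  have e2 := (h'.disjoint hM hp).symm
  rw [← Finset.union_sdiff_cancel_right e1, h2, Finset.union_sdiff_cancel_right e2]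

theorem merge_ne_right (hc : c.1 ≠ 0) : merge c p ≠ p := by
  intro h
  have := (Prod.ext_iff.1 h).1
  simp only [merge, add_eq_right] at this
  exact hc this

theorem conn_lcm_ne_single (hM : Gens M) {S : Finset (Mon σ)} (h : S.Nonempty) (hS : S ⊆ M)
    (i : σ) : mlcm S ≠ Pi.single i 1 := by
  intro he
  obtain ⟨s, hs⟩ := h
  exact hM.not_le s (hS hs) i (he ▸ le_mlcm hs)

theorem Pure.eq_of_fst_eq (hM : Gens M) (hp : Pure p) (hq : Pure q) (hpM : p.2 ⊆ M)
    (hqM : q.2 ⊆ M) (h : p.1 = q.1) (hc : Cop p.2 q.2) : p = q := by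
  rcases hp with ⟨h1, i, h2⟩ | ⟨h1, h2⟩ <;> rcases hq with ⟨h3, j, h4⟩ | ⟨h3, h4⟩
  · exact Prod.ext h (h1.trans h3.symm)
  · exact absurd (h4.symm.trans (h.symm.trans h2)) (conn_lcm_ne_single hM h3.1 hqM i)
  · exact absurd (h2.symm.trans (h.trans h4)) (conn_lcm_ne_single hM h1.1 hpM j)
  · have hn := hc.not_ncf
    rw [← h2, ← h4, ← h] at hn
    refine absurd (ncf_self ?_) hn
    rw [h2, Ne, mlcm_eq_zero_iff hM hpM]
    exact h1.1.ne_empty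

theorem AtomOf.eq_or_cop (hp : AtomOf p c) (hq : AtomOf q c) : p = q ∨ Cop p.2 q.2 := by
  rcases hp with ⟨h1, -⟩ | ⟨h1, h2, h3, h4⟩
  · rw [h1]
    exact .inr (cop_empty_left _)
  · rcases hq with ⟨h5, -⟩ | ⟨h5, h6, h7, h8⟩
    · rw [h5]
      exact .inr (cop_empty_right _)
    · by_cases hne : (p.2 ∩ q.2).Nonempty
      · left
        have e1 := h1.2 _ Finset.inter_subset_left hne
          (h8.mono Finset.inter_subset_right (by
            intro x
            simp only [Finset.mem_sdiff, Finset.mem_inter]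
            exact fun hx => ⟨h3 hx.1, fun hq => hx.2 ⟨hx.1, hq⟩⟩))
        have e2 := h5.2 _ Finset.inter_subset_right hne
          (h4.mono Finset.inter_subset_left (by
            intro x
            simp only [Finset.mem_sdiff, Finset.mem_inter]
            exact fun hx => ⟨h7 hx.1, fun hq => hx.2 ⟨hq, hx.1⟩⟩))
        have e : p.2 = q.2 := e1.symm.trans e2
        exact Prod.ext (by rw [h2, h6, e]) e
      · right
        refine h4.mono subset_rfl fun x hx => Finset.mem_sdiff.2 ⟨h7 hx, fun hxp => hne ⟨x, ?_⟩⟩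
        exact Finset.mem_inter.2 ⟨hxp, hx⟩

end Atoms

section Words
variable {σ : Type*} {M : Finset (Mon σ)} {p q a b c d : Ltr σ} {u v w : List (Ltr σ)}

/-- The pure letter `a` divides a letter of the word, with coprime letters before it. -/
def MinAt (a : Ltr σ) : List (Ltr σ) → Prop
  | [] => False
  | c :: w => AtomOf a c ∨ (MinAt a w ∧ Cop a.2 c.2)

/-- `v` arises from `u` by multiplying two consecutive coprime letters. -/
inductive Mrg : List (Ltr σ) → List (Ltr σ) → Prop
  | head (c d : Ltr σ) (w : List (Ltr σ)) : Cop c.2 d.2 → Mrg (c :: d :: w) (merge c d :: w)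
  | cons (c : Ltr σ) (u v : List (Ltr σ)) : Mrg u v → Mrg (c :: u) (c :: v)

/-- All letters of the word are valid. -/
def Val (M : Finset (Mon σ)) (w : List (Ltr σ)) : Prop := ∀ c ∈ w, c ∈ validL M

theorem val_cons : Val M (c :: w) ↔ c ∈ validL M ∧ Val M w := List.forall_mem_cons

theorem Mrg.val (h : Mrg u v) (hu : Val M u) : Val M v := by
  induction h with
  | head c d w h =>
    simp only [val_cons] at hu ⊢
    exact ⟨merge_valid hu.1 hu.2.1, hu.2.2⟩
  | cons c u v h ih =>
    rw [val_cons] at hu ⊢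
    exact ⟨hu.1, ih hu.2⟩

theorem Mrg.minAt_iff (h : Mrg u v) (hu : Val M u) : MinAt a u ↔ MinAt a v := by
  induction h with
  | head c d w h =>
    simp only [val_cons] at hu
    simp only [MinAt, atomOf_merge hu.1 hu.2.1 h]
    have h1 : AtomOf a d → Cop a.2 c.2 := fun ha => h.symm.mono ha.subset subset_rfl
    have h2 : Cop a.2 (merge c d).2 ↔ Cop a.2 c.2 ∧ Cop a.2 d.2 := cop_union_right
    rw [h2]
    tauto
  | cons c u v h ih =>
    simp only [MinAt, ih (val_cons.1 hu).2]

theorem MinAt.pure (h : MinAt p w) : Pure p := by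
  induction w with
  | nil => exact h.elim
  | cons c w ih => exact h.elim AtomOf.pure fun h => ih h.1

theorem MinAt.subset (h : MinAt p w) (hw : Val M w) : p.2 ⊆ M := by
  induction w with
  | nil => exact h.elim
  | cons c w ih =>
    rw [val_cons] at hw
    exact h.elim (fun h => h.subset.trans hw.1.2.1) fun h => ih h.1 hw.2

theorem MinAt.eq_of_fst_eq (hM : Gens M) (hp : MinAt p w) (hq : MinAt q w) (hw : Val M w)
    (h : p.1 = q.1) : p = q := by
  have hpM := hp.subset hw
  have hqM := hq.subset hw
  have hpp := hp.pure
  have hqp := hq.pure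
  induction w with
  | nil => exact hp.elim
  | cons c w ih =>
    rcases hp with hp | hp <;> rcases hq with hq | hq
    · rcases hp.eq_or_cop hq with he | he
      · exact he
      · exact hpp.eq_of_fst_eq hM hqp hpM hqM h he
    · exact hpp.eq_of_fst_eq hM hqp hpM hqM h (hq.2.symm.mono hp.subset subset_rfl)
    · exact hpp.eq_of_fst_eq hM hqp hpM hqM h (hp.2.mono subset_rfl hq.subset)
    · exact ih hp.1 hq.1 (val_cons.1 hw).2

/-- The selected pure letter of a word. -/
def Sel (key : Mon σ → ℕ) (p : Ltr σ) (w : List (Ltr σ)) : Prop :=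
  MinAt p w ∧ ∀ q, MinAt q w → key p.1 ≤ key q.1

/-- `p` is a variable which occurs in the word. -/
def Later (p : Ltr σ) (w : List (Ltr σ)) : Prop := p.2 = ∅ ∧ MinAt p w

variable {key : Mon σ → ℕ}

theorem exists_sel (hw : Val M w) (hne : w ≠ []) : ∃ p, Sel key p w := by
  have h : ∃ n, ∃ p, MinAt p w ∧ key p.1 = n := by
    obtain ⟨c, w, rfl⟩ := List.exists_cons_of_ne_nil hne
    obtain ⟨p, hp⟩ := exists_atomOf (hw c List.mem_cons_self)
    exact ⟨_, p, .inl hp, rfl⟩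
  obtain ⟨p, hp, hn⟩ := Nat.find_spec h
  exact ⟨p, hp, fun q hq => hn ▸ Nat.find_min' h ⟨q, hq, rfl⟩⟩

theorem Sel.unique (hM : Gens M) (hk : Function.Injective key) (hp : Sel key p w)
    (hq : Sel key q w) (hw : Val M w) : p = q :=
  hp.1.eq_of_fst_eq hM hq.1 hw (hk (le_antisymm (hp.2 q hq.1) (hq.2 p hp.1)))

theorem Mrg.sel_iff (h : Mrg u v) (hu : Val M u) : Sel key p u ↔ Sel key p v := by
  simp only [Sel, h.minAt_iff hu]

theorem Mrg.later_iff (h : Mrg u v) (hu : Val M u) : Later p u ↔ Later p v := by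
  simp only [Later, h.minAt_iff hu]

/-- `v` arises from `u` by multiplying the letter `p` into the letter before it. -/
inductive Up (p : Ltr σ) : List (Ltr σ) → List (Ltr σ) → Prop
  | here (c : Ltr σ) (w : List (Ltr σ)) : Cop p.2 c.2 → ¬ Later p w → Up p (c :: p :: w) (merge c p :: w)
  | there (c : Ltr σ) (u v : List (Ltr σ)) : Cop p.2 c.2 → Up p u v → Up p (c :: u) (c :: v)

theorem Up.mrg (h : Up p u v) : Mrg u v := by
  induction h with
  | here c w h => exact .head c p w h.symm
  | there c u v _ _ ih => exact .cons c u v ih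

theorem Up.minAt (h : Up p u v) (hp : Pure p) : MinAt p u := by
  induction h with
  | here c w h => exact .inr ⟨.inl hp.atomOf, h⟩
  | there c u v h _ ih => exact .inr ⟨ih, h⟩

theorem up_or_head (hM : Gens M) (hw : Val M w) (hp : MinAt p w) :
    (∃ w', w = p :: w' ∧ ¬ Later p w') ∨ (∃ v, Up p w v) ∨ ∃ u, Val M u ∧ Up p u w := by
  have hpM := hp.subset hw
  have hpp := hp.pure
  induction w with
  | nil => exact hp.elim
  | cons c w ih =>
    rw [val_cons] at hw
    by_cases h : MinAt p w ∧ Cop p.2 c.2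
    · right
      rcases ih hw.2 h.1 with ⟨w', rfl, h1⟩ | ⟨v, h1⟩ | ⟨u, h1, h2⟩
      · exact .inl ⟨_, .here c w' h.2 h1⟩
      · exact .inl ⟨_, .there c _ _ h.2 h1⟩
      · exact .inr ⟨c :: u, val_cons.2 ⟨hw.1, h1⟩, .there c _ _ h.2 h2⟩
    · have hl : ¬ Later p w := fun hl => h ⟨hl.2, by rw [hl.1]; exact cop_empty_left _⟩
      have hc : AtomOf p c := hp.resolve_right h
      by_cases he : c = p
      · exact .inl ⟨w, by rw [he], hl⟩
      · obtain ⟨d, hd, h1, rfl⟩ := hc.factor hM hw.1 he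
        exact .inr (.inr ⟨d :: p :: w, val_cons.2 ⟨hd, val_cons.2 ⟨hpp.valid hM hpM, hw.2⟩⟩,
          .here d w h1 hl⟩)

theorem Cop.eq_empty (hM : Gens M) {S U : Finset (Mon σ)} (h : Cop S U) (hS : S ⊆ M)
    (hSU : S ⊆ U) : S = ∅ := by
  have := h.disjoint hM hS
  exact Finset.disjoint_self_iff_empty S |>.1 (this.mono_right hSU)

theorem Up.later_left (hM : Gens M) (hp : Pure p) (hpM : p.2 ⊆ M) (h : Up p (p :: w) v) :
    Later p w := by
  rcases h with ⟨_, w, h1, -⟩ | ⟨_, _, v, h1, h2⟩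
  · exact ⟨h1.eq_empty hM hpM subset_rfl, .inl hp.atomOf⟩
  · exact ⟨h1.eq_empty hM hpM subset_rfl, h2.minAt hp⟩

theorem Up.later_right (hM : Gens M) (hp : Pure p) (hpM : p.2 ⊆ M) (hu : Val M u)
    (h : Up p u (p :: w)) : Later p w := by
  generalize he : p :: w = v at h
  rcases h with ⟨c, w', h1, -⟩ | ⟨c, u, v, h1, h2⟩
  · simp only [List.cons.injEq] at he
    rw [val_cons] at hu
    exact absurd he.1.symm (merge_ne_right hu.1.1)
  · simp only [List.cons.injEq] at he
    rw [val_cons] at hu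
    obtain ⟨rfl, rfl⟩ := he
    exact ⟨h1.eq_empty hM hpM subset_rfl, (h2.mrg.minAt_iff hu.2).1 (h2.minAt hp)⟩

theorem Up.functional (hM : Gens M) (hp : Pure p) (hpM : p.2 ⊆ M) {v' : List (Ltr σ)}
    (h : Up p u v) (h' : Up p u v') : v = v' := by
  induction h generalizing v' with
  | here c w h1 h2 =>
    cases h' with
    | here _ _ _ _ => rfl
    | there _ _ v h3 h4 => exact absurd (h4.later_left hM hp hpM) h2
  | there c u v h1 h2 ih =>
    cases h' with
    | here _ w h3 h4 => exact absurd (h2.later_left hM hp hpM) h4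
    | there _ _ v' h3 h4 => rw [ih h4]

theorem Up.injective (hM : Gens M) (hp : Pure p) (hpM : p.2 ⊆ M) {u' : List (Ltr σ)}
    (hu : Val M u) (hu' : Val M u') (h : Up p u v) (h' : Up p u' v) : u = u' := by
  have key : ∀ c w u', Val M u' → Cop p.2 (merge c p).2 → Up p u' w → Later p w :=
    fun c w u' hu' h1 h2 => ⟨h1.eq_empty hM hpM Finset.subset_union_right,
      (h2.mrg.minAt_iff hu').1 (h2.minAt hp)⟩
  induction h generalizing u' with
  | here c w h1 h2 =>
    generalize he : merge c p :: w = v' at h'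
    cases h' with
    | here c' w' h3 h4 =>
      simp only [List.cons.injEq] at he
      rw [merge_cancel hM hpM h1 h3 he.1, he.2]
    | there c' u v h3 h4 =>
      simp only [List.cons.injEq] at he
      obtain ⟨rfl, rfl⟩ := he
      exact absurd (key _ _ _ (val_cons.1 hu').2 h3 h4) h2
  | there c u v h1 h2 ih =>
    rw [val_cons] at hu
    generalize he : c :: v = v' at h'
    cases h' with
    | here c' w' h3 h4 =>
      simp only [List.cons.injEq] at he
      obtain ⟨rfl, rfl⟩ := he
      exact absurd (key _ _ _ hu.2 h1 h2) h4
    | there c' u' v' h3 h4 =>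
      simp only [List.cons.injEq] at he
      obtain ⟨rfl, rfl⟩ := he
      rw [ih hu.2 (val_cons.1 hu').2 h4]

theorem Up.not_up (hM : Gens M) (hp : Pure p) (hpM : p.2 ⊆ M) {v' : List (Ltr σ)}
    (hu : Val M u) (h : Up p u v) (h' : Up p v v') : False := by
  induction h generalizing v' with
  | here c w h1 h2 =>
    generalize he : merge c p :: w = v at h'
    cases h' with
    | here c' w' h3 h4 =>
      simp only [List.cons.injEq] at he
      obtain ⟨rfl, rfl⟩ := he
      exact h2 ⟨h3.eq_empty hM hpM Finset.subset_union_right, .inl hp.atomOf⟩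
    | there c' u v h3 h4 =>
      simp only [List.cons.injEq] at he
      obtain ⟨rfl, rfl⟩ := he
      exact h2 ⟨h3.eq_empty hM hpM Finset.subset_union_right, h4.minAt hp⟩
  | there c u v h1 h2 ih =>
    rw [val_cons] at hu
    cases h' with
    | here c' w' h3 h4 => exact h4 (h2.later_right hM hp hpM hu.2)
    | there c' u' v' h3 h4 => exact ih hu.2 h4

/-- The matching of words. -/
inductive Match (key : Mon σ → ℕ) : List (Ltr σ) → List (Ltr σ) → Prop
  | peel (p : Ltr σ) (u v : List (Ltr σ)) : Sel key p (p :: u) → ¬ Later p u →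
      Match key u v → Match key (p :: u) (p :: v)
  | top (p : Ltr σ) (u v : List (Ltr σ)) : Sel key p u → Up p u v → Match key u v

/-- The words unmatched by `Match`. -/
def Crit (key : Mon σ → ℕ) : List (Ltr σ) → Prop
  | [] => True
  | c :: w => Sel key c (c :: w) ∧ ¬ Later c w ∧ Crit key w

theorem Match.mrg (h : Match key u v) : Mrg u v := by
  induction h with
  | peel p u v _ _ _ ih => exact .cons p u v ih
  | top p u v _ h => exact h.mrg

theorem match_total (hM : Gens M) (hw : Val M w) (hc : ¬ Crit key w) :
    (∃ v, Match key w v) ∨ ∃ u, Val M u ∧ Match key u w := by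
  induction w with
  | nil => exact absurd trivial hc
  | cons c w ih =>
    obtain ⟨p, hp⟩ := exists_sel (key := key) hw (List.cons_ne_nil c w)
    rcases up_or_head hM hw hp.1 with ⟨w', h1, h2⟩ | ⟨v, h1⟩ | ⟨u, h1, h2⟩
    · simp only [List.cons.injEq] at h1
      obtain ⟨rfl, rfl⟩ := h1
      rw [val_cons] at hw
      rcases ih hw.2 (fun h => hc ⟨hp, h2, h⟩) with ⟨v, hv⟩ | ⟨u, hu, huw⟩
      · exact .inl ⟨_, .peel _ _ _ hp h2 hv⟩
      · refine .inr ⟨c :: u, val_cons.2 ⟨hw.1, hu⟩, .peel _ _ _ ?_ ?_ huw⟩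
        · exact ((Mrg.cons c _ _ huw.mrg).sel_iff (val_cons.2 ⟨hw.1, hu⟩)).2 hp
        · rwa [huw.mrg.later_iff hu]
    · exact .inl ⟨v, .top p _ _ hp h1⟩
    · exact .inr ⟨u, h1, .top p _ _ ((h2.mrg.sel_iff h1).2 hp) h2⟩

theorem Match.functional (hM : Gens M) (hk : Function.Injective key) {v' : List (Ltr σ)}
    (hu : Val M u) (h : Match key u v) (h' : Match key u v') : v = v' := by
  induction h generalizing v' with
  | peel p u v h1 h2 h3 ih =>
    cases h' with
    | peel _ _ v' _ _ h6 => rw [ih (val_cons.1 hu).2 h6]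
    | top q _ _ h4 h5 =>
      obtain rfl := h1.unique hM hk h4 hu
      exact absurd (h5.later_left hM h1.1.pure (h1.1.subset hu)) h2
  | top p u v h1 h2 =>
    cases h' with
    | peel q u v' h4 h5 h6 =>
      obtain rfl := h1.unique hM hk h4 hu
      exact absurd (h2.later_left hM h1.1.pure (h1.1.subset hu)) h5
    | top q _ _ h4 h5 =>
      obtain rfl := h1.unique hM hk h4 hu
      exact h2.functional hM h1.1.pure (h1.1.subset hu) h5

theorem Match.injective (hM : Gens M) (hk : Function.Injective key) {u' : List (Ltr σ)}
    (hu : Val M u) (hu' : Val M u') (h : Match key u v) (h' : Match key u' v) : u = u' := by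
  induction h generalizing u' with
  | peel p u v h1 h2 h3 ih =>
    have hv := ((Mrg.cons p _ _ h3.mrg).sel_iff hu).1 h1
    have hvv := (Mrg.cons p _ _ h3.mrg).val hu
    rw [h3.mrg.later_iff (val_cons.1 hu).2] at h2
    generalize he : p :: v = v' at h'
    cases h' with
    | peel q u' v' h4 h5 h6 =>
      simp only [List.cons.injEq] at he
      obtain ⟨rfl, rfl⟩ := he
      rw [ih (val_cons.1 hu).2 (val_cons.1 hu').2 h6]
    | top q _ _ h4 h5 =>
      subst he
      obtain rfl := hv.unique hM hk ((h5.mrg.sel_iff hu').1 h4) hvv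
      exact absurd (h5.later_right hM h1.1.pure (h1.1.subset hu) hu') h2
  | top p u v h1 h2 =>
    have hv := (h2.mrg.sel_iff hu).1 h1
    have hvv := h2.mrg.val hu
    cases h' with
    | peel q u' v' h4 h5 h6 =>
      rw [h6.mrg.later_iff (val_cons.1 hu').2] at h5
      obtain rfl := hv.unique hM hk (((Mrg.cons q _ _ h6.mrg).sel_iff hu').1 h4) hvv
      exact absurd (h2.later_right hM h1.1.pure (h1.1.subset hu) hu) h5
    | top q _ _ h4 h5 =>
      obtain rfl := hv.unique hM hk ((h5.mrg.sel_iff hu').1 h4) hvv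
      exact h2.injective hM h1.1.pure (h1.1.subset hu) hu hu' h5

theorem Match.not_match (hM : Gens M) (hk : Function.Injective key) {v' : List (Ltr σ)}
    (hu : Val M u) (h : Match key u v) (h' : Match key v v') : False := by
  induction h generalizing v' with
  | peel p u v h1 h2 h3 ih =>
    have hv := ((Mrg.cons p _ _ h3.mrg).sel_iff hu).1 h1
    have hvv := (Mrg.cons p _ _ h3.mrg).val hu
    rw [h3.mrg.later_iff (val_cons.1 hu).2] at h2
    cases h' with
    | peel _ _ v' h4 h5 h6 => exact ih (val_cons.1 hu).2 h6
    | top q _ _ h4 h5 =>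
      obtain rfl := hv.unique hM hk h4 hvv
      exact h2 (h5.later_left hM h1.1.pure (h1.1.subset hu))
  | top p u v h1 h2 =>
    have hv := (h2.mrg.sel_iff hu).1 h1
    have hvv := h2.mrg.val hu
    cases h' with
    | peel q v v' h4 h5 h6 =>
      obtain rfl := hv.unique hM hk h4 hvv
      exact h5 (h2.later_right hM h1.1.pure (h1.1.subset hu) hu)
    | top q _ _ h4 h5 =>
      obtain rfl := hv.unique hM hk h4 hvv
      exact h2.not_up hM h1.1.pure (h1.1.subset hu) hu h5

theorem Match.not_crit_left (hM : Gens M) (hk : Function.Injective key) (hu : Val M u)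
    (h : Match key u v) : ¬ Crit key u := by
  induction h with
  | peel p u v h1 h2 h3 ih => exact fun hc => ih (val_cons.1 hu).2 hc.2.2
  | top p u v h1 h2 =>
    intro hc
    cases u with
    | nil => cases h2
    | cons c u =>
      obtain rfl := h1.unique hM hk hc.1 hu
      exact hc.2.1 (h2.later_left hM h1.1.pure (h1.1.subset hu))

theorem Match.not_crit_right (hM : Gens M) (hk : Function.Injective key) (hu : Val M u)
    (h : Match key u v) : ¬ Crit key v := by
  induction h with
  | peel p u v h1 h2 h3 ih => exact fun hc => ih (val_cons.1 hu).2 hc.2.2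
  | top p u v h1 h2 =>
    intro hc
    cases v with
    | nil => cases h2
    | cons c v =>
      obtain rfl := ((h2.mrg.sel_iff hu).1 h1).unique hM hk hc.1 (h2.mrg.val hu)
      exact hc.2.1 (h2.later_right hM h1.1.pure (h1.1.subset hu) hu)

end Words

section Rank
variable {σ : Type*} {M : Finset (Mon σ)} {p q a b c d : Ltr σ} {u v w : List (Ltr σ)}
  {key : Mon σ → ℕ}

/-- The number of letters after the position of `p` in a word. -/
def aft (p : Ltr σ) : List (Ltr σ) → ℕ
  | [] => 0
  | c :: w => if MinAt p w ∧ Cop p.2 c.2 then aft p w else w.length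

theorem minAt_self (hp : Pure p) : MinAt p (p :: w) := .inl hp.atomOf

theorem aft_cons_of (h : MinAt p w) (hc : Cop p.2 c.2) : aft p (c :: w) = aft p w :=
  if_pos ⟨h, hc⟩

theorem aft_self_cons (hM : Gens M) (hpM : p.2 ⊆ M) (h : ¬ Later p w) :
    aft p (p :: w) = w.length :=
  if_neg fun h' => h ⟨h'.2.eq_empty hM hpM subset_rfl, h'.1⟩

theorem Up.cop_head (h : Up p (c :: u) v) (hp : Pure p) : Cop p.2 c.2 ∧ MinAt p u := by
  cases h with
  | here _ w h1 _ => exact ⟨h1, .inl hp.atomOf⟩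
  | there _ _ v h1 h2 => exact ⟨h1, h2.minAt hp⟩

theorem Up.aft_lt (hM : Gens M) (hp : Pure p) (hpM : p.2 ⊆ M) {u' v' : List (Ltr σ)}
    (hu : Val M u) (hu' : Val M u') (h : Up p u v) (hm : Mrg u v') (h' : Up p u' v')
    (hne : v ≠ v') : aft p u' < aft p u := by
  induction h generalizing u' v' with
  | here c w h1 h2 =>
    rw [aft_cons_of (minAt_self hp) h1, aft_self_cons hM hpM h2]
    cases hm with
    | head _ _ _ _ => exact absurd rfl hne
    | cons _ _ v1 hm =>
      cases hm with
      | head _ d w' hpd =>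
        have h3 : p.2 = ∅ → ¬ MinAt p w' := fun he hw' =>
          h2 ⟨he, .inr ⟨hw', by rw [he]; exact cop_empty_left _⟩⟩
        generalize he : c :: merge p d :: w' = z at h'
        cases h' with
        | here c' w'' h4 h5 =>
          simp only [List.cons.injEq] at he
          obtain ⟨rfl, rfl⟩ := he
          have he := h1.eq_empty hM hpM Finset.subset_union_right
          refine absurd ⟨he, .inl ?_⟩ h5
          rw [val_cons, val_cons, val_cons] at hu
          exact (atomOf_merge hu.2.1 hu.2.2.1 hpd).2 (.inl hp.atomOf)
        | there c' u' v' h4 h5 =>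
          simp only [List.cons.injEq] at he
          obtain ⟨rfl, rfl⟩ := he
          rw [aft_cons_of (h5.minAt hp) h4]
          generalize he : merge p d :: w' = z at h5
          cases h5 with
          | here c' w'' h6 h7 =>
            simp only [List.cons.injEq] at he
            obtain ⟨-, rfl⟩ := he
            rw [aft_cons_of (minAt_self hp) h6, aft_self_cons hM hpM h7]
            simp
          | there c' u'' v'' h6 h7 =>
            simp only [List.cons.injEq] at he
            obtain ⟨rfl, rfl⟩ := he
            have he := h6.eq_empty hM hpM Finset.subset_union_left
            refine absurd ?_ (h3 he)
            rw [val_cons, val_cons] at hu'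
            exact (h7.mrg.minAt_iff hu'.2.2).1 (h7.minAt hp)
      | cons _ _ w1 hm =>
        generalize he : c :: p :: w1 = z at h'
        cases h' with
        | here c' w'' h4 h5 =>
          simp only [List.cons.injEq] at he
          obtain ⟨rfl, rfl⟩ := he
          exact absurd ⟨h1.eq_empty hM hpM Finset.subset_union_right, .inl hp.atomOf⟩ h5
        | there c' u' v' h4 h5 =>
          simp only [List.cons.injEq] at he
          obtain ⟨rfl, rfl⟩ := he
          rw [val_cons] at hu' hu
          rw [val_cons] at hu
          rw [hm.later_iff hu.2.2] at h2
          exact absurd (h5.later_right hM hp hpM hu'.2) h2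
  | there c u v h1 h2 ih =>
    rw [aft_cons_of (h2.minAt hp) h1]
    rw [val_cons] at hu
    cases hm with
    | cons _ _ v1 hm =>
      generalize he : c :: v1 = z at h'
      cases h' with
      | here c' w'' h4 h5 =>
        simp only [List.cons.injEq] at he
        obtain ⟨rfl, rfl⟩ := he
        exact absurd ⟨h1.eq_empty hM hpM Finset.subset_union_right,
          (hm.minAt_iff hu.2).1 (h2.minAt hp)⟩ h5
      | there c' u' v' h4 h5 =>
        simp only [List.cons.injEq] at he
        obtain ⟨rfl, rfl⟩ := he
        rw [aft_cons_of (h5.minAt hp) h4]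
        exact ih hu.2 (val_cons.1 hu').2 hm h5 fun he => hne (by rw [he])
    | head _ d w hcd =>
      obtain ⟨h6, h7⟩ := h2.cop_head hp
      generalize he : merge c d :: w = z at h'
      cases h' with
      | here c' w'' h4 h5 =>
        simp only [List.cons.injEq] at he
        obtain ⟨he, rfl⟩ := he
        have h8 : p.2 ⊆ (merge c d).2 := by
          rw [he]
          exact Finset.subset_union_right
        exact absurd ⟨(cop_union_right.2 ⟨h1, h6⟩).eq_empty hM hpM h8, h7⟩ h5
      | there c' u' v' h4 h5 =>
        simp only [List.cons.injEq] at he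
        obtain ⟨rfl, rfl⟩ := he
        rw [val_cons] at hu'
        cases h2 with
        | here _ w' h8 h9 => exact absurd (h5.later_right hM hp hpM hu'.2) h9
        | there _ _ v2 h8 h9 => exact (h5.not_up hM hp hpM hu'.2 h9).elim

/-- The rank of a word: the number of peeled letters and the position of the factor. -/
def rk (key : Mon σ → ℕ) : List (Ltr σ) → ℕ ×ₗ ℕ
  | [] => toLex (0, 0)
  | c :: w => if Sel key c (c :: w) ∧ ¬ Later c w then
      toLex ((ofLex (rk key w)).1 + 1, (ofLex (rk key w)).2)
    else if h : ∃ p, Sel key p (c :: w) then toLex (0, aft h.choose (c :: w)) else toLex (0, 0)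

theorem rk_peel (h : Sel key p (p :: w)) (h' : ¬ Later p w) :
    rk key (p :: w) = toLex ((ofLex (rk key w)).1 + 1, (ofLex (rk key w)).2) := if_pos ⟨h, h'⟩

theorem rk_top (hM : Gens M) (hk : Function.Injective key) (hu : Val M u) (h : Sel key p u)
    (h' : Up p u v) : rk key u = toLex (0, aft p u) := by
  cases u with
  | nil => cases h'
  | cons c u =>
    have h1 : ¬ (Sel key c (c :: u) ∧ ¬ Later c u) := by
      rintro ⟨h1, h2⟩
      obtain rfl := h.unique hM hk h1 hu
      exact h2 (h'.later_left hM h.1.pure (h.1.subset hu))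
    have h2 : ∃ p, Sel key p (c :: u) := ⟨p, h⟩
    rw [rk, if_neg h1, dif_pos h2, h2.choose_spec.unique hM hk h hu]

theorem merge_not_pure (hc : c ∈ validL M) (hd : d ∈ validL M) : ¬ Pure (merge c d) := by
  have hcl := mlcm_le_iff.2 hc.2.2
  have hdl := mlcm_le_iff.2 hd.2.2
  rintro (⟨h1, i, h2⟩ | ⟨h1, h2⟩)
  · simp only [merge] at h2
    have hx : ∀ x y : Mon σ, x + y = Pi.single i 1 → x ≠ 0 → x i ≠ 0 := by
      intro x y h hx h0
      apply hx
      funext j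
      by_cases hj : j = i
      · rw [hj, h0]
        rfl
      · have := congrFun h j
        simp only [Pi.add_apply, Pi.single_eq_of_ne hj] at this
        simp only [Pi.zero_apply]
        omega
    have e1 := hx _ _ h2 hc.1
    have e2 := hx _ _ ((add_comm _ _).trans h2) hd.1
    have := congrFun h2 i
    simp only [Pi.add_apply, Pi.single_eq_same] at this
    omega
  · simp only [merge, mlcm_union] at h1 h2
    have hi : ∀ i, (c.1 i = 0 ∨ d.1 i = 0) ∧ mlcm c.2 i = c.1 i ∧ mlcm d.2 i = d.1 i := by
      intro i
      have e1 := congrFun h2 i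
      have e2 : mlcm c.2 i ≤ c.1 i := hcl i
      have e3 : mlcm d.2 i ≤ d.1 i := hdl i
      simp only [Pi.add_apply, Pi.sup_apply] at e1
      rcases le_total (mlcm c.2 i) (mlcm d.2 i) with h | h
      · rw [sup_eq_right.2 h] at e1
        omega
      · rw [sup_eq_left.2 h] at e1
        omega
    have hcop : Cop c.2 d.2 := by
      rintro s hs t ht ⟨i, h3, h4⟩
      have e1 : s i ≤ c.1 i := hc.2.2 s hs i
      have e2 : t i ≤ d.1 i := hd.2.2 t ht i
      have := (hi i).1
      omega
    have hcon : ∀ {x y : Ltr σ}, x.2 ∪ y.2 ⊆ x.2 → Cop x.2 y.2 → x ∈ validL M → y.1 ≠ 0 →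
        (∀ i, mlcm y.2 i = y.1 i) → False := by
      intro x y hxy hc hx hy hl
      obtain ⟨i, hne⟩ := Function.ne_iff.1 hy
      rw [← hl i] at hne
      obtain ⟨s, hs, hsi⟩ := mlcm_apply_ne hne
      exact hc s (hxy (Finset.mem_union_right _ hs)) s hs ⟨i, hsi, hsi⟩
    rcases h1.subset_or_subset subset_rfl hcop with h | h
    · exact hcon h hcop hc hd.1 fun i => (hi i).2.2
    · rw [Finset.union_comm] at h
      exact hcon h hcop.symm hd hc.1 fun i => (hi i).2.1

theorem Match.rk_lt (hM : Gens M) (hk : Function.Injective key) {u' v' : List (Ltr σ)}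
    (hu : Val M u) (hu' : Val M u') (h : Match key u v) (hm : Mrg u v') (h' : Match key u' v')
    (hne : v ≠ v') : rk key u' < rk key u := by
  induction h generalizing u' v' with
  | peel p u v h1 h2 h3 ih =>
    have hs := (hm.sel_iff hu).1 h1
    have hpM := h1.1.subset hu
    have hvv := hm.val hu
    rw [rk_peel h1 h2]
    cases hm with
    | cons _ _ v1 hm =>
      rw [val_cons] at hu
      generalize he : p :: v1 = z at h'
      cases h' with
      | peel q u1 v1' h4 h5 h6 =>
        simp only [List.cons.injEq] at he
        obtain ⟨rfl, rfl⟩ := he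
        rw [rk_peel h4 h5]
        have := ih hu.2 (val_cons.1 hu').2 hm h6 fun he => hne (by rw [he])
        rw [Prod.Lex.lt_iff] at this ⊢
        simp only [ofLex_toLex]
        omega
      | top q _ _ h4 h5 =>
        subst he
        obtain rfl := hs.unique hM hk ((h5.mrg.sel_iff hu').1 h4) hvv
        rw [hm.later_iff hu.2] at h2
        exact absurd (h5.later_right hM h1.1.pure hpM hu') h2
    | head _ d w hpd =>
      generalize he : merge p d :: w = z at h' hs hvv
      cases h' with
      | peel q u1 v1' h4 h5 h6 =>
        obtain rfl := hs.unique hM hk ((((Mrg.cons q _ _ h6.mrg)).sel_iff hu').1 h4) hvv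
        simp only [List.cons.injEq] at he
        rw [val_cons, val_cons] at hu
        have := he.1
        rw [merge] at this
        have := (Prod.ext_iff.1 this).1
        simp only [add_eq_left] at this
        exact absurd this hu.2.1.1
      | top q _ _ h4 h5 =>
        rw [rk_top hM hk hu' h4 h5, Prod.Lex.lt_iff]
        left
        simp
  | top p u v h1 h2 =>
    have hs := (hm.sel_iff hu).1 h1
    have hpM := h1.1.subset hu
    have hvv := hm.val hu
    cases h' with
    | peel q u1 v1' h4 h5 h6 =>
      obtain rfl := hs.unique hM hk ((((Mrg.cons q _ _ h6.mrg)).sel_iff hu').1 h4) hvv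
      generalize he : p :: v1' = z at hm
      cases hm with
      | head c d w hcd =>
        simp only [List.cons.injEq] at he
        rw [val_cons, val_cons] at hu
        exact absurd (he.1 ▸ h1.1.pure) (merge_not_pure hu.1 hu.2.1)
      | cons c u0 v0 hm =>
        simp only [List.cons.injEq] at he
        obtain ⟨rfl, rfl⟩ := he
        rw [h6.mrg.later_iff (val_cons.1 hu').2, ← hm.later_iff (val_cons.1 hu).2] at h5
        exact absurd (h2.later_left hM h1.1.pure hpM) h5
    | top q _ _ h4 h5 =>
      obtain rfl := hs.unique hM hk ((h5.mrg.sel_iff hu').1 h4) hvv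
      rw [rk_top hM hk hu' h4 h5, rk_top hM hk hu h1 h2, Prod.Lex.lt_iff]
      right
      exact ⟨rfl, h2.aft_lt hM h1.1.pure hpM hu hu' hm h5 hne⟩

end Rank

section Labels
variable {σ : Type*} {M : Finset (Mon σ)} {p q a b c d : Ltr σ} {u v w : List (Ltr σ)}
  {key : Mon σ → ℕ}

/-- The monomial is a variable. -/
def VarL (g : Mon σ) : Prop := ∃ i, g = Pi.single i 1

/-- Coprimality of pure letters, in terms of labels. -/
def LCop (g h : Mon σ) : Prop := VarL g ∨ VarL h ∨ ¬ NCF g h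

/-- `MinAt` in terms of labels. -/
def LMin (g : Mon σ) : List (Mon σ) → Prop
  | [] => False
  | h :: w => g = h ∨ (LMin g w ∧ LCop g h)

/-- `Crit` in terms of labels. -/
def LCrit (key : Mon σ → ℕ) : List (Mon σ) → Prop
  | [] => True
  | g :: w => (∀ h, LMin h (g :: w) → key g ≤ key h) ∧ ¬ (VarL g ∧ LMin g w) ∧ LCrit key w

/-- The valid pure letters. -/
def pureL (M : Finset (Mon σ)) : Set (Ltr σ) := {p | Pure p ∧ p ∈ validL M}

theorem pureL_var (hM : Gens M) (hp : p ∈ pureL M) : VarL p.1 ↔ p.2 = ∅ := by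
  constructor
  · rintro ⟨i, hi⟩
    rcases hp.1 with h | ⟨h1, h2⟩
    · exact h.1
    · exact absurd (h2.symm.trans hi) (conn_lcm_ne_single hM h1.1 hp.2.2.1 i)
  · intro h
    rcases hp.1 with ⟨-, i, h⟩ | ⟨h1, -⟩
    · exact ⟨i, h⟩
    · exact absurd h h1.1.ne_empty

theorem cop_iff_not_ncf {S U : Finset (Mon σ)} : Cop S U ↔ ¬ NCF (mlcm S) (mlcm U) := by
  refine ⟨Cop.not_ncf, fun h s hs u hu => ?_⟩
  rintro ⟨i, h1, h2⟩
  refine h ⟨i, ?_, ?_⟩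
  · have : s i ≤ mlcm S i := le_mlcm hs i
    omega
  · have : u i ≤ mlcm U i := le_mlcm hu i
    omega

theorem pureL_cop (hM : Gens M) (hp : p ∈ pureL M) (hq : q ∈ pureL M) :
    Cop p.2 q.2 ↔ LCop p.1 q.1 := by
  rw [LCop, pureL_var hM hp, pureL_var hM hq]
  by_cases h1 : p.2 = ∅
  · simp [h1, cop_empty_left]
  by_cases h2 : q.2 = ∅
  · simp [h2, cop_empty_right]
  have e1 : p.1 = mlcm p.2 := by
    rcases hp.1 with h | h
    · exact absurd h.1 h1
    · exact h.2
  have e2 : q.1 = mlcm q.2 := by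
    rcases hq.1 with h | h
    · exact absurd h.1 h2
    · exact h.2
  rw [cop_iff_not_ncf, e1, e2]
  tauto

theorem lMin_iff (hM : Gens M) (hw : ∀ c ∈ w, c ∈ pureL M) {g : Mon σ} :
    LMin g (w.map Prod.fst) ↔ ∃ p ∈ pureL M, p.1 = g ∧ MinAt p w := by
  induction w with
  | nil => simp [LMin, MinAt]
  | cons c w ih =>
    rw [List.forall_mem_cons] at hw
    rw [List.map_cons, LMin, ih hw.2]
    constructor
    · rintro (rfl | ⟨⟨p, h1, rfl, h3⟩, h4⟩)
      · exact ⟨c, hw.1, rfl, .inl hw.1.1.atomOf⟩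
      · exact ⟨p, h1, rfl, .inr ⟨h3, (pureL_cop hM h1 hw.1).2 h4⟩⟩
    · rintro ⟨p, h1, rfl, h3 | h3⟩
      · exact .inl (congrArg Prod.fst (h3.eq_of_pure hw.1.1))
      · exact .inr ⟨⟨p, h1, rfl, h3.1⟩, (pureL_cop hM h1 hw.1).1 h3.2⟩

theorem pureL.val (hw : ∀ c ∈ w, c ∈ pureL M) : Val M w := fun c hc => (hw c hc).2

theorem MinAt.mem_pureL (hM : Gens M) (hw : Val M w) (h : MinAt p w) : p ∈ pureL M :=
  ⟨h.pure, h.pure.valid hM (h.subset hw)⟩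

theorem crit_iff (hM : Gens M) (hw : ∀ c ∈ w, c ∈ pureL M) :
    Crit key w ↔ LCrit key (w.map Prod.fst) := by
  induction w with
  | nil => simp [Crit, LCrit]
  | cons c w ih =>
    have hw' := List.forall_mem_cons.1 hw
    have e1 : Sel key c (c :: w) ↔
        ∀ h, LMin h ((c :: w).map Prod.fst) → key c.1 ≤ key h := by
      simp only [lMin_iff hM hw]
      constructor
      · rintro ⟨-, h⟩ _ ⟨p, -, rfl, hp⟩
        exact h p hp
      · exact fun h => ⟨minAt_self hw'.1.1, fun q hq =>
          h _ ⟨q, hq.mem_pureL hM (pureL.val hw), rfl, hq⟩⟩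
    have e2 : Later c w ↔ VarL c.1 ∧ LMin c.1 (w.map Prod.fst) := by
      rw [Later, pureL_var hM hw'.1, lMin_iff hM hw'.2]
      refine and_congr_right fun _ => ⟨fun h => ⟨c, hw'.1, rfl, h⟩, ?_⟩
      rintro ⟨p, hp, h1, h2⟩
      have h3 : c.2 = ∅ := by assumption
      have h4 : p.2 = ∅ := by
        rw [← pureL_var hM hp, h1, pureL_var hM hw'.1, h3]
      rwa [show c = p from Prod.ext h1.symm (h3.trans h4.symm)]
    rw [Crit, e1, e2, ih hw'.2]
    rfl

theorem Crit.pureL (hw : Val M w) (h : Crit key w) : ∀ c ∈ w, c ∈ pureL M := by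
  induction w with
  | nil => simp
  | cons c w ih =>
    rw [val_cons] at hw
    exact List.forall_mem_cons.2 ⟨⟨h.1.1.pure, hw.1⟩, ih hw.2 h.2.2⟩

end Labels

section Reduction
variable {k : Type*} [Field k] {σ : Type*} {M : Finset (Mon σ)} {p q a b c d : Ltr σ}
  {u v w : List (Ltr σ)} {key o : Mon σ → ℕ}
open BarData

/-- The measure of a letter decreased by the terms of the differential which are not products
of coprime letters. -/
def wtL [Fintype σ] (a : Ltr σ) : ℕ := a.2.card + ∑ i, mlcm a.2 i

/-- The sum of the weights of the letters of a word. -/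
def wt [Fintype σ] (w : List (Ltr σ)) : ℕ := (w.map wtL).sum

theorem card_union_letters {S U : Finset (Mon σ)} (h : Disjoint S U) :
    (S ∪ U).card = S.card + U.card := Finset.card_union_of_disjoint h

theorem card_erase_letters {S : Finset (Mon σ)} {s : Mon σ} (h : s ∈ S) :
    (S.erase s).card < S.card := Finset.card_erase_lt_of_mem h

theorem mlcm_erase_le (S : Finset (Mon σ)) (s : Mon σ) : mlcm (S.erase s) ≤ mlcm S :=
  mlcm_mono (Finset.erase_subset s S)

theorem wtL_merge [Fintype σ] (hM : Gens M) (hc : c ∈ validL M) (h : Cop c.2 d.2) :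
    wtL (merge c d) = wtL c + wtL d := by
  simp only [wtL, merge]
  rw [card_union_letters (h.disjoint hM hc.2.1), h.mlcm_union]
  simp only [Pi.add_apply, Finset.sum_add_distrib]
  omega

theorem Mrg.wt_eq [Fintype σ] (hM : Gens M) (hu : Val M u) (h : Mrg u v) : wt v = wt u := by
  induction h with
  | head c d w h =>
    rw [val_cons] at hu
    simp only [wt, List.map_cons, List.sum_cons, wtL_merge hM hu.1 h]
    omega
  | cons c u v h ih =>
    have := ih (val_cons.1 hu).2
    simp only [wt, List.map_cons, List.sum_cons] at this ⊢
    omega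

theorem step_wt [Fintype σ] (h : (taylor k o).Step u v) : wt v < wt u ∨ Mrg u v := by
  induction h with
  | @int a b w h =>
    left
    obtain ⟨s, hs, rfl⟩ := taylor_d_ne h
    have h1 := card_erase_letters hs
    have h2 := Finset.sum_le_sum fun i (_ : i ∈ Finset.univ) => mlcm_erase_le a.2 s i
    simp only [wt, List.map_cons, List.sum_cons, wtL]
    omega
  | @mul a b c w h =>
    obtain ⟨hd, rfl⟩ := taylor_mul_ne h
    by_cases hc : Cop a.2 b.2
    · exact .inr (.head a b w hc)
    left
    rw [cop_iff_not_ncf, not_not] at hc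
    obtain ⟨i, h1, h2⟩ := hc
    have h0 := mlcm_union a.2 b.2
    have h3 : ∑ i, (mlcm a.2 ⊔ mlcm b.2) i < ∑ i, (mlcm a.2 i + mlcm b.2 i) := by
      refine Finset.sum_lt_sum (fun j _ => ?_) ⟨i, Finset.mem_univ i, ?_⟩
      · simp
      · simp only [Pi.sup_apply]
        rcases le_total (mlcm a.2 i) (mlcm b.2 i) with h | h
        · rw [sup_eq_right.2 h]
          omega
        · rw [sup_eq_left.2 h]
          omega
    rw [Finset.sum_add_distrib, ← h0] at h3
    simp only [wt, List.map_cons, List.sum_cons, wtL]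
    rw [card_union_letters hd]
    omega
  | cons a h ih =>
    rcases ih with ih | ih
    · left
      simp only [wt, List.map_cons, List.sum_cons] at ih ⊢
      omega
    · exact .inr (.cons _ _ _ ih)

theorem Mrg.length (h : Mrg u v) : u.length = v.length + 1 := by
  induction h with
  | head c d w h => simp
  | cons c u v h ih => simp [ih]

theorem Mrg.BD_ne_zero (hM : Gens M) (hu : Val M u) (h : Mrg u v) : (taylor k o).BD u v ≠ 0 := by
  have hsg : ∀ a, (taylor k o).sg a ≠ 0 := fun a => by
    rw [taylor_sg]
    exact pow_ne_zero _ (neg_ne_zero.2 one_ne_zero)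
  induction h with
  | head c d w h =>
    rw [val_cons, val_cons] at hu
    have h1 : (Finsupp.single (d :: w) (1 : k)) w = 0 :=
      Finsupp.single_eq_of_ne fun h => by simpa using congrArg List.length h
    have h2 : (Finsupp.single c (1 : k)) (merge c d) = 0 := by
      refine Finsupp.single_eq_of_ne fun h => hu.2.1.1 ?_
      simpa [merge] using congrArg Prod.fst h
    rw [BD_apply_cons, starAux_apply_cons, h1, h2, Finsupp.single_eq_same]
    simp only [mul_zero, neg_zero, zero_mul, zero_add, add_zero, mul_one]
    exact mul_ne_zero (hsg c) (taylor_mul_self_ne (h.disjoint hM hu.1.2.1))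
  | cons c u v h ih =>
    rw [val_cons] at hu
    have h1 : (Finsupp.single u (1 : k)) v = 0 :=
      Finsupp.single_eq_of_ne fun he => by
        have := h.length
        rw [he] at this
        omega
    have h2 : (taylor k o).starAux c u (c :: v) = 0 := by
      cases u with
      | nil => simp [starAux]
      | cons b u =>
        rw [starAux_apply_cons]
        refine mul_eq_zero_of_left ?_ _
        by_contra hne
        have := congrArg Prod.fst (taylor_mul_ne hne).2
        simp only [left_eq_add] at this
        exact (val_cons.1 hu.2).1.1 this
    rw [BD_apply_cons, h1, h2, Finsupp.single_eq_same]
    simp only [mul_zero, neg_zero, zero_add, one_mul]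
    exact mul_ne_zero (hsg c) (ih hu.2)

/-- If a product of two valid letters occurs in the product of the Taylor algebra,
it is not pure. -/
theorem taylor_mul_not_pure (ha : a ∈ validL M) (hb : b ∈ validL M)
    (h : (taylor k o).mul a b c ≠ 0) : ¬ Pure c := by
  rw [(taylor_mul_ne h).2]
  exact merge_not_pure ha hb

theorem pure_of_taylor_d (hM : Gens M) (ha : a ∈ validL M) (h : (taylor k o).d a b ≠ 0)
    (hb : Pure b) : Pure a := by
  obtain ⟨s, hs, rfl⟩ := taylor_d_ne h
  have hs0 := hM.ne_zero s (ha.2.1 hs)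
  rcases hb with ⟨-, i, h2⟩ | ⟨h1, h2⟩
  · simp only at h2
    exact absurd (h2 ▸ ha.2.2 s hs) (hM.not_le s (ha.2.1 hs) i)
  · simp only at h1 h2
    have hsl : s ≤ mlcm (a.2.erase s) := h2 ▸ ha.2.2 s hs
    have hncop : ∀ U : Finset (Mon σ), s ∈ U → ¬ Cop U (a.2.erase s) := by
      intro U hU hc
      obtain ⟨i, hi⟩ := Function.ne_iff.1 hs0
      simp only [Pi.zero_apply] at hi
      have : s i ≤ mlcm (a.2.erase s) i := hsl i
      obtain ⟨t, ht, hti⟩ := mlcm_apply_ne (S := a.2.erase s) (i := i) (by omega)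
      exact hc s hU t ht ⟨i, hi, hti⟩
    refine .inr ⟨⟨⟨s, hs⟩, fun C hC hCn hcop => ?_⟩, le_antisymm ?_ (mlcm_le_iff.2 ha.2.2)⟩
    · by_cases hne : (C ∩ a.2.erase s).Nonempty
      · have h3 := h1.2 _ Finset.inter_subset_right hne (hcop.mono Finset.inter_subset_left (by
          intro x
          simp only [Finset.mem_sdiff, Finset.mem_inter, Finset.mem_erase]
          tauto))
        by_cases hsC : s ∈ C
        · refine Finset.Subset.antisymm hC fun x hx => ?_
          by_cases hxs : x = s
          · rwa [hxs]
          · have : x ∈ C ∩ a.2.erase s := by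
              rw [h3]
              exact Finset.mem_erase.2 ⟨hxs, hx⟩
            exact (Finset.mem_inter.1 this).1
        · refine absurd (hcop.mono (Finset.inter_subset_left (s₂ := a.2.erase s)) subset_rfl).symm
            ?_
          rw [h3]
          exact hncop _ (Finset.mem_sdiff.2 ⟨hs, hsC⟩)
      · have hCs : C = {s} := by
          refine Finset.Subset.antisymm (fun x hx => ?_) (fun x hx => ?_)
          · by_contra hxs
            refine hne ⟨x, Finset.mem_inter.2 ⟨hx, Finset.mem_erase.2 ⟨?_, hC hx⟩⟩⟩
            simpa using hxs
          · rw [Finset.mem_singleton] at hx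
            obtain ⟨y, hy⟩ := hCn
            have : y = s := by
              by_contra hys
              exact hne ⟨y, Finset.mem_inter.2 ⟨hy, Finset.mem_erase.2 ⟨hys, hC hy⟩⟩⟩
            rwa [hx, ← this]
        subst hCs
        refine absurd (hcop.mono subset_rfl ?_) (hncop {s} (by simp))
        intro x hx
        rw [Finset.mem_erase] at hx
        simp [hx.1, hx.2]
    · rw [h2]
      exact mlcm_mono (Finset.erase_subset s a.2)

theorem step_pure (hM : Gens M) (hu : Val M u) (h : (taylor k o).Step u v)
    (hv : ∀ c ∈ v, c ∈ pureL M) :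
    (∀ c ∈ u, c ∈ pureL M) ∧ u.map Prod.fst = v.map Prod.fst := by
  induction h with
  | @int a b w h =>
    rw [val_cons] at hu
    rw [List.forall_mem_cons] at hv ⊢
    obtain ⟨s, hs, rfl⟩ := taylor_d_ne h
    exact ⟨⟨⟨pure_of_taylor_d hM hu.1 h hv.1.1, hu.1⟩, hv.2⟩, rfl⟩
  | @mul a b c w h =>
    rw [val_cons, val_cons] at hu
    rw [List.forall_mem_cons] at hv
    exact absurd hv.1.1 (taylor_mul_not_pure hu.1 hu.2.1 h)
  | cons a h ih =>
    rw [val_cons] at hu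
    rw [List.forall_mem_cons] at hv ⊢
    obtain ⟨h1, h2⟩ := ih hu.2 hv.2
    exact ⟨⟨hv.1, h1⟩, by simp [h2]⟩

theorem step_crit (hM : Gens M) (hu : Val M u) (h : (taylor k o).Step u v) (hv : Val M v)
    (hc : Crit key v) : Crit key u := by
  have hvp := hc.pureL hv
  obtain ⟨h1, h2⟩ := step_pure hM hu h hvp
  rwa [crit_iff hM h1, h2, ← crit_iff hM hvp]

/-- The words of a piece that are not critical. -/
def ncPiece (M : Finset (Mon σ)) (key : Mon σ → ℕ) (α : Mon σ) (i : ℕ) : Set (List (Ltr σ)) :=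
  {w ∈ piece (validL M) Prod.fst tdeg α i | ¬ Crit key w}

theorem piece_val {α : Mon σ} {i : ℕ} (h : w ∈ piece (validL M) Prod.fst tdeg α i) : Val M w :=
  h.1

theorem Mrg.wlab_eq (h : Mrg u v) : wlab Prod.fst u = wlab Prod.fst v := by
  induction h with
  | head c d w h => simp only [wlab_cons, merge, add_assoc]
  | cons c u v h ih => simp only [wlab_cons, ih]

theorem Mrg.wdeg_eq (hM : Gens M) (hu : Val M u) (h : Mrg u v) :
    wdeg tdeg u = wdeg tdeg v + 1 := by
  induction h with
  | head c d w h =>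
    rw [val_cons] at hu
    simp only [wdeg_cons, merge, tdeg]
    rw [Finset.card_union_of_disjoint (h.disjoint hM hu.1.2.1)]
    omega
  | cons c u v h ih =>
    have := ih (val_cons.1 hu).2
    simp only [wdeg_cons]
    omega

theorem D_single_one (A : BarData k (Ltr σ)) (w v : List (Ltr σ)) :
    A.D (Finsupp.single w 1) v = A.BD w v := by
  rw [D, Finsupp.linearCombination_single, one_smul]

theorem ncPiece_D (hM : Gens M) {α : Mon σ} {i : ℕ} {c : List (Ltr σ) →₀ k}
    (hc : c ∈ Finsupp.supported k k (ncPiece M key α (i + 1))) :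
    (taylor k o).D c ∈ Finsupp.supported k k (ncPiece M key α i) :=
  D_mem_supported (fun w hw v hv => by
    have h1 := taylor_graded.step_piece hw.1 hv
    exact ⟨h1, fun hc => hw.2 (step_crit hM (piece_val hw.1) hv (piece_val h1) hc)⟩) hc

theorem ncPiece_exact [Fintype σ] (hM : Gens M) (ho : Function.Injective o)
    (hk : Function.Injective key) (α : Mon σ) (i : ℕ) (c : List (Ltr σ) →₀ k)
    (hc : c ∈ Finsupp.supported k k (ncPiece M key α i)) (hDc : (taylor k o).D c = 0) :
    ∃ e ∈ Finsupp.supported k k (ncPiece M key α (i + 1)), (taylor k o).D e = c := by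
  refine exact_of_matching (ρ := ℕ ×ₗ (ℕ ×ₗ ℕ)) (taylor k o).D (ncPiece M key α) (Match key)
    (fun w => toLex (wt w, rk key w)) (fun i c hc => ncPiece_D hM hc)
    (fun i c _ => (taylor_laws ho).D_D c) ?_ ?_ ?_ ?_ i c hc hDc
  · intro i x hx
    rcases match_total hM (piece_val hx.1) hx.2 with h | ⟨u, hu, h⟩
    · exact .inr h
    · refine .inl ⟨u, ⟨⟨hu, ?_, ?_⟩, h.not_crit_left hM hk hu⟩, h⟩
      · rw [h.mrg.wdeg_eq hM hu, hx.1.2.1]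
      · rw [h.mrg.wlab_eq, hx.1.2.2]
  · intro i u hu u' hu' v h h'
    exact h.injective hM hk (piece_val hu.1) (piece_val hu'.1) h'
  · intro i u hu v h
    rw [D_single_one]
    exact h.mrg.BD_ne_zero hM (piece_val hu.1)
  · intro i u hu u' hu' v v' h h' hne hD
    rw [D_single_one] at hD
    have h1 := h'.mrg.wt_eq hM (piece_val hu'.1)
    rw [Prod.Lex.lt_iff]
    simp only [ofLex_toLex]
    rcases step_wt (Step.of_BD hD) with h2 | h2
    · left
      omega
    · right
      refine ⟨?_, h.rk_lt hM hk (piece_val hu.1) (piece_val hu'.1) h2 h' hne.symm⟩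
      rw [← h1, h2.wt_eq hM (piece_val hu.1)]

variable (k o M) in
/-- The bar data on valid pure letters, with zero product. -/
def pureBar : BarData k (Ltr σ) where
  d a := if a ∈ pureL M then ((taylor k o).d a).filter (· ∈ pureL M) else 0
  sg := (taylor k o).sg
  mul _ _ := 0

/-- The critical words of given degree and multidegree. -/
def critPiece (M : Finset (Mon σ)) (key : Mon σ → ℕ) (α : Mon σ) (i : ℕ) :
    Set (List (Ltr σ)) :=
  {w ∈ piece (pureL M) Prod.fst tdeg α i | LCrit key (w.map Prod.fst)}

theorem mem_critPiece (hM : Gens M) {α : Mon σ} {i : ℕ} :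
    w ∈ critPiece M key α i ↔ w ∈ piece (validL M) Prod.fst tdeg α i ∧ Crit key w := by
  constructor
  · rintro ⟨⟨h1, h2⟩, h3⟩
    exact ⟨⟨fun c hc => (h1 c hc).2, h2⟩, (crit_iff hM h1).2 h3⟩
  · rintro ⟨h1, h2⟩
    have h3 := h2.pureL h1.1
    exact ⟨⟨h3, h1.2⟩, (crit_iff hM h3).1 h2⟩

theorem pureBar_d_apply (ha : a ∈ pureL M) (hb : b ∈ pureL M) :
    (pureBar k M o).d a b = (taylor k o).d a b := by
  simp only [pureBar, if_pos ha]
  exact Finsupp.filter_apply_pos _ _ hb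

theorem pureBar_BD_apply (hw : ∀ c ∈ w, c ∈ pureL M) (hv : ∀ c ∈ v, c ∈ pureL M) :
    (pureBar k M o).BD w v = (taylor k o).BD w v := by
  induction w generalizing v with
  | nil => rfl
  | cons a w ih =>
    cases v with
    | nil => rw [BD_apply_nil, BD_apply_nil]
    | cons b v =>
      rw [List.forall_mem_cons] at hv
      rw [List.forall_mem_cons] at hw
      have h1 : (pureBar k M o).d a b = (taylor k o).d a b := pureBar_d_apply hw.1 hv.1
      have h2 : (pureBar k M o).starAux a w (b :: v) = 0 := by
        cases w with
        | nil => simp [starAux]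
        | cons c w =>
          rw [starAux_apply_cons]
          exact zero_mul _
      have h3 : (taylor k o).starAux a w (b :: v) = 0 := by
        cases w with
        | nil => simp [starAux]
        | cons c w =>
          rw [starAux_apply_cons]
          refine mul_eq_zero_of_left ?_ _
          by_contra hne
          exact taylor_mul_not_pure hw.1.2 (hw.2 c List.mem_cons_self).2 hne hv.1.1
      rw [BD_apply_cons, BD_apply_cons, h1, h2, h3, ih hw.2 hv.2]
      rfl

theorem pureBar_d_ne (h : (pureBar k M o).d a b ≠ 0) :
    (taylor k o).d a b ≠ 0 ∧ a ∈ pureL M ∧ b ∈ pureL M := by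
  by_cases ha : a ∈ pureL M
  · by_cases hb : b ∈ pureL M
    · rw [pureBar_d_apply ha hb] at h
      exact ⟨h, ha, hb⟩
    · simp only [pureBar, if_pos ha] at h
      exact absurd (Finsupp.filter_apply_neg _ _ hb) h
  · simp only [pureBar, if_neg ha] at h
    exact absurd rfl h

theorem pureBar_step (hw : ∀ c ∈ w, c ∈ pureL M) (h : (pureBar k M o).Step w v) :
    (∀ c ∈ v, c ∈ pureL M) ∧ v.map Prod.fst = w.map Prod.fst := by
  induction h with
  | @int a b w h =>
    rw [List.forall_mem_cons] at hw ⊢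
    obtain ⟨h1, -, h2⟩ := pureBar_d_ne h
    exact ⟨⟨h2, hw.2⟩, by simp [(taylor_graded.d hw.1.2 h1).2.1]⟩
  | mul w h => exact absurd rfl h
  | cons a h ih =>
    rw [List.forall_mem_cons] at hw ⊢
    obtain ⟨h1, h2⟩ := ih hw.2
    exact ⟨⟨hw.1, h1⟩, by simp [h2]⟩

variable (k) in
/-- Projection onto the span of a set of basis elements. -/
def projOn {Y : Type*} (K : Set Y) : (Y →₀ k) →ₗ[k] (Y →₀ k) where
  toFun c := c.filter (· ∈ K)
  map_add' _ _ := Finsupp.filter_add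
  map_smul' _ _ := Finsupp.filter_smul

theorem projOn_apply {Y : Type*} (K : Set Y) (c : Y →₀ k) (y : Y) :
    projOn k K c y = if y ∈ K then c y else 0 := Finsupp.filter_apply _ _ _

theorem torDim_eq_crit [Fintype σ] (hM : Gens M) (ho : Function.Injective o)
    (hk : Function.Injective key) (α : Mon σ) (i : ℕ) :
    torDim k (upperSet M) i α =
      homDim (fun i => Finsupp.supported k k (critPiece M key α i)) (pureBar k M o).D i := by
  rw [torDim_eq ho]
  refine homDim_eq_of_exact (C' := fun i => Finsupp.supported k k (critPiece M key α i))
    (D' := (pureBar k M o).D) (projOn k {w | Crit key w}) ?_ ?_ ?_ ?_ ?_ ?_ ?_ i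
  · intro i
    exact finiteDimensional_supported (finLetters_validL.finite_piece _ _ _)
  · intro i c hc
    exact taylorSub_D hc
  · intro c hc
    exact taylorSub_D_zero hc
  · intro i c _
    exact (taylor_laws ho).D_D c
  · intro i
    ext c
    rw [Submodule.mem_map]
    constructor
    · rintro ⟨c, hc, rfl⟩
      rw [Finsupp.mem_supported]
      intro w hw
      rw [Finset.mem_coe, Finsupp.mem_support_iff, projOn_apply] at hw
      split_ifs at hw with h
      · exact (mem_critPiece hM).2 ⟨(Finsupp.mem_supported k c).1 hc
          (Finsupp.mem_support_iff.2 hw), h⟩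
      · exact absurd rfl hw
    · intro hc
      refine ⟨c, Finsupp.supported_mono (fun w hw => ((mem_critPiece hM).1 hw).1) hc, ?_⟩
      ext w
      rw [projOn_apply]
      split_ifs with h
      · rfl
      · by_contra hne
        exact h ((mem_critPiece hM).1 ((Finsupp.mem_supported k c).1 hc
          (Finsupp.mem_support_iff.2 (Ne.symm hne)))).2
  · intro i c hc
    rw [← Finsupp.sum_single c, Finsupp.sum]
    simp only [map_sum]
    refine Finset.sum_congr rfl fun w hw => ?_
    have hwp := (Finsupp.mem_supported k c).1 hc hw
    have hval : Val M w := piece_val hwp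
    rw [D_single, map_smul]
    ext v
    rw [Finsupp.smul_apply, projOn_apply]
    by_cases hwc : Crit key w
    · have hwP := hwc.pureL hval
      have e1 : projOn k {w | Crit key w} (Finsupp.single w (c w)) = Finsupp.single w (c w) :=
        Finsupp.filter_single_of_pos _ hwc
      rw [e1, D_single, Finsupp.smul_apply]
      congr 1
      split_ifs with hv
      · by_cases hvV : ∀ c ∈ v, c ∈ pureL M
        · rw [pureBar_BD_apply hwP hvV]
        · have h1 : (taylor k o).BD w v = 0 := by
            by_contra hne
            have := (taylor_graded.step (Step.of_BD hne) hval).1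
            exact hvV (hv.pureL this)
          have h2 : (pureBar k M o).BD w v = 0 := by
            by_contra hne
            exact hvV (pureBar_step hwP (Step.of_BD hne)).1
          rw [h1, h2]
      · by_contra hne
        obtain ⟨h1, h2⟩ := pureBar_step hwP (Step.of_BD (Ne.symm hne))
        refine hv ?_
        change Crit key v
        rw [crit_iff hM h1, h2, ← crit_iff hM hwP]
        exact hwc
    · have e1 : projOn k {w | Crit key w} (Finsupp.single w (c w)) = 0 :=
        Finsupp.filter_single_of_neg _ hwc
      rw [e1, map_zero, Finsupp.zero_apply]
      split_ifs with hv
      · have : (taylor k o).BD w v = 0 := by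
          by_contra hne
          have h1 := (taylor_graded.step (Step.of_BD hne) hval).1
          exact hwc (step_crit hM hval (Step.of_BD hne) h1 hv)
        rw [this, smul_zero]
      · exact smul_zero _
  · intro i c hc hDc hpc
    have hcn : c ∈ Finsupp.supported k k (ncPiece M key α i) := by
      rw [Finsupp.mem_supported]
      intro w hw
      refine ⟨(Finsupp.mem_supported k c).1 hc hw, fun hcr => ?_⟩
      have := DFunLike.congr_fun hpc w
      rw [projOn_apply] at this
      exact Finsupp.mem_support_iff.1 hw ((if_pos hcr).symm.trans this)
    obtain ⟨e, he, hDe⟩ := ncPiece_exact hM ho hk α i c hcn hDc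
    refine ⟨e, Finsupp.supported_mono (fun w hw => hw.1) he, ?_, hDe⟩
    ext w
    rw [projOn_apply]
    split_ifs with h
    · by_contra hne
      exact ((Finsupp.mem_supported k e).1 he (Finsupp.mem_support_iff.2 hne)).2 h
    · rfl

end Reduction

section Homogeneous
variable {k : Type*} [Field k] {X Γ : Type*} {gr : X → Γ} {deg : X → ℕ}

/-- The basis elements with given grade and degree. -/
def homPiece (gr : X → Γ) (deg : X → ℕ) (γ : Γ) (j : ℕ) : Set X := {a | gr a = γ ∧ deg a = j}

/-- Endomorphisms preserving the grade and changing the degree by `n`. -/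
def Homog (gr : X → Γ) (deg : X → ℕ) (n : ℤ) (T : Module.End k (X →₀ k)) : Prop :=
  ∀ a b, T (Finsupp.single a 1) b ≠ 0 → gr b = gr a ∧ (deg b : ℤ) = deg a + n

theorem end_apply {Y : Type*} (T : (X →₀ k) →ₗ[k] (Y →₀ k)) (c : X →₀ k) (b : Y) :
    T c b = c.sum fun a r => r * T (Finsupp.single a 1) b := by
  conv_lhs => rw [← Finsupp.sum_single c, Finsupp.sum, map_sum, Finsupp.finsetSum_apply]
  refine Finset.sum_congr rfl fun a _ => ?_
  rw [← mul_one (c a), ← smul_eq_mul, ← Finsupp.smul_single, map_smul, Finsupp.smul_apply,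
    smul_eq_mul, smul_eq_mul, mul_one]

theorem exists_of_end_apply {Y : Type*} {T : (X →₀ k) →ₗ[k] (Y →₀ k)} {c : X →₀ k} {b : Y}
    (h : T c b ≠ 0) : ∃ a, c a ≠ 0 ∧ T (Finsupp.single a 1) b ≠ 0 := by
  rw [end_apply] at h
  obtain ⟨a, -, h2⟩ := Finset.exists_ne_zero_of_sum_ne_zero h
  exact ⟨a, left_ne_zero_of_mul h2, right_ne_zero_of_mul h2⟩

theorem mem_supported_of {Y : Type*} {S : Set Y} {c : Y →₀ k} (h : ∀ b, c b ≠ 0 → b ∈ S) :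
    c ∈ Finsupp.supported k k S :=
  (Finsupp.mem_supported k c).2 fun b hb => h b (Finsupp.mem_support_iff.1 hb)

theorem of_mem_supported {Y : Type*} {S : Set Y} {c : Y →₀ k} (h : c ∈ Finsupp.supported k k S)
    {b : Y} (hb : c b ≠ 0) : b ∈ S :=
  (Finsupp.mem_supported k c).1 h (Finsupp.mem_support_iff.2 hb)

namespace Homog
variable {T U : Module.End k (X →₀ k)} {m n : ℤ}

theorem mul (hT : Homog gr deg m T) (hU : Homog gr deg n U) : Homog gr deg (n + m) (T * U) := by
  intro a b h
  obtain ⟨c, h1, h2⟩ := exists_of_end_apply (T := T) (c := U (Finsupp.single a 1)) h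
  obtain ⟨h3, h4⟩ := hU a c h1
  obtain ⟨h5, h6⟩ := hT c b h2
  exact ⟨h5.trans h3, by omega⟩

theorem sub (hT : Homog gr deg n T) (hU : Homog gr deg n U) : Homog gr deg n (T - U) := by
  intro a b h
  by_cases h1 : T (Finsupp.single a 1) b = 0
  · refine hU a b fun h2 => h ?_
    rw [LinearMap.sub_apply, Finsupp.sub_apply, h1, h2, sub_zero]
  · exact hT a b h1

theorem one : Homog gr deg 0 (1 : Module.End k (X →₀ k)) := by
  intro a b h
  have : a = b := by
    by_contra hab
    exact h (Finsupp.single_eq_of_ne (Ne.symm hab))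
  subst this
  simp

theorem apply_ne (hT : Homog gr deg n T) {γ : Γ} {j : ℕ} {c : X →₀ k}
    (hc : c ∈ Finsupp.supported k k (homPiece gr deg γ j)) {b : X} (hb : T c b ≠ 0) :
    gr b = γ ∧ (deg b : ℤ) = j + n := by
  obtain ⟨a, h1, h2⟩ := exists_of_end_apply hb
  obtain ⟨h3, h4⟩ := of_mem_supported hc h1
  obtain ⟨h5, h6⟩ := hT a b h2
  exact ⟨h5.trans h3, by omega⟩

theorem mem_supported (hT : Homog gr deg n T) {γ : Γ} {i j : ℕ} (hj : (j : ℤ) = i + n)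
    {c : X →₀ k} (hc : c ∈ Finsupp.supported k k (homPiece gr deg γ i)) :
    T c ∈ Finsupp.supported k k (homPiece gr deg γ j) :=
  mem_supported_of fun b hb => by
    obtain ⟨h1, h2⟩ := hT.apply_ne hc hb
    exact ⟨h1, by omega⟩

theorem sign (hT : Homog gr deg n T) {s : Module.End k (X →₀ k)}
    (hs : ∀ a, s (Finsupp.single a 1) = (-1 : k) ^ deg a • Finsupp.single a 1) {ε : k}
    (hε : ∀ i j : ℕ, (j : ℤ) = i + n → (-1 : k) ^ j = ε * (-1) ^ i) (x : X →₀ k) :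
    s (T x) = ε • T (s x) := by
  have key : ∀ c : X →₀ k, ∀ b, s c b = (-1 : k) ^ deg b * c b := by
    intro c b
    induction c using Finsupp.induction_linear with
    | zero => simp
    | add x y hx hy => simp [hx, hy, mul_add]
    | single a r =>
      rw [← mul_one r, ← smul_eq_mul, ← Finsupp.smul_single, map_smul, hs]
      by_cases h : a = b
      · subst h
        simp [mul_comm]
      · simp [Finsupp.single_eq_of_ne (Ne.symm h)]
  induction x using Finsupp.induction_linear with
  | zero => simp
  | add x y hx hy => simp only [map_add, hx, hy, smul_add]
  | single a r =>
    rw [← mul_one r, ← smul_eq_mul, ← Finsupp.smul_single]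
    simp only [map_smul]
    rw [smul_comm ε r]
    congr 1
    rw [hs, map_smul]
    ext b
    rw [key, Finsupp.smul_apply, Finsupp.smul_apply, smul_eq_mul, smul_eq_mul, ← mul_assoc]
    by_cases hb : T (Finsupp.single a 1) b = 0
    · rw [hb, mul_zero, mul_zero]
    · rw [hε _ _ (hT a b hb).2]

end Homog

theorem exists_generalized_inverse {E : Type*} [AddCommGroup E] [Module k E]
    (d : Module.End k E) : ∃ g : Module.End k E, ∀ x, d (g (d x)) = d x := by
  obtain ⟨g, hg⟩ := d.rangeRestrict.exists_rightInverse_of_surjective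
    (LinearMap.range_eq_top.2 d.surjective_rangeRestrict)
  obtain ⟨g', hg'⟩ := LinearMap.exists_extend g
  refine ⟨g', fun x => ?_⟩
  have h1 : g' (d x) = g ⟨d x, LinearMap.mem_range_self d x⟩ :=
    LinearMap.congr_fun hg' ⟨d x, LinearMap.mem_range_self d x⟩
  rw [h1]
  exact congrArg Subtype.val (LinearMap.congr_fun hg ⟨d x, LinearMap.mem_range_self d x⟩)

theorem exists_homog_inverse {d : Module.End k (X →₀ k)} (hd : Homog gr deg (-1) d) :
    ∃ g : Module.End k (X →₀ k), Homog gr deg 1 g ∧ d * g * d = d := by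
  obtain ⟨g, hg⟩ := exists_generalized_inverse d
  let g' : Module.End k (X →₀ k) := Finsupp.linearCombination k fun a =>
    (g (Finsupp.single a 1)).filter (· ∈ homPiece gr deg (gr a) (deg a + 1))
  have hg' : ∀ a, g' (Finsupp.single a 1) =
      (g (Finsupp.single a 1)).filter (· ∈ homPiece gr deg (gr a) (deg a + 1)) := fun a => by
    simp [g']
  have hgh : Homog gr deg 1 g' := by
    intro a b h
    rw [hg', Finsupp.filter_apply] at h
    split_ifs at h with hb
    · exact ⟨hb.1, by rw [hb.2]; push_cast; rfl⟩
    · exact absurd rfl h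
  refine ⟨g', hgh, ?_⟩
  have hfil : ∀ (γ : Γ) (j : ℕ), ∀ x ∈ Finsupp.supported k k (homPiece gr deg γ j),
      g' x = (g x).filter (· ∈ homPiece gr deg γ (j + 1)) := by
    intro γ j x hx
    ext b
    rw [end_apply, Finsupp.filter_apply, end_apply g]
    split_ifs with hb
    · refine Finset.sum_congr rfl fun a ha => ?_
      obtain ⟨h1, h2⟩ := (Finsupp.mem_supported k x).1 hx ha
      change x a * g' (Finsupp.single a 1) b = x a * g (Finsupp.single a 1) b
      rw [hg', h1, h2, Finsupp.filter_apply, if_pos hb]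
    · refine Finset.sum_eq_zero fun a ha => ?_
      obtain ⟨h1, h2⟩ := (Finsupp.mem_supported k x).1 hx ha
      change x a * g' (Finsupp.single a 1) b = 0
      rw [hg', h1, h2, Finsupp.filter_apply, if_neg hb, mul_zero]
  have hdf : ∀ (γ : Γ) (j : ℕ) (y : X →₀ k) (b : X), gr b = γ → deg b = j →
      d (y.filter (· ∈ homPiece gr deg γ (j + 1))) b = d y b := by
    intro γ j y b h1 h2
    conv_rhs => rw [← Finsupp.filter_add_filter_not y (· ∈ homPiece gr deg γ (j + 1)),
      map_add, Finsupp.add_apply]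
    rw [left_eq_add]
    by_contra hne
    obtain ⟨a, h3, h4⟩ := exists_of_end_apply hne
    obtain ⟨h5, h6⟩ := hd a b h4
    rw [Finsupp.filter_apply] at h3
    split_ifs at h3 with h7
    · exact h3 rfl
    · exact h7 ⟨h5.symm.trans h1, by omega⟩
  ext a b : 3
  simp only [LinearMap.comp_apply, Finsupp.lsingle_apply, Module.End.mul_apply]
  by_cases ha : deg a = 0
  · have : d (Finsupp.single a 1) = 0 := by
      ext c
      by_contra hne
      have := (hd a c hne).2
      omega
    rw [this, map_zero, map_zero]
  obtain ⟨j, hj⟩ := Nat.exists_eq_succ_of_ne_zero ha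
  have hda : d (Finsupp.single a 1) ∈ Finsupp.supported k k (homPiece gr deg (gr a) j) :=
    mem_supported_of fun c hc => by
      obtain ⟨h1, h2⟩ := hd a c hc
      exact ⟨h1, by omega⟩
  by_cases hb : gr b = gr a ∧ deg b = j
  · rw [hfil _ _ _ hda, hdf _ _ _ _ hb.1 hb.2, hg]
  · have e1 : d (Finsupp.single a 1) b = 0 := by
      by_contra hne
      exact hb (of_mem_supported hda hne)
    have e2 : d (g' (d (Finsupp.single a 1))) b = 0 := by
      by_contra hne
      obtain ⟨h1, h2⟩ := (hd.mul hgh).apply_ne hda hne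
      exact hb ⟨h1, by omega⟩
    rw [e1, e2]

theorem improve_generalized_inverse {A : Type*} [Ring A] {d h : A} (hdd : d * d = 0)
    (e1 : d * h * d = d) (e2 : h * d * h = h) :
    d * (h - h * h * d) * d = d ∧ (h - h * h * d) * d * (h - h * h * d) = h - h * h * d ∧
      (h - h * h * d) * (h - h * h * d) = 0 := by
  have e3 : (h - h * h * d) * d = h * d := by
    rw [sub_mul, mul_assoc _ d d, hdd, mul_zero, sub_zero]
  have e4 : h * d * (h - h * h * d) = h - h * h * d := by
    rw [mul_sub, e2, ← mul_assoc, ← mul_assoc, e2]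
  refine ⟨?_, ?_, ?_⟩
  · rw [mul_assoc, e3, ← mul_assoc, e1]
  · rw [e3, e4]
  · conv_lhs => rw [sub_mul, mul_assoc h h d, mul_assoc h (h * d), ← mul_assoc h h d]
    rw [e4, sub_self]

theorem exists_homotopy {d : Module.End k (X →₀ k)} (hd : Homog gr deg (-1) d)
    (hdd : d * d = 0) : ∃ h : Module.End k (X →₀ k), Homog gr deg 1 h ∧ d * h * d = d ∧
      h * d * h = h ∧ h * h = 0 := by
  obtain ⟨g, hg, hgd⟩ := exists_homog_inverse hd
  have e1 : d * (g * d * g) * d = d :=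
    calc d * (g * d * g) * d = (d * g * d) * g * d := by simp only [mul_assoc]
      _ = d := by rw [hgd, hgd]
  have e2 : g * d * g * d * (g * d * g) = g * d * g :=
    calc g * d * g * d * (g * d * g) = g * (d * g * d) * g * d * g := by simp only [mul_assoc]
      _ = g * (d * g * d) * g := by
        conv_lhs => rw [hgd]
        simp only [mul_assoc]
      _ = g * d * g := by rw [hgd]
  have hh : Homog gr deg 1 (g * d * g) := by simpa using (hg.mul hd).mul hg
  obtain ⟨h1, h2, h3⟩ := improve_generalized_inverse (A := Module.End k (X →₀ k)) hdd e1 e2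
  exact ⟨_, hh.sub (by simpa using (hh.mul hh).mul hd), h1, h2, h3⟩

end Homogeneous

section Kunneth
variable {k : Type*} [Field k] {X Γ : Type*} {gr : X → Γ} {deg : X → ℕ}
open BarData

theorem finrank_supported_eq_ncard {Y : Type*} {S : Set Y} (hS : S.Finite) :
    Module.finrank k (Finsupp.supported k k S) = S.ncard := by
  have := hS.fintype
  rw [(Finsupp.supportedEquivFinsupp S).finrank_eq, Module.finrank_finsupp_self,
    ← Nat.card_eq_fintype_card, Nat.card_coe_set_eq]

theorem homDim_zero {E : Type*} [AddCommGroup E] [Module k E] (C : ℕ → Submodule k E) (i : ℕ) :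
    homDim C (0 : E →ₗ[k] E) i = Module.finrank k (C i) := by
  rw [homDim, LinearMap.ker_zero, inf_top_eq, Submodule.map_zero, finrank_bot, Nat.sub_zero]

theorem exists_inverse_maps {E : Type*} [AddCommGroup E] [Module k E] (S T : Submodule k E)
    [FiniteDimensional k S] [FiniteDimensional k T]
    (h : Module.finrank k S = Module.finrank k T) :
    ∃ e f : E →ₗ[k] E, (∀ x ∈ S, e x ∈ T ∧ f (e x) = x) ∧ ∀ y ∈ T, f y ∈ S ∧ e (f y) = y := by
  let L := LinearEquiv.ofFinrankEq S T h
  obtain ⟨e, he⟩ := LinearMap.exists_extend (T.subtype.comp L.toLinearMap)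
  obtain ⟨f, hf⟩ := LinearMap.exists_extend (S.subtype.comp L.symm.toLinearMap)
  have he' : ∀ x : S, e x = L x := fun x => LinearMap.congr_fun he x
  have hf' : ∀ y : T, f y = L.symm y := fun y => LinearMap.congr_fun hf y
  refine ⟨e, f, fun x hx => ?_, fun y hy => ?_⟩
  · have h1 := he' ⟨x, hx⟩
    refine ⟨?_, ?_⟩
    · rw [h1]; exact (L ⟨x, hx⟩).2
    · rw [h1, hf', L.symm_apply_apply]
  · have h1 := hf' ⟨y, hy⟩
    refine ⟨?_, ?_⟩
    · rw [h1]; exact (L.symm ⟨y, hy⟩).2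
    · rw [h1, he', L.apply_symm_apply]

theorem wordMap_apply_ne {X' : Type*} {p : X → X' →₀ k} {w : List X} {v : List X'}
    (h : wordMap p w v ≠ 0) : List.Forall₂ (fun a b => p a b ≠ 0) w v := by
  induction w generalizing v with
  | nil =>
    rw [wordMap] at h
    by_cases hv : v = []
    · rw [hv]
      exact .nil
    · exact absurd (Finsupp.single_eq_of_ne hv) h
  | cons a w ih =>
    rw [wordMap] at h
    cases v with
    | nil => exact absurd (consL_apply_nil _ _) h
    | cons b v =>
      rw [consL_apply_cons] at h
      exact .cons (left_ne_zero_of_mul h) (ih (right_ne_zero_of_mul h))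

/-- The words with given sequence of grades and given degree. -/
def grWords (gr : X → Γ) (deg : X → ℕ) (K : Set (List Γ)) (i : ℕ) : Set (List X) :=
  {w | w.map gr ∈ K ∧ wdeg deg w = i}

theorem forall₂_grade {w v : List X}
    (h : List.Forall₂ (fun a b => gr b = gr a ∧ deg b = deg a) w v) :
    v.map gr = w.map gr ∧ wdeg deg v = wdeg deg w := by
  induction h with
  | nil => exact ⟨rfl, rfl⟩
  | cons h _ ih =>
    rw [List.map_cons, List.map_cons, wdeg_cons, wdeg_cons, h.1, h.2, ih.1, ih.2]
    exact ⟨rfl, rfl⟩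

theorem step_grade {A : BarData k X} (hm : ∀ a b, A.mul a b = 0) (hd : Homog gr deg (-1) A.dL)
    {w v : List X} (h : A.Step w v) : v.map gr = w.map gr ∧ wdeg deg v + 1 = wdeg deg w := by
  induction h with
  | @int a b w h =>
    have := hd a b (by rwa [dL_single, one_smul])
    rw [List.map_cons, List.map_cons, this.1, wdeg_cons, wdeg_cons]
    exact ⟨rfl, by omega⟩
  | mul w h =>
    rw [hm] at h
    exact absurd rfl h
  | cons a h ih =>
    rw [List.map_cons, List.map_cons, ih.1, wdeg_cons, wdeg_cons]
    exact ⟨rfl, by omega⟩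

/-- The words of a homotopy built from a homotopy `h` on letters and the projection `p`. -/
def homotopyWord (A : BarData k X) (h p : Module.End k (X →₀ k)) : List X → List X →₀ k
  | [] => 0
  | a :: w => -consL k X (h (Finsupp.single a 1)) (Finsupp.single w 1) +
      A.sg a • consL k X (p (Finsupp.single a 1)) (homotopyWord A h p w)

/-- The linear extension of `homotopyWord`. -/
def homotopyL (A : BarData k X) (h p : Module.End k (X →₀ k)) :
    (List X →₀ k) →ₗ[k] (List X →₀ k) :=
  Finsupp.linearCombination k (homotopyWord A h p)

theorem homotopyL_single (A : BarData k X) (h p : Module.End k (X →₀ k)) (w : List X) (r : k) :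
    homotopyL A h p (Finsupp.single w r) = r • homotopyWord A h p w := by simp [homotopyL]

theorem homotopyL_consL (A : BarData k X) (h p : Module.End k (X →₀ k)) (x : X →₀ k)
    (W : List X →₀ k) : homotopyL A h p (consL k X x W) =
      -consL k X (h x) W + consL k X (p (A.sL x)) (homotopyL A h p W) := by
  induction x using Finsupp.induction_linear with
  | zero => simp
  | add x y hx hy => simp only [map_add, LinearMap.add_apply, hx, hy]; abel
  | single a r =>
    induction W using Finsupp.induction_linear with
    | zero => simp
    | add x y hx hy => simp only [map_add, hx, hy]; abel
    | single w t =>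
      have h1 : Finsupp.single w t = t • Finsupp.single w (1 : k) := by simp
      have h2 : Finsupp.single a r = r • Finsupp.single a (1 : k) := by simp
      have h3 : Finsupp.single a (A.sg a) = A.sg a • Finsupp.single a (1 : k) := by simp
      rw [h1, h2]
      simp only [map_smul, LinearMap.smul_apply, consL_single, homotopyL_single, sL_single,
        one_smul, mul_one, homotopyWord, h3, smul_add, smul_neg]

theorem starL_eq_zero {A : BarData k X} (hm : ∀ a b, A.mul a b = 0) (x : X →₀ k)
    (W : List X →₀ k) : A.starL x W = 0 := by
  induction x using Finsupp.induction_linear with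
  | zero => simp
  | add x y hx hy => simp only [map_add, LinearMap.add_apply, hx, hy, add_zero]
  | single a r =>
    induction W using Finsupp.induction_linear with
    | zero => simp
    | add x y hx hy => simp only [map_add, hx, hy, add_zero]
    | single w t =>
      rw [starL_single]
      cases w with
      | nil => simp [starAux]
      | cons b w => simp [starAux, hm]

theorem homotopy_identity {A : BarData k X} (hm : ∀ a b, A.mul a b = 0)
    (hsg : ∀ a, A.sg a = (-1) ^ deg a) (hd : Homog gr deg (-1) A.dL)
    {h p : Module.End k (X →₀ k)} (hh : Homog gr deg 1 h) (hp : Homog gr deg 0 p)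
    (hdp : ∀ x, A.dL (p x) = 0) (hpd : ∀ x, p (A.dL x) = 0)
    (hdh : ∀ x, A.dL (h x) + h (A.dL x) = x - p x) (W : List X →₀ k) :
    A.D (homotopyL A h p W) + homotopyL A h p (A.D W) =
      W - wordMapL (fun a => p (Finsupp.single a 1)) W := by
  have hs : ∀ a, A.sL (Finsupp.single a 1) = (-1 : k) ^ deg a • Finsupp.single a 1 := by
    intro a
    rw [sL_single, hsg, one_smul, Finsupp.smul_single, smul_eq_mul, mul_one]
  have hss : ∀ x, A.sL (A.sL x) = x := by
    intro x
    induction x using Finsupp.induction_linear with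
    | zero => simp
    | add x y hx hy => simp only [map_add, hx, hy]
    | single a r =>
      rw [sL_single, map_smul, sL_single, hsg, smul_smul, Finsupp.smul_single, smul_eq_mul,
        mul_assoc, ← mul_pow]
      simp
  have hsd : ∀ x, A.sL (A.dL x) = (-1 : k) • A.dL (A.sL x) :=
    hd.sign hs fun i j hij => by
      rw [show i = j + 1 by omega, pow_succ]
      ring
  have hsh : ∀ x, A.sL (h x) = (-1 : k) • h (A.sL x) :=
    hh.sign hs fun i j hij => by
      rw [show j = i + 1 by omega, pow_succ]
      ring
  have hsp : ∀ x, A.sL (p x) = (1 : k) • p (A.sL x) :=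
    hp.sign hs fun i j hij => by
      rw [show j = i by omega, one_mul]
  have hl : ∀ x, Finsupp.linearCombination k (fun a => p (Finsupp.single a 1)) x = p x := by
    intro x
    conv_rhs => rw [← Finsupp.sum_single x, Finsupp.sum, map_sum]
    rw [Finsupp.linearCombination_apply]
    refine Finset.sum_congr rfl fun a _ => ?_
    change x a • p (Finsupp.single a 1) = _
    rw [← map_smul, Finsupp.smul_single, smul_eq_mul, mul_one]
  induction W using word_induction with
  | h0 => simp
  | hadd U V hU hV =>
    simp only [map_add]
    rw [add_add_add_comm, hU, hV]
    abel
  | hnil r =>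
    rw [homotopyL_single, D_nil, homotopyWord, wordMapL_single, wordMap]
    simp
  | hcons a w ih r =>
    generalize Finsupp.single a r = x, Finsupp.single w (1 : k) = W at *
    rw [homotopyL_consL, D_cons, wordMapL_consL, hl]
    simp only [map_add, map_neg, D_cons, homotopyL_consL, starL_eq_zero hm, hdp, hsp, hss, hpd,
      hsd, hsh, map_zero, LinearMap.zero_apply, one_smul, neg_smul, LinearMap.neg_apply]
    rw [eq_sub_of_add_eq (hdh x), ← sub_eq_of_eq_add' (sub_eq_iff_eq_add.1 ih.symm)]
    simp only [map_add, map_sub, LinearMap.sub_apply]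
    abel


theorem barD_grade_laws {A : BarData k X} (hm : ∀ a b, A.mul a b = 0)
    (hsg : ∀ a, A.sg a = (-1) ^ deg a) (hd : Homog gr deg (-1) A.dL)
    (hdd : ∀ x, A.dL (A.dL x) = 0) : A.Laws where
  dd a := by simpa using hdd (Finsupp.single a 1)
  sg_sg a := by rw [hsg, ← mul_pow]; simp
  sg_d a := by
    have h := hd.sign (s := A.sL) (ε := -1) (fun a => by
      rw [sL_single, hsg, one_smul, Finsupp.smul_single, smul_eq_mul, mul_one])
      (fun i j hij => by rw [show i = j + 1 by omega, pow_succ]; ring) (Finsupp.single a 1)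
    rw [dL_single, one_smul, sL_single, one_smul, dL_single, neg_smul, one_smul] at h
    exact h
  sg_mul a b := by simp [hm]
  leibniz a b := by
    have h1 : ∀ x y, A.mulL x y = 0 := fun x y => by
      have : A.mulL = 0 := by
        ext a b : 4
        simp [hm]
      rw [this]
      rfl
    rw [h1, h1, hm]
    simp
  assoc a b c := by simp [hm]

theorem linearCombination_apply_of_supported {S : Set X} {p : X → X →₀ k}
    {T : (X →₀ k) →ₗ[k] (X →₀ k)} (h : ∀ a ∈ S, p a = T (Finsupp.single a 1)) {x : X →₀ k}
    (hx : x ∈ Finsupp.supported k k S) : Finsupp.linearCombination k p x = T x := by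
  conv_rhs => rw [← Finsupp.sum_single x, Finsupp.sum, map_sum]
  rw [Finsupp.linearCombination_apply]
  refine Finset.sum_congr rfl fun a ha => ?_
  change x a • p a = _
  rw [h a ((Finsupp.mem_supported k x).1 hx ha), ← map_smul, Finsupp.smul_single, smul_eq_mul,
    mul_one]

/-- The projection attached to a homotopy on letters. -/
theorem exists_projection {d : Module.End k (X →₀ k)} (hd : Homog gr deg (-1) d)
    (hdd : ∀ x, d (d x) = 0) : ∃ h p : Module.End k (X →₀ k), Homog gr deg 1 h ∧
      Homog gr deg 0 p ∧ (∀ x, d (p x) = 0) ∧ (∀ x, p (d x) = 0) ∧ (∀ x, p (h x) = 0) ∧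
      (∀ x, p (p x) = p x) ∧ ∀ x, d (h x) + h (d x) = x - p x := by
  obtain ⟨h, hh, e1, e2, e3⟩ := exists_homotopy hd (LinearMap.ext hdd)
  have e1' : ∀ x, d (h (d x)) = d x := LinearMap.congr_fun e1
  have e2' : ∀ x, h (d (h x)) = h x := LinearMap.congr_fun e2
  have e3' : ∀ x, h (h x) = 0 := LinearMap.congr_fun e3
  obtain ⟨p, hp, hpx⟩ : ∃ p : Module.End k (X →₀ k), Homog gr deg 0 p ∧
      ∀ x, p x = x - d (h x) - h (d x) :=
    ⟨1 - d * h - h * d, (Homog.one.sub (by simpa using hd.mul hh)).sub (by simpa using hh.mul hd),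
      fun x => rfl⟩
  refine ⟨h, p, hh, hp, fun x => ?_, fun x => ?_, fun x => ?_, fun x => ?_, fun x => ?_⟩
  · rw [hpx, map_sub, map_sub, hdd, e1', sub_zero, sub_self]
  · rw [hpx, hdd, map_zero, e1', sub_zero, sub_self]
  · rw [hpx, e3', map_zero, e2', sub_zero, sub_self]
  · simp only [hpx, map_sub, hdd, e1', e2', e3', map_zero]
    abel
  · rw [hpx]
    abel

theorem homDim_homPiece {d p h : Module.End k (X →₀ k)} (hd : Homog gr deg (-1) d)
    (hdd : ∀ x, d (d x) = 0) (hh : Homog gr deg 1 h) (hpd : ∀ x, p (d x) = 0)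
    (hph : ∀ x, p (h x) = 0) (hdh : ∀ x, d (h x) + h (d x) = x - p x) {γ : Γ}
    (hfin : ∀ j, (homPiece gr deg γ j).Finite) (j : ℕ) :
    homDim (fun j => Finsupp.supported k k (homPiece gr deg γ j)) d j =
      Module.finrank k ((Finsupp.supported k k (homPiece gr deg γ j)).map p) := by
  rw [← homDim_zero (fun j => (Finsupp.supported k k (homPiece gr deg γ j)).map p)]
  refine homDim_eq_of_exact p ?_ ?_ ?_ ?_ ?_ ?_ ?_ j
  · exact fun j => finiteDimensional_supported (hfin j)
  · exact fun i c hc => hd.mem_supported (by push_cast; ring) hc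
  · intro c hc
    ext b
    by_contra hne
    have := (hd.apply_ne hc hne).2
    omega
  · exact fun i c _ => hdd c
  · exact fun i => rfl
  · exact fun i c _ => hpd c
  · intro i c hc hdc hpc
    refine ⟨h c, hh.mem_supported (by push_cast; ring) hc, hph c, ?_⟩
    have := hdh c
    rwa [hdc, map_zero, add_zero, hpc, sub_zero] at this

theorem homotopyWord_grade {A : BarData k X} {h p : Module.End k (X →₀ k)}
    (hh : Homog gr deg 1 h) (hp : Homog gr deg 0 p) {w v : List X}
    (hv : homotopyWord A h p w v ≠ 0) : v.map gr = w.map gr ∧ wdeg deg v = wdeg deg w + 1 := by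
  induction w generalizing v with
  | nil => exact absurd rfl hv
  | cons a w ih =>
    cases v with
    | nil =>
      rw [homotopyWord, Finsupp.add_apply, Finsupp.neg_apply, Finsupp.smul_apply,
        consL_apply_nil, consL_apply_nil] at hv
      simp at hv
    | cons b v =>
      rw [homotopyWord, Finsupp.add_apply, Finsupp.neg_apply, Finsupp.smul_apply,
        consL_apply_cons, consL_apply_cons] at hv
      rw [List.map_cons, List.map_cons, wdeg_cons, wdeg_cons]
      by_cases h1 : h (Finsupp.single a 1) b * Finsupp.single w (1 : k) v = 0
      · rw [h1, neg_zero, zero_add, smul_eq_mul] at hv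
        have h2 := right_ne_zero_of_mul hv
        have h3 := hp a b (left_ne_zero_of_mul h2)
        have h4 := ih (right_ne_zero_of_mul h2)
        exact ⟨by rw [h3.1, h4.1], by omega⟩
      · have h3 := hh a b (left_ne_zero_of_mul h1)
        have h4 : v = w := by
          by_contra hne
          exact right_ne_zero_of_mul h1 (Finsupp.single_eq_of_ne hne)
        exact ⟨by rw [h3.1, h4], by rw [h4]; omega⟩

/-- The homology of words is spanned by the words in homology classes of letters. -/
theorem homDim_grWords {A : BarData k X} (hm : ∀ a b, A.mul a b = 0)
    (hsg : ∀ a, A.sg a = (-1) ^ deg a) (hd : Homog gr deg (-1) A.dL)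
    (hdd : ∀ x, A.dL (A.dL x) = 0) {K : Set (List Γ)} {G : Set Γ} {J : Set X}
    (hG : ∀ l ∈ K, ∀ γ ∈ l, γ ∈ G) (hfin : ∀ γ ∈ G, ∀ j, (homPiece gr deg γ j).Finite)
    (hJ : ∀ γ ∈ G, ∀ j, (J ∩ homPiece gr deg γ j).ncard =
      homDim (fun j => Finsupp.supported k k (homPiece gr deg γ j)) A.dL j)
    (hfinW : ∀ i, (grWords gr deg K i).Finite) (i : ℕ) :
    homDim (fun i => Finsupp.supported k k (grWords gr deg K i)) A.D i =
      {w ∈ grWords gr deg K i | ∀ a ∈ w, a ∈ J}.ncard := by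
  obtain ⟨h, p, hh, hp, hdp, hpd, hph, hpp, hdh⟩ := exists_projection hd hdd
  have key : ∀ γ j, ∃ e f : (X →₀ k) →ₗ[k] (X →₀ k), γ ∈ G →
      (∀ x ∈ (Finsupp.supported k k (homPiece gr deg γ j)).map p,
        e x ∈ Finsupp.supported k k (J ∩ homPiece gr deg γ j) ∧ f (e x) = x) ∧
      ∀ y ∈ Finsupp.supported k k (J ∩ homPiece gr deg γ j),
        f y ∈ (Finsupp.supported k k (homPiece gr deg γ j)).map p ∧ e (f y) = y := by
    intro γ j
    by_cases hγ : γ ∈ G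
    · have := finiteDimensional_supported (k := k) (hfin γ hγ j)
      have h2 : (J ∩ homPiece gr deg γ j).Finite := (hfin γ hγ j).subset Set.inter_subset_right
      have := finiteDimensional_supported (k := k) h2
      obtain ⟨e, f, h3⟩ := exists_inverse_maps
        ((Finsupp.supported k k (homPiece gr deg γ j)).map p)
        (Finsupp.supported k k (J ∩ homPiece gr deg γ j)) (by
          rw [finrank_supported_eq_ncard h2, hJ γ hγ,
            homDim_homPiece hd hdd hh hpd hph hdh (hfin γ hγ)])
      exact ⟨e, f, fun _ => h3⟩
    · exact ⟨0, 0, fun h => absurd h hγ⟩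
  choose e f hef using key
  have hsup : ∀ a : X, Finsupp.single a (1 : k) ∈
      Finsupp.supported k k (homPiece gr deg (gr a) (deg a)) := fun a =>
    Finsupp.single_mem_supported k 1 ⟨rfl, rfl⟩
  have hmap : ∀ γ j, (Finsupp.supported k k (homPiece gr deg γ j)).map p ≤
      Finsupp.supported k k (homPiece gr deg γ j) := by
    rintro γ j _ ⟨x, hx, rfl⟩
    exact hp.mem_supported (by ring) hx
  let pi : X → X →₀ k := fun a => e (gr a) (deg a) (p (Finsupp.single a 1))
  let io : X → X →₀ k := fun a => f (gr a) (deg a) (Finsupp.single a 1)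
  have hpi : ∀ γ j, ∀ x ∈ Finsupp.supported k k (homPiece gr deg γ j),
      Finsupp.linearCombination k pi x = e γ j (p x) := fun γ j x hx =>
    linearCombination_apply_of_supported (T := (e γ j).comp p)
      (fun a ha => by rw [← ha.1, ← ha.2]; rfl) hx
  have hio : ∀ γ j, ∀ x ∈ Finsupp.supported k k (homPiece gr deg γ j),
      Finsupp.linearCombination k io x = f γ j x := fun γ j x hx =>
    linearCombination_apply_of_supported (T := f γ j)
      (fun a ha => by rw [← ha.1, ← ha.2]) hx
  have hpi_ne : ∀ a b, gr a ∈ G → pi a b ≠ 0 → b ∈ J ∧ gr b = gr a ∧ deg b = deg a :=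
    fun a b ha hb => of_mem_supported (((hef (gr a) (deg a) ha).1 _
      (Submodule.mem_map_of_mem (hsup a))).1) hb
  have hio_ne : ∀ a b, gr a ∈ G → a ∈ J → io a b ≠ 0 → gr b = gr a ∧ deg b = deg a :=
    fun a b ha haJ hb => of_mem_supported (hmap _ _ (((hef (gr a) (deg a) ha).2 _
      (Finsupp.single_mem_supported k 1 ⟨haJ, rfl, rfl⟩)).1)) hb
  have hpi_io : ∀ a, gr a ∈ G → a ∈ J →
      Finsupp.linearCombination k pi (io a) = Finsupp.single a 1 := by
    intro a ha haJ
    obtain ⟨h1, h2⟩ := (hef (gr a) (deg a) ha).2 _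
      (Finsupp.single_mem_supported k 1 (⟨haJ, rfl, rfl⟩ : a ∈ J ∩ homPiece gr deg _ _))
    rw [hpi _ _ _ (hmap _ _ h1)]
    obtain ⟨x, hx, hxe⟩ := h1
    have h4 : p (f (gr a) (deg a) (Finsupp.single a 1)) = f (gr a) (deg a) (Finsupp.single a 1) := by
      rw [← hxe, hpp]
    exact (congrArg _ h4).trans h2
  have hio_pi : ∀ a, gr a ∈ G →
      Finsupp.linearCombination k io (pi a) = p (Finsupp.single a 1) := by
    intro a ha
    obtain ⟨h1, h2⟩ := (hef (gr a) (deg a) ha).1 _ (Submodule.mem_map_of_mem (hsup a))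
    rw [hio _ _ _ (Finsupp.supported_mono Set.inter_subset_right h1)]
    exact h2
  have hpi_d : ∀ a, Finsupp.linearCombination k pi (A.dL (Finsupp.single a 1)) = 0 := by
    intro a
    rw [hpi (gr a) (deg a - 1) _ (mem_supported_of fun b hb => ?_), hpd, map_zero]
    have := hd a b hb
    exact ⟨this.1, by omega⟩
  have hpi_h : ∀ a, Finsupp.linearCombination k pi (h (Finsupp.single a 1)) = 0 := by
    intro a
    rw [hpi (gr a) (deg a + 1) _ (mem_supported_of fun b hb => ?_), hph, map_zero]
    have := hh a b hb
    exact ⟨this.1, by omega⟩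
  have hsL : ∀ a, A.sL (Finsupp.single a 1) = A.sg a • Finsupp.single a (1 : k) := by
    intro a
    rw [sL_single, one_smul, Finsupp.smul_single, smul_eq_mul, mul_one]
  have hwG : ∀ i, ∀ w ∈ grWords gr deg K i, ∀ a ∈ w, gr a ∈ G := fun i w hw a ha =>
    hG _ hw.1 _ (List.mem_map_of_mem ha)
  have hPD : ∀ w : List X, wordMapL pi (A.D (Finsupp.single w 1)) = 0 := by
    intro w
    induction w with
    | nil => rw [D_nil, map_zero]
    | cons a w ih =>
      rw [show Finsupp.single (a :: w) (1 : k) =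
        consL k X (Finsupp.single a 1) (Finsupp.single w 1) by simp, D_cons, starL_eq_zero hm,
        map_add, map_add, map_neg, wordMapL_consL, wordMapL_consL, hpi_d, ih]
      simp
  have hIP : ∀ w : List X, (∀ a ∈ w, gr a ∈ G) → wordMapL io (wordMapL pi (Finsupp.single w 1)) =
      wordMapL (fun a => p (Finsupp.single a 1)) (Finsupp.single w 1) := by
    intro w hw
    induction w with
    | nil => simp [wordMapL_single, wordMap]
    | cons a w ih =>
      rw [show Finsupp.single (a :: w) (1 : k) =
        consL k X (Finsupp.single a 1) (Finsupp.single w 1) by simp, wordMapL_consL,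
        wordMapL_consL, wordMapL_consL, ih fun b hb => hw b (List.mem_cons_of_mem _ hb),
        Finsupp.linearCombination_single, one_smul, hio_pi a (hw a List.mem_cons_self),
        Finsupp.linearCombination_single, one_smul]
  have hPI : ∀ w : List X, (∀ a ∈ w, gr a ∈ G ∧ a ∈ J) →
      wordMapL pi (wordMapL io (Finsupp.single w 1)) = Finsupp.single w 1 := by
    intro w hw
    induction w with
    | nil => simp [wordMapL_single, wordMap]
    | cons a w ih =>
      have ha := hw a List.mem_cons_self
      rw [show Finsupp.single (a :: w) (1 : k) =
        consL k X (Finsupp.single a 1) (Finsupp.single w 1) by simp, wordMapL_consL,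
        wordMapL_consL, ih fun b hb => hw b (List.mem_cons_of_mem _ hb),
        Finsupp.linearCombination_single, one_smul, hpi_io a ha.1 ha.2]
  have hPH : ∀ w : List X, wordMapL pi (homotopyL A h p (Finsupp.single w 1)) = 0 := by
    intro w
    induction w with
    | nil => rw [homotopyL_single, homotopyWord, smul_zero, map_zero]
    | cons a w ih =>
      rw [show Finsupp.single (a :: w) (1 : k) =
        consL k X (Finsupp.single a 1) (Finsupp.single w 1) by simp, homotopyL_consL, map_add,
        map_neg, wordMapL_consL, wordMapL_consL, ih, hpi_h]
      simp
  have hp_ne : ∀ {w v : List X}, wordMap (fun a => p (Finsupp.single a 1)) w v ≠ 0 →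
      v.map gr = w.map gr ∧ wdeg deg v = wdeg deg w := fun hv =>
    forall₂_grade ((wordMap_apply_ne hv).imp fun a b hab => ⟨(hp a b hab).1, by
      have := (hp a b hab).2
      omega⟩)
  refine (homDim_eq_of_exact (D' := (0 : (List X →₀ k) →ₗ[k] (List X →₀ k)))
    (C' := fun i => Finsupp.supported k k {w ∈ grWords gr deg K i | ∀ a ∈ w, a ∈ J})
    (wordMapL pi) ?_ ?_ ?_ ?_ ?_ ?_ ?_ i).trans ?_
  · exact fun j => finiteDimensional_supported (hfinW j)
  · intro i c hc
    refine D_mem_supported (fun w hw v hv => ?_) hc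
    have := step_grade hm hd hv
    exact ⟨this.1 ▸ hw.1, by have := hw.2; omega⟩
  · intro c hc
    have : A.D c ∈ Finsupp.supported k k (∅ : Set (List X)) := by
      refine D_mem_supported (fun w hw v hv => ?_) hc
      have h1 := step_grade hm hd hv
      have h2 := hw.2
      omega
    simpa using this
  · exact fun i c _ => (barD_grade_laws hm hsg hd hdd).D_D c
  · intro i
    refine le_antisymm ?_ ?_
    · rintro _ ⟨c, hc, rfl⟩
      refine mem_supported_of fun v hv => ?_
      obtain ⟨w, hw, hv⟩ := exists_of_end_apply hv
      have hw := of_mem_supported hc hw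
      rw [wordMapL_single, one_smul] at hv
      have h2 : List.Forall₂ (fun a b => b ∈ J ∧ gr b = gr a ∧ deg b = deg a) w v :=
        ((List.forall₂_and_left _ _).2 ⟨hwG i w hw, wordMap_apply_ne hv⟩).imp
          fun a b hab => hpi_ne a b hab.1 hab.2
      have h3 := forall₂_grade (h2.imp fun a b hab => hab.2)
      exact ⟨⟨h3.1 ▸ hw.1, h3.2.trans hw.2⟩, ((List.forall₂_and_left _ _).1
        (h2.imp fun a b hab => ⟨hab.1, hab.2⟩).flip).1⟩
    · rw [Finsupp.supported_eq_span_single, Submodule.span_le]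
      rintro _ ⟨w, hw, rfl⟩
      refine ⟨wordMapL io (Finsupp.single w 1), mem_supported_of fun v hv => ?_,
        hPI w fun a ha => ⟨hwG i w hw.1 a ha, hw.2 a ha⟩⟩
      rw [wordMapL_single, one_smul] at hv
      have h3 := forall₂_grade (((List.forall₂_and_left (p := fun a => gr a ∈ G ∧ a ∈ J) _ _).2
        ⟨fun a ha => ⟨hwG i w hw.1 a ha, hw.2 a ha⟩, wordMap_apply_ne hv⟩).imp
          fun a b hab => hio_ne a b hab.1.1 hab.1.2 hab.2)
      exact ⟨h3.1 ▸ hw.1.1, h3.2.trans hw.1.2⟩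
  · intro i c _
    have : (wordMapL pi).comp A.D = 0 := Finsupp.lhom_ext' fun w => LinearMap.ext_ring (hPD w)
    exact LinearMap.congr_fun this c
  · intro i c hc hdc hpc
    have h1 : wordMapL io (wordMapL pi c) = wordMapL (fun a => p (Finsupp.single a 1)) c := by
      rw [Finsupp.supported_eq_span_single] at hc
      refine LinearMap.eqOn_span (f := (wordMapL io).comp (wordMapL pi)) ?_ hc
      rintro _ ⟨w, hw, rfl⟩
      exact hIP w (hwG i w hw)
    have h2 := homotopy_identity hm hsg hd hh hp hdp hpd hdh c
    rw [← h1, hpc, hdc, map_zero, map_zero, add_zero, sub_zero] at h2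
    refine ⟨homotopyL A h p c, mem_supported_of fun v hv => ?_, ?_, h2⟩
    · obtain ⟨w, hw, hv⟩ := exists_of_end_apply hv
      have hw := of_mem_supported hc hw
      rw [homotopyL_single, one_smul] at hv
      have h3 := homotopyWord_grade hh hp hv
      exact ⟨h3.1 ▸ hw.1, by rw [h3.2, hw.2]⟩
    · have : (wordMapL pi).comp (homotopyL A h p) = 0 :=
        Finsupp.lhom_ext' fun w => LinearMap.ext_ring (hPH w)
      exact LinearMap.congr_fun this c
  · rw [homDim_zero, finrank_supported_eq_ncard]
    exact (hfinW i).subset (Set.sep_subset _ _)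

end Kunneth

section Count
variable {k : Type*} [Field k] {σ : Type*} {M : Finset (Mon σ)} {o key : Mon σ → ℕ}
  {a b : Ltr σ}
open BarData

/-- The pure letters with given label and degree. -/
def purePiece (M : Finset (Mon σ)) (γ : Mon σ) (j : ℕ) : Set (Ltr σ) :=
  {a ∈ pureL M | a.1 = γ ∧ tdeg a = j}

/-- A set of pure letters is admissible if it has as many elements in each piece as the
dimension of the homology of that piece. -/
def Admissible (k : Type*) [Field k] (M : Finset (Mon σ)) (o : Mon σ → ℕ)
    (J : Set (Ltr σ)) : Prop :=
  ∀ γ j, (J ∩ purePiece M γ j).ncard =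
    homDim (fun j => Finsupp.supported k k (purePiece M γ j)) (pureBar k M o).dL j

theorem pureBar_dd (hM : Gens M) (ho : Function.Injective o) (x : Ltr σ →₀ k) :
    (pureBar k M o).dL ((pureBar k M o).dL x) = 0 := by
  have key : ∀ a, (pureBar k M o).dL ((pureBar k M o).d a) = 0 := by
    intro a
    ext c
    have hT := DFunLike.congr_fun ((taylor_laws (k := k) ho).dd a) c
    rw [end_apply, Finsupp.zero_apply] at hT ⊢
    simp only [dL_single, one_smul] at hT ⊢
    have hsub : ((pureBar k M o).d a).support ⊆ ((taylor k o).d a).support := by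
      intro b hb
      rw [Finsupp.mem_support_iff] at hb ⊢
      exact (pureBar_d_ne hb).1
    rw [Finsupp.sum_of_support_subset _ hsub _ (by simp)]
    by_cases hac : a ∈ pureL M ∧ c ∈ pureL M
    · rw [← hT]
      refine Finset.sum_congr rfl fun b hb => ?_
      rw [Finsupp.mem_support_iff] at hb
      by_cases hb' : b ∈ pureL M
      · rw [pureBar_d_apply hac.1 hb', pureBar_d_apply hb' hac.2]
      · have h1 : (pureBar k M o).d a b = 0 := by
          by_contra h
          exact hb' (pureBar_d_ne h).2.2
        have h2 : (taylor k o).d b c = 0 := by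
          by_contra h
          have hbv := (taylor_graded.d hac.1.2 hb).1
          exact hb' ⟨pure_of_taylor_d hM hbv h hac.2.1, hbv⟩
        change _ * _ = _ * (taylor k o).d b c
        rw [h1, h2, zero_mul, mul_zero]
    · refine Finset.sum_eq_zero fun b _ => ?_
      by_contra h
      exact hac ⟨(pureBar_d_ne (left_ne_zero_of_mul h)).2.1,
        (pureBar_d_ne (right_ne_zero_of_mul h)).2.2⟩
  have : (pureBar k M o).dL.comp (pureBar k M o).dL = 0 :=
    Finsupp.lhom_ext' fun a => LinearMap.ext_ring (by simpa using key a)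
  exact LinearMap.congr_fun this x

/-- The number of critical words with letters in `J`. -/
def critCount (M : Finset (Mon σ)) (key : Mon σ → ℕ) (J : Set (Ltr σ)) (α : Mon σ) (i : ℕ) : ℕ :=
  {w ∈ critPiece M key α i | ∀ a ∈ w, a ∈ J}.ncard

theorem torDim_eq_critCount [Fintype σ] (hM : Gens M) (ho : Function.Injective o)
    (hk : Function.Injective key) {J : Set (Ltr σ)} (hJ : Admissible k M o J) (α : Mon σ) (i : ℕ) :
    torDim k (upperSet M) i α = critCount M key J α i := by
  let gr : Ltr σ → Mon σ × Prop := fun a => (a.1, a ∈ pureL M)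
  let K : Set (List (Mon σ × Prop)) :=
    {l | (∀ γ ∈ l, γ.2) ∧ (l.map Prod.fst).sum = α ∧ LCrit key (l.map Prod.fst)}
  let G : Set (Mon σ × Prop) := {γ | γ.2}
  have hW : ∀ i, grWords gr tdeg K i = critPiece M key α i := by
    intro i
    ext w
    simp only [grWords, K, critPiece, piece, wlab, gr, Set.mem_ofPred_eq, List.map_map,
      List.forall_mem_map]
    change (((∀ a ∈ w, a ∈ pureL M) ∧ (w.map Prod.fst).sum = α ∧ LCrit key (w.map Prod.fst)) ∧ _) ↔
      ((∀ a ∈ w, a ∈ pureL M) ∧ _ ∧ (w.map Prod.fst).sum = α) ∧ LCrit key (w.map Prod.fst)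
    tauto
  have hP : ∀ γ ∈ G, ∀ j, homPiece gr tdeg γ j = purePiece M γ.1 j := by
    rintro ⟨γ, q⟩ hq j
    have hq : q := hq
    ext a
    simp only [homPiece, purePiece, gr, Set.mem_ofPred_eq, Prod.mk.injEq]
    constructor
    · rintro ⟨⟨rfl, rfl⟩, h⟩
      exact ⟨hq, rfl, h⟩
    · rintro ⟨h, rfl, h'⟩
      exact ⟨⟨rfl, propext (iff_of_true h hq)⟩, h'⟩
  have hd : Homog gr tdeg (-1) (pureBar k M o).dL := by
    intro a b h
    rw [dL_single, one_smul] at h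
    obtain ⟨h1, h2, h3⟩ := pureBar_d_ne h
    have h4 := (taylor_graded.d h2.2 h1).2
    refine ⟨Prod.ext h4.1 (propext (iff_of_true h3 h2)), ?_⟩
    have := h4.2
    omega
  have hfin : ∀ i, (critPiece M key α i).Finite := fun i =>
    (finLetters_validL.finite_piece tdeg α i).subset fun w hw =>
      ⟨fun a ha => (hw.1.1 a ha).2, hw.1.2⟩
  rw [torDim_eq_crit hM ho hk, critCount, ← hW]
  simp only [← hW]
  refine homDim_grWords (G := G) (fun _ _ => rfl) (fun _ => rfl) hd (pureBar_dd hM ho)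
    (fun l hl γ hγ => hl.1 γ hγ) (fun γ hγ j => ?_) (fun γ hγ j => ?_)
    (fun i => (hW i) ▸ hfin i) i
  · rw [hP γ hγ]
    refine (finLetters_validL (M := M).finite γ.1).subset fun a ha => ⟨ha.1.2, ha.2.1.le⟩
  · simp only [hP γ hγ]
    exact hJ γ.1 j

end Count

section Components
variable {σ : Type*} {M : Finset (Mon σ)} {S U C : Finset (Mon σ)}

/-- The connected components of a monomial set. -/
def comps (S : Finset (Mon σ)) : Finset (Finset (Mon σ)) :=
  S.powerset.filter fun C => Conn C ∧ Cop C (S \ C)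

theorem mem_comps : C ∈ comps S ↔ C ⊆ S ∧ Conn C ∧ Cop C (S \ C) := by
  rw [comps, Finset.mem_filter, Finset.mem_powerset]

theorem comps_empty : comps (∅ : Finset (Mon σ)) = ∅ := by
  rw [Finset.eq_empty_iff_forall_notMem]
  intro C hC
  rw [mem_comps] at hC
  exact hC.2.1.1.ne_empty (Finset.subset_empty.1 hC.1)

theorem Conn.comps_eq (h : Conn C) : comps C = {C} := by
  ext B
  rw [mem_comps, Finset.mem_singleton]
  constructor
  · rintro ⟨h1, h2, h3⟩
    exact h.2 B h1 h2.1 h3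
  · rintro rfl
    exact ⟨subset_rfl, h, by rw [Finset.sdiff_self]; exact cop_empty_right B⟩

theorem comps_union (h : Cop S U) : comps (S ∪ U) = comps S ∪ comps U := by
  ext C
  simp only [Finset.mem_union, mem_comps]
  constructor
  · rintro ⟨h1, h2, h3⟩
    rcases h2.subset_or_subset h1 h with h4 | h4
    · exact .inl ⟨h4, h2, h3.mono subset_rfl (Finset.sdiff_subset_sdiff
        Finset.subset_union_left subset_rfl)⟩
    · exact .inr ⟨h4, h2, h3.mono subset_rfl (Finset.sdiff_subset_sdiff
        Finset.subset_union_right subset_rfl)⟩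
  · rintro (⟨h1, h2, h3⟩ | ⟨h1, h2, h3⟩)
    · refine ⟨h1.trans Finset.subset_union_left, h2, ?_⟩
      rw [Finset.union_sdiff_distrib, cop_union_right]
      exact ⟨h3, h.mono h1 Finset.sdiff_subset⟩
    · refine ⟨h1.trans Finset.subset_union_right, h2, ?_⟩
      rw [Finset.union_sdiff_distrib, cop_union_right]
      exact ⟨h.symm.mono h1 Finset.sdiff_subset, h3⟩

theorem comps_disjoint (h : Disjoint S U) : Disjoint (comps S) (comps U) := by
  rw [Finset.disjoint_left]
  intro C h1 h2
  rw [mem_comps] at h1 h2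
  obtain ⟨m, hm⟩ := h1.2.1.1
  exact Finset.disjoint_left.1 h (h1.1 hm) (h2.1 hm)

/-- The degree of a monomial set. -/
def sdeg (S : Finset (Mon σ)) : ℕ := S.card + (comps S).card

/-- The coefficient attached to a monomial set. -/
def scoef (J : Set (Ltr σ)) (S : Finset (Mon σ)) : ℤ :=
  ∏ C ∈ comps S, if (mlcm C, C) ∈ J then -1 else 0

theorem sdeg_union (hM : Gens M) (hS : S ⊆ M) (h : Cop S U) : sdeg (S ∪ U) = sdeg S + sdeg U := by
  have hd := h.disjoint hM hS
  rw [sdeg, sdeg, sdeg, comps_union h, Finset.card_union_of_disjoint hd,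
    Finset.card_union_of_disjoint (comps_disjoint hd)]
  omega

theorem scoef_union (hM : Gens M) (J : Set (Ltr σ)) (hS : S ⊆ M) (h : Cop S U) :
    scoef J (S ∪ U) = scoef J S * scoef J U := by
  rw [scoef, comps_union h, Finset.prod_union (comps_disjoint (h.disjoint hM hS))]
  rfl

end Components

section Letters
variable {σ : Type*} [Fintype σ] {M : Finset (Mon σ)} {a b : Ltr σ} {J : Set (Ltr σ)}

/-- The degree of the complement of `m_S` in the label of a letter. -/
def exc (a : Ltr σ) : ℕ := ∑ i, (a.1 i - mlcm a.2 i)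

/-- The homological degree of a letter. -/
def cdeg (a : Ltr σ) : ℕ := sdeg a.2 + exc a

/-- The coefficient of a letter. -/
def ccoef (J : Set (Ltr σ)) (a : Ltr σ) : ℤ := scoef J a.2 * (-1) ^ exc a

theorem exc_merge (ha : a ∈ validL M) (hb : b ∈ validL M) (h : Cop a.2 b.2) :
    exc (merge a b) = exc a + exc b := by
  have h1 := mlcm_le_iff.2 ha.2.2
  have h2 := mlcm_le_iff.2 hb.2.2
  have e : mlcm (merge a b).2 = mlcm a.2 + mlcm b.2 := h.mlcm_union
  rw [exc, exc, exc, ← Finset.sum_add_distrib]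
  refine Finset.sum_congr rfl fun i _ => ?_
  have h3 : mlcm a.2 i ≤ a.1 i := h1 i
  have h4 : mlcm b.2 i ≤ b.1 i := h2 i
  have h5 := congrFun e i
  have h6 : (merge a b).1 i = a.1 i + b.1 i := rfl
  rw [Pi.add_apply] at h5
  rw [h5, h6]
  omega

theorem cdeg_merge (hM : Gens M) (ha : a ∈ validL M) (hb : b ∈ validL M) (h : Cop a.2 b.2) :
    cdeg (merge a b) = cdeg a + cdeg b := by
  have h1 : sdeg (merge a b).2 = sdeg a.2 + sdeg b.2 := sdeg_union hM ha.2.1 h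
  rw [cdeg, cdeg, cdeg, exc_merge ha hb h, h1]
  omega

theorem ccoef_merge (hM : Gens M) (ha : a ∈ validL M) (hb : b ∈ validL M) (h : Cop a.2 b.2) :
    ccoef J (merge a b) = ccoef J a * ccoef J b := by
  have h1 : scoef J (merge a b).2 = scoef J a.2 * scoef J b.2 := scoef_union hM J ha.2.1 h
  rw [ccoef, ccoef, ccoef, exc_merge ha hb h, h1, pow_add]
  ring

theorem Pure.cdeg_eq (h : Pure a) : cdeg a = tdeg a := by
  rw [cdeg, tdeg, sdeg, exc]
  rcases h with ⟨h1, i, h2⟩ | ⟨h1, h2⟩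
  · rw [h1, h2, comps_empty, mlcm_empty]
    simp
  · rw [← h2, h1.comps_eq]
    simp

theorem Pure.ccoef_eq (h : Pure a) (hJ : a.2 = ∅ → a ∈ J) :
    -ccoef J a = if a ∈ J then 1 else 0 := by
  rw [ccoef, scoef, exc]
  rcases h with ⟨h1, i, h2⟩ | ⟨h1, h2⟩
  · rw [if_pos (hJ h1), h1, h2, comps_empty, mlcm_empty]
    simp
  · rw [← h2, h1.comps_eq, Finset.prod_singleton, ← h2]
    split_ifs <;> simp

end Letters

section WordSeries
variable {X ι : Type*} {V : Set X} {E : X → ι →₀ ℕ} {s : X → ℤ}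

/-- The words with given total label. -/
def wordsOf (V : Set X) (E : X → ι →₀ ℕ) (e : ι →₀ ℕ) : Set (List X) :=
  {w | (∀ a ∈ w, a ∈ V) ∧ (w.map E).sum = e}

/-- The generating function of letters. -/
def letterSeries (s : X → ℤ) (hV : ∀ e, {a ∈ V | E a = e}.Finite) : MvPowerSeries ι ℤ :=
  fun e => ∑ a ∈ (hV e).toFinset, s a

/-- The generating function of words. -/
def wordSeries (s : X → ℤ) (hW : ∀ e, (wordsOf V E e).Finite) : MvPowerSeries ι ℤ :=
  fun e => ∑ w ∈ (hW e).toFinset, (w.map fun a => -s a).prod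

theorem wordSeries_mul (hV : ∀ e, {a ∈ V | E a = e}.Finite)
    (hW : ∀ e, (wordsOf V E e).Finite) :
    (1 + letterSeries s hV) * wordSeries s hW = 1 := by
  ext e
  rw [add_mul, one_mul, map_add, MvPowerSeries.coeff_mul, MvPowerSeries.coeff_one]
  simp only [MvPowerSeries.coeff_apply, letterSeries, wordSeries]
  rw [← Finset.sum_filter_add_sum_filter_not _ (· = []), Finset.sum_filter, Finset.sum_ite_eq']
  have h1 : ([] : List X) ∈ (hW e).toFinset ↔ e = 0 := by
    simp [wordsOf, eq_comm]
  have h2 : ∑ p ∈ Finset.HasAntidiagonal.antidiagonal e, (∑ a ∈ (hV p.1).toFinset, s a) *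
        ∑ w ∈ (hW p.2).toFinset, (w.map fun a => -s a).prod =
      -∑ w ∈ (hW e).toFinset with ¬ w = [], (w.map fun a => -s a).prod := by
    rw [← Finset.sum_neg_distrib]
    simp only [Finset.sum_mul_sum, ← Finset.sum_product']
    rw [Finset.sum_sigma']
    refine Finset.sum_bij (fun x _ => x.2.1 :: x.2.2) ?_ ?_ ?_ ?_
    · rintro ⟨p, a, w⟩ hx
      simp only [Finset.mem_sigma, Finset.HasAntidiagonal.mem_antidiagonal, Finset.mem_product,
        Set.Finite.mem_toFinset] at hx
      simp only [Finset.mem_filter, Set.Finite.mem_toFinset]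
      refine ⟨⟨List.forall_mem_cons.2 ⟨hx.2.1.1, hx.2.2.1⟩, ?_⟩, List.cons_ne_nil _ _⟩
      rw [List.map_cons, List.sum_cons, hx.2.1.2, hx.2.2.2, hx.1]
    · rintro ⟨⟨p, q⟩, a, w⟩ hx ⟨⟨p', q'⟩, a', w'⟩ hx' h
      simp only [Finset.mem_sigma, Finset.mem_product, Set.Finite.mem_toFinset] at hx hx'
      simp only [List.cons.injEq] at h
      obtain ⟨rfl, rfl⟩ := h
      obtain rfl : p = p' := hx.2.1.2.symm.trans hx'.2.1.2
      obtain rfl : q = q' := hx.2.2.2.symm.trans hx'.2.2.2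
      rfl
    · intro w hw
      simp only [Finset.mem_filter, Set.Finite.mem_toFinset] at hw
      obtain ⟨⟨h3, h4⟩, h5⟩ := hw
      cases w with
      | nil => exact absurd rfl h5
      | cons a w =>
        rw [List.forall_mem_cons] at h3
        refine ⟨⟨(E a, (w.map E).sum), a, w⟩, ?_, rfl⟩
        simp only [Finset.mem_sigma, Finset.HasAntidiagonal.mem_antidiagonal, Finset.mem_product,
          Set.Finite.mem_toFinset]
        exact ⟨by simpa using h4, ⟨h3.1, rfl⟩, h3.2, rfl⟩
    · rintro ⟨p, a, w⟩ _
      simp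
  rw [h2, add_neg_cancel_right, List.map_nil, List.prod_nil]
  simp only [h1]

end WordSeries

section Exponents
variable {t : ℕ}

theorem expOf_add (α β : Mon (Fin t)) (i j : ℕ) :
    expOf α i + expOf β j = expOf (α + β) (i + j) := by
  ext o
  cases o <;> simp [expOf]

theorem expOf_eq_iff {α : Mon (Fin t)} {i : ℕ} {e : Option (Fin t) →₀ ℕ} :
    expOf α i = e ↔ α = (fun j => e (some j)) ∧ i = e none := by
  constructor
  · rintro rfl
    exact ⟨rfl, rfl⟩
  · rintro ⟨rfl, rfl⟩
    ext o
    cases o <;> rfl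

/-- The exponent of a letter. -/
def labE (a : Ltr (Fin t)) : Option (Fin t) →₀ ℕ := expOf a.1 (cdeg a)

theorem sum_labE (w : List (Ltr (Fin t))) :
    (w.map labE).sum = expOf (wlab Prod.fst w) (wdeg cdeg w) := by
  induction w with
  | nil =>
    rw [eq_comm, expOf_eq_iff]
    exact ⟨rfl, rfl⟩
  | cons a w ih => rw [List.map_cons, List.sum_cons, ih, labE, expOf_add, wlab_cons, wdeg_cons]

end Exponents

section Cancel
variable {t : ℕ} {M : Finset (Mon (Fin t))} {J : Set (Ltr (Fin t))} {key : Mon (Fin t) → ℕ}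
  {u v w : List (Ltr (Fin t))}

theorem finite_letters (M : Finset (Mon (Fin t))) (e : Option (Fin t) →₀ ℕ) :
    {a ∈ validL M | labE a = e}.Finite := by
  refine ((finLetters_validL (M := M)).finite (fun j => e (some j))).subset ?_
  rintro a ⟨h1, h2⟩
  exact ⟨h1, (expOf_eq_iff.1 h2).1.le⟩

theorem finite_wordsOf (M : Finset (Mon (Fin t))) (e : Option (Fin t) →₀ ℕ) :
    (wordsOf (validL M) labE e).Finite := by
  refine ((finLetters_validL (M := M)).finite_wlab (fun j => e (some j))).subset ?_
  rintro w ⟨h1, h2⟩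
  rw [sum_labE] at h2
  exact ⟨h1, (expOf_eq_iff.1 h2).1⟩

theorem Mrg.coef_eq (hM : Gens M) (hu : Val M u) (h : Mrg u v) :
    (u.map fun a => -ccoef J a).prod = -(v.map fun a => -ccoef J a).prod := by
  induction h with
  | head c d w h =>
    simp only [val_cons] at hu
    simp only [List.map_cons, List.prod_cons, ccoef_merge hM hu.1 hu.2.1 h]
    ring
  | cons c u v h ih =>
    rw [List.map_cons, List.prod_cons, ih (val_cons.1 hu).2, List.map_cons, List.prod_cons,
      mul_neg]

theorem Mrg.sum_labE_eq (hM : Gens M) (hu : Val M u) (h : Mrg u v) :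
    (u.map labE).sum = (v.map labE).sum := by
  induction h with
  | head c d w h =>
    simp only [val_cons] at hu
    simp only [List.map_cons, List.sum_cons]
    rw [← add_assoc, labE, labE, expOf_add, ← cdeg_merge hM hu.1 hu.2.1 h]
    rfl
  | cons c u v h ih =>
    rw [List.map_cons, List.sum_cons, ih (val_cons.1 hu).2, List.map_cons, List.sum_cons]

/-- The symmetrized matching. -/
def Partner (M : Finset (Mon (Fin t))) (key : Mon (Fin t) → ℕ) (w v : List (Ltr (Fin t))) : Prop :=
  Val M v ∧ (Match key w v ∨ Match key v w)

theorem Partner.unique (hM : Gens M) (hk : Function.Injective key) {v' : List (Ltr (Fin t))}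
    (hw : Val M w) (h : Partner M key w v) (h' : Partner M key w v') : v = v' := by
  rcases h with ⟨hv, h | h⟩ <;> rcases h' with ⟨hv', h' | h'⟩
  · exact h.functional hM hk hw h'
  · exact (h'.not_match hM hk hv' h).elim
  · exact (h.not_match hM hk hv h').elim
  · exact h.injective hM hk hv hv' h'

theorem sum_not_crit (hM : Gens M) (hk : Function.Injective key) (e : Option (Fin t) →₀ ℕ) :
    ∑ w ∈ (finite_wordsOf M e).toFinset with ¬ Crit key w,
      (w.map fun a => -ccoef J a).prod = 0 := by
  have hmem : ∀ {w}, w ∈ (finite_wordsOf M e).toFinset.filter (fun w => ¬ Crit key w) ↔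
      (Val M w ∧ (w.map labE).sum = e) ∧ ¬ Crit key w := by
    intro w
    rw [Finset.mem_filter, Set.Finite.mem_toFinset]
    rfl
  have hex : ∀ w ∈ (finite_wordsOf M e).toFinset.filter (fun w => ¬ Crit key w),
      ∃ v, Partner M key w v := by
    intro w hw
    obtain ⟨⟨h1, h2⟩, h3⟩ := hmem.1 hw
    rcases match_total hM h1 h3 with ⟨v, hv⟩ | ⟨u, hu, hv⟩
    · exact ⟨v, hv.mrg.val h1, .inl hv⟩
    · exact ⟨u, hu, .inr hv⟩
  choose g hg using hex
  have hgm : ∀ w hw, g w hw ∈ (finite_wordsOf M e).toFinset.filter (fun w => ¬ Crit key w) := by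
    intro w hw
    obtain ⟨⟨h1, h2⟩, h3⟩ := hmem.1 hw
    obtain ⟨h4, h5⟩ := hg w hw
    refine hmem.2 ⟨⟨h4, ?_⟩, ?_⟩
    · rcases h5 with h5 | h5
      · rw [← h5.mrg.sum_labE_eq hM h1, h2]
      · rw [h5.mrg.sum_labE_eq hM h4, h2]
    · rcases h5 with h5 | h5
      · exact h5.not_crit_right hM hk h1
      · exact h5.not_crit_left hM hk h4
  have hsum : ∀ w hw, (w.map fun a => -ccoef J a).prod +
      ((g w hw).map fun a => -ccoef J a).prod = 0 := by
    intro w hw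
    obtain ⟨⟨h1, h2⟩, h3⟩ := hmem.1 hw
    obtain ⟨h4, h5 | h5⟩ := hg w hw
    · rw [h5.mrg.coef_eq hM h1, neg_add_cancel]
    · rw [h5.mrg.coef_eq hM h4, add_neg_cancel]
  refine Finset.sum_involution g hsum (fun w hw hne heq => hne ?_) hgm fun w hw => ?_
  · have := hsum w hw
    rw [heq] at this
    omega
  · refine (hg _ (hgm w hw)).unique hM hk (hmem.1 (hgm w hw)).1.1 ⟨(hmem.1 hw).1.1, ?_⟩
    exact (hg w hw).2.symm

theorem wordSeries_eq_critCount (hM : Gens M) (hk : Function.Injective key)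
    (hJ : ∀ a ∈ pureL M, a.2 = ∅ → a ∈ J) (e : Option (Fin t) →₀ ℕ) :
    wordSeries (ccoef J) (finite_wordsOf M) e =
      critCount M key J (fun j => e (some j)) (e none) := by
  rw [wordSeries, ← Finset.sum_filter_add_sum_filter_not _ (Crit key), sum_not_crit hM hk,
    add_zero]
  have hF : ∀ w : List (Ltr (Fin t)), (∀ a ∈ w, a ∈ pureL M) →
      (w.map fun a => -ccoef J a).prod = if ∀ a ∈ w, a ∈ J then 1 else 0 := by
    intro w hw
    induction w with
    | nil => simp
    | cons a w ih =>
      rw [List.forall_mem_cons] at hw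
      rw [List.map_cons, List.prod_cons, ih hw.2, hw.1.1.ccoef_eq (hJ a hw.1)]
      simp only [List.forall_mem_cons, ite_and]
      split_ifs <;> simp
  have hdeg : ∀ w : List (Ltr (Fin t)), (∀ a ∈ w, a ∈ pureL M) → wdeg cdeg w = wdeg tdeg w := by
    intro w hw
    induction w with
    | nil => rfl
    | cons a w ih =>
      rw [List.forall_mem_cons] at hw
      rw [wdeg_cons, wdeg_cons, ih hw.2, hw.1.1.cdeg_eq]
  have hc : ∀ {w}, w ∈ (finite_wordsOf M e).toFinset.filter (Crit key) ↔
      w ∈ critPiece M key (fun j => e (some j)) (e none) := by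
    intro w
    rw [mem_critPiece hM, Finset.mem_filter, Set.Finite.mem_toFinset]
    refine and_congr_left fun hcr => ?_
    simp only [wordsOf, piece, Set.mem_ofPred_eq]
    refine and_congr_right fun hv => ?_
    rw [sum_labE, expOf_eq_iff, hdeg w (hcr.pureL hv), and_comm]
  rw [Finset.sum_congr rfl fun w hw => hF w (hc.1 hw).1.1, Finset.sum_boole, critCount,
    ← Set.ncard_coe_finset]
  congr 2
  ext w
  rw [Finset.mem_coe, Finset.mem_filter, hc]
  rfl

end Cancel

section Exterior
variable {t : ℕ}

/-- The inverse of the product of the `1 + x_i z` over `i ∈ s`. -/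
def invSeries (s : Finset (Fin t)) : MvPowerSeries (Option (Fin t)) ℤ :=
  fun e => if (∑ i, e (some i) = e none) ∧ ∀ i ∉ s, e (some i) = 0 then (-1) ^ e none else 0

theorem invSeries_empty : invSeries (∅ : Finset (Fin t)) = 1 := by
  ext e
  rw [MvPowerSeries.coeff_one, MvPowerSeries.coeff_apply, invSeries]
  by_cases h : e = 0
  · subst h
    simp
  · rw [if_neg h, if_neg]
    rintro ⟨h1, h2⟩
    have h3 : ∀ i, e (some i) = 0 := fun i => h2 i (Finset.notMem_empty i)
    rw [Finset.sum_eq_zero fun i _ => h3 i] at h1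
    apply h
    ext o
    cases o with
    | none => exact h1.symm
    | some i => exact h3 i

theorem X_mul_X (i : Fin t) :
    (MvPowerSeries.X (some i) * MvPowerSeries.X none : MvPowerSeries (Option (Fin t)) ℤ) =
      MvPowerSeries.monomial (expOf (Pi.single i 1) 1) 1 := by
  rw [MvPowerSeries.X_def, MvPowerSeries.X_def, MvPowerSeries.monomial_mul_monomial, one_mul]
  have h : expOf (Pi.single i 1) 1 = Finsupp.single (some i) 1 + Finsupp.single none 1 := by
    rw [expOf_eq_iff]
    constructor
    · ext j
      simp [Pi.single_apply, Finsupp.single_apply, eq_comm]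
    · simp
  rw [h]

theorem expOf_le_iff {α : Mon (Fin t)} {d : ℕ} {e : Option (Fin t) →₀ ℕ} :
    expOf α d ≤ e ↔ (∀ i, α i ≤ e (some i)) ∧ d ≤ e none := by
  constructor
  · exact fun h => ⟨fun i => h (some i), h none⟩
  · rintro ⟨h1, h2⟩ o
    cases o with
    | none => exact h2
    | some i => exact h1 i

theorem mul_invSeries_insert {s : Finset (Fin t)} {i : Fin t} (hi : i ∉ s) :
    (1 + MvPowerSeries.X (some i) * MvPowerSeries.X none) * invSeries (insert i s) =
      invSeries s := by
  ext e
  rw [X_mul_X, add_mul, one_mul, map_add, MvPowerSeries.coeff_monomial_mul, one_mul]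
  simp only [MvPowerSeries.coeff_apply]
  have key : (∀ j ∉ s, e (some j) = 0) ↔ e (some i) = 0 ∧ ∀ j ∉ insert i s, e (some j) = 0 := by
    constructor
    · exact fun h => ⟨h i hi, fun j hj => h j fun hjs => hj (Finset.mem_insert_of_mem hjs)⟩
    · rintro ⟨h1, h2⟩ j hj
      by_cases hji : j = i
      · rwa [hji]
      · exact h2 j fun h3 => (Finset.mem_insert.1 h3).elim hji hj
  have hsum : e (some i) ≤ ∑ j, e (some j) :=
    Finset.single_le_sum (f := fun j => e (some j)) (fun _ _ => Nat.zero_le _) (Finset.mem_univ i)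
  by_cases h0 : e (some i) = 0
  · rw [if_neg, add_zero, invSeries, invSeries]
    · simp only [key, h0, true_and]
    · intro h
      have := (expOf_le_iff.1 h).1 i
      rw [Pi.single_eq_same] at this
      omega
  · have hs : invSeries s e = 0 := by
      rw [invSeries, if_neg]
      exact fun h => h0 (key.1 h.2).1
    rw [hs]
    by_cases h1 : e none = 0
    · rw [invSeries, if_neg (by rintro ⟨h2, -⟩; omega), zero_add, if_neg]
      intro h
      have := (expOf_le_iff.1 h).2
      omega
    · obtain ⟨n, hn⟩ := Nat.exists_eq_succ_of_ne_zero h1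
      have hle : expOf (Pi.single i 1) 1 ≤ e := by
        rw [expOf_le_iff]
        refine ⟨fun j => ?_, by omega⟩
        by_cases hj : j = i
        · rw [hj, Pi.single_eq_same]
          omega
        · rw [Pi.single_eq_of_ne hj]
          exact Nat.zero_le _
      rw [if_pos hle, invSeries, invSeries]
      have e1 : ∀ j, (e - expOf (Pi.single i 1) 1) (some j) =
          e (some j) - (Pi.single i 1 : Mon (Fin t)) j := fun _ => rfl
      have e2 : (e - expOf (Pi.single i 1) 1) none = n := by
        change e none - 1 = n
        omega
      have e3 : ∑ j, (e (some j) - (Pi.single i 1 : Mon (Fin t)) j) + 1 = ∑ j, e (some j) := by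
        have e4 : ∑ j, (Pi.single i 1 : Mon (Fin t)) j = 1 := by simp
        rw [← Finset.sum_congr rfl fun j _ => Nat.sub_add_cancel ((expOf_le_iff.1 hle).1 j),
          Finset.sum_add_distrib, e4]
      have e5 : ∀ j ∉ insert i s, e (some j) - (Pi.single i 1 : Mon (Fin t)) j = e (some j) := by
        intro j hj
        rw [Pi.single_eq_of_ne (fun h => hj (by rw [h]; exact Finset.mem_insert_self i s)), Nat.sub_zero]
      simp only [e1, e2]
      rw [hn, ← e3, pow_succ]
      have e6 : (∀ j ∉ insert i s, e (some j) - (Pi.single i 1 : Mon (Fin t)) j = 0) ↔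
          ∀ j ∉ insert i s, e (some j) = 0 :=
        forall₂_congr fun j hj => by rw [e5 j hj]
      simp only [e6, Nat.succ_eq_add_one, add_left_inj]
      split_ifs <;> simp

theorem prod_mul_invSeries (s : Finset (Fin t)) :
    (∏ i ∈ s, (1 + MvPowerSeries.X (some i) * MvPowerSeries.X none)) * invSeries s = 1 := by
  induction s using Finset.induction_on with
  | empty => rw [Finset.prod_empty, one_mul, invSeries_empty]
  | insert i s hi ih => rw [Finset.prod_insert hi, mul_comm (_ + _), mul_assoc,
      mul_invSeries_insert hi, ih]

end Exterior

section Denominator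
variable {t : ℕ} {M : Finset (Mon (Fin t))} {J : Set (Ltr (Fin t))}

/-- The denominator of the Poincaré series, as a sum over all subsets of `M`. -/
def denomPoly (M : Finset (Mon (Fin t))) (J : Set (Ltr (Fin t))) :
    MvPolynomial (Option (Fin t)) ℤ :=
  ∑ S ∈ M.powerset, MvPolynomial.monomial (expOf (mlcm S) (sdeg S)) (scoef J S)

theorem denomPoly_mul_invSeries (hM : Gens M) :
    (denomPoly M J : MvPowerSeries (Option (Fin t)) ℤ) * invSeries Finset.univ =
      1 + letterSeries (ccoef J) (finite_letters M) := by
  ext e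
  rw [denomPoly, ← MvPolynomial.coeToMvPowerSeries.ringHom_apply, map_sum, Finset.sum_mul, map_sum,
    map_add, MvPowerSeries.coeff_one]
  simp only [MvPolynomial.coeToMvPowerSeries.ringHom_apply, MvPolynomial.coe_monomial,
    MvPowerSeries.coeff_monomial_mul]
  simp only [MvPowerSeries.coeff_apply, letterSeries]
  set γ : Mon (Fin t) := fun j => e (some j) with hγ
  have hterm : ∀ S ∈ M.powerset, (if expOf (mlcm S) (sdeg S) ≤ e then
      scoef J S * invSeries Finset.univ (e - expOf (mlcm S) (sdeg S)) else 0) =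
      if mlcm S ≤ γ ∧ cdeg (γ, S) = e none then ccoef J (γ, S) else 0 := by
    intro S _
    have h1 : expOf (mlcm S) (sdeg S) ≤ e ↔ mlcm S ≤ γ ∧ sdeg S ≤ e none := expOf_le_iff
    have h2 : invSeries Finset.univ (e - expOf (mlcm S) (sdeg S)) =
        if exc (γ, S) = e none - sdeg S then (-1) ^ (e none - sdeg S) else 0 := by
      rw [invSeries]
      simp only [Finset.mem_univ, not_true_eq_false, IsEmpty.forall_iff, implies_true, and_true]
      rfl
    rw [h2, ccoef, cdeg]
    by_cases h3 : mlcm S ≤ γ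
    · by_cases h4 : sdeg S + exc (γ, S) = e none
      · rw [if_pos (h1.2 ⟨h3, by omega⟩), if_pos (by omega), if_pos ⟨h3, h4⟩, ← h4,
          Nat.add_sub_cancel_left]
      · rw [if_neg (c := mlcm S ≤ γ ∧ _) fun h => h4 h.2]
        by_cases h5 : expOf (mlcm S) (sdeg S) ≤ e
        · have := (h1.1 h5).2
          rw [if_pos h5, if_neg (by omega), mul_zero]
        · rw [if_neg h5]
    · rw [if_neg (fun h => h3 (h1.1 h).1), if_neg (fun h => h3 h.1)]
  rw [Finset.sum_congr rfl hterm]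
  by_cases h0 : γ = 0
  · have hl : (finite_letters M e).toFinset = ∅ := by
      rw [Set.Finite.toFinset_eq_empty, Set.eq_empty_iff_forall_notMem]
      rintro a ⟨h1, h2⟩
      exact h1.1 ((expOf_eq_iff.1 h2).1.trans h0)
    rw [hl, Finset.sum_empty, add_zero, Finset.sum_eq_single ∅]
    · have h1 : exc ((γ, ∅) : Ltr (Fin t)) = 0 := by simp [exc, h0]
      have h2 : e = 0 ↔ e none = 0 := by
        constructor
        · rintro rfl
          rfl
        · intro h
          ext o
          cases o with
          | none => exact h
          | some i => exact congrFun h0 i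
      rw [ccoef, cdeg, h1, sdeg, scoef, comps_empty]
      simp [mlcm_empty, h2, eq_comm]
    · intro S hS hne
      refine if_neg fun h => hne ?_
      rw [h0] at h
      exact (mlcm_eq_zero_iff hM (Finset.mem_powerset.1 hS)).1 (le_antisymm h.1 bot_le)
    · intro h
      exact absurd (Finset.empty_mem_powerset M) h
  · have he : e ≠ 0 := by
      rintro rfl
      exact h0 rfl
    rw [if_neg he, zero_add, ← Finset.sum_filter]
    refine Finset.sum_bij (fun S _ => (γ, S)) ?_ ?_ ?_ ?_
    · intro S hS
      rw [Finset.mem_filter, Finset.mem_powerset] at hS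
      rw [Set.Finite.mem_toFinset]
      exact ⟨⟨h0, hS.1, mlcm_le_iff.1 hS.2.1⟩, expOf_eq_iff.2 ⟨rfl, hS.2.2⟩⟩
    · intro S _ S' _ h
      exact (Prod.ext_iff.1 h).2
    · rintro ⟨δ, S⟩ ha
      rw [Set.Finite.mem_toFinset] at ha
      obtain ⟨⟨_, h2, h3⟩, h4⟩ := ha
      obtain ⟨rfl, h5⟩ := expOf_eq_iff.1 h4
      refine ⟨S, ?_, rfl⟩
      rw [Finset.mem_filter, Finset.mem_powerset]
      exact ⟨h2, mlcm_le_iff.2 h3, h5⟩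
    · intro S _
      rfl

end Denominator

section Pieces
variable {k : Type*} [Field k] {σ : Type*} {M : Finset (Mon σ)} {o : Mon σ → ℕ}
  {J : Set (Ltr σ)} {a : Ltr σ} {γ : Mon σ} {j : ℕ}
open BarData

theorem finite_purePiece (M : Finset (Mon σ)) (γ : Mon σ) (j : ℕ) : (purePiece M γ j).Finite := by
  refine ((Set.finite_singleton γ).prod M.powerset.finite_toSet).subset ?_
  rintro ⟨δ, S⟩ ⟨h1, h2, -⟩
  exact ⟨h2, Finset.mem_coe.2 (Finset.mem_powerset.2 h1.2.2.1)⟩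

theorem snd_eq_empty_of_mem_purePiece (h : ∀ S ⊆ M, Conn S → mlcm S ≠ γ)
    (ha : a ∈ purePiece M γ j) : a.2 = ∅ := by
  rcases ha.1.1 with h1 | h1
  · exact h1.1
  · exact absurd (h1.2.symm.trans ha.2.1) (h _ ha.1.2.2.1 h1.1)

theorem dL_eq_zero {A : BarData k (Ltr σ)} {P : Set (Ltr σ)} (h : ∀ a ∈ P, A.d a = 0)
    {x : Ltr σ →₀ k} (hx : x ∈ Finsupp.supported k k P) : A.dL x = 0 := by
  rw [dL, Finsupp.linearCombination_apply]
  refine Finset.sum_eq_zero fun a ha => ?_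
  change x a • A.d a = 0
  rw [h a ((Finsupp.mem_supported k x).1 hx ha), smul_zero]

theorem homDim_purePiece_of_not_conn (h : ∀ S ⊆ M, Conn S → mlcm S ≠ γ) (j : ℕ) :
    homDim (fun j => Finsupp.supported k k (purePiece M γ j)) (pureBar k M o).dL j =
      (purePiece M γ j).ncard := by
  have hd : ∀ j, ∀ x ∈ Finsupp.supported k k (purePiece M γ j), (pureBar k M o).dL x = 0 := by
    intro j x hx
    refine dL_eq_zero (fun a ha => ?_) hx
    ext b
    by_contra hne
    obtain ⟨s, hs, -⟩ := taylor_d_ne (pureBar_d_ne hne).1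
    rw [snd_eq_empty_of_mem_purePiece h ha] at hs
    exact Finset.notMem_empty s hs
  have h1 : Finsupp.supported k k (purePiece M γ j) ⊓ LinearMap.ker (pureBar k M o).dL =
      Finsupp.supported k k (purePiece M γ j) := inf_eq_left.2 (hd j)
  have h2 : (Finsupp.supported k k (purePiece M γ (j + 1))).map (pureBar k M o).dL = ⊥ :=
    le_bot_iff.1 (Submodule.map_le_iff_le_comap.2 (hd (j + 1)))
  rw [homDim, h1, h2, finrank_bot, Nat.sub_zero, finrank_supported_eq_ncard (finite_purePiece M γ j)]

theorem Admissible.mem (hM : Gens M) (hJ : Admissible k M o J) (ha : a ∈ pureL M)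
    (h : a.2 = ∅) : a ∈ J := by
  have hn : ∀ S ⊆ M, Conn S → mlcm S ≠ a.1 := by
    rintro S hS ⟨⟨s, hs⟩, -⟩ hSa
    rcases ha.1 with ⟨-, i, h1⟩ | h1
    · exact hM.not_le s (hS hs) i (h1 ▸ hSa ▸ le_mlcm hs)
    · exact h1.1.1.ne_empty h
  have h1 := hJ a.1 (tdeg a)
  rw [homDim_purePiece_of_not_conn hn] at h1
  have h2 := Set.eq_of_subset_of_ncard_le Set.inter_subset_right h1.ge
    (finite_purePiece M a.1 (tdeg a))
  have h3 : a ∈ purePiece M a.1 (tdeg a) := ⟨ha, rfl, rfl⟩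
  rw [← h2] at h3
  exact h3.1

theorem exists_admissible (k : Type*) [Field k] (M : Finset (Mon σ)) (o : Mon σ → ℕ) :
    ∃ J, Admissible k M o J := by
  have h : ∀ γ j, ∃ P ⊆ purePiece M γ j, P.ncard =
      homDim (fun j => Finsupp.supported k k (purePiece M γ j)) (pureBar k M o).dL j := by
    intro γ j
    refine Set.exists_subset_card_eq ?_
    rw [homDim, ← finrank_supported_eq_ncard (k := k) (finite_purePiece M γ j)]
    have := finiteDimensional_supported (k := k) (finite_purePiece M γ j)
    exact (Nat.sub_le _ _).trans (Submodule.finrank_mono inf_le_left)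
  choose P hP hc using h
  refine ⟨{a | a ∈ P a.1 (tdeg a)}, fun γ j => ?_⟩
  rw [← hc]
  congr 1
  ext a
  constructor
  · rintro ⟨h1, -, h2, h3⟩
    rw [Set.mem_ofPred_eq, h2, h3] at h1
    exact h1
  · intro h1
    have h2 := hP γ j h1
    refine ⟨?_, h2⟩
    rw [Set.mem_ofPred_eq, h2.2.1, h2.2.2]
    exact h1

end Pieces

section Denominator
variable {k : Type*} [Field k] {t : ℕ} {M : Finset (Mon (Fin t))} {o : Mon (Fin t) → ℕ}
  {J : Set (Ltr (Fin t))}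

theorem IsDenominator.eq_denomPoly (hM : Gens M) (ho : Function.Injective o)
    (hJ : Admissible k M o J) {b : MvPolynomial (Option (Fin t)) ℤ}
    (hb : IsDenominator k (upperSet M) b) : b = denomPoly M J := by
  have hk : Function.Injective (Encodable.encode : Mon (Fin t) → ℕ) := Encodable.encode_injective
  have hP : poincareSeries k (upperSet M) = wordSeries (ccoef J) (finite_wordsOf M) := by
    ext e
    rw [MvPowerSeries.coeff_apply, MvPowerSeries.coeff_apply, poincareSeries,
      torDim_eq_critCount hM ho hk hJ, wordSeries_eq_critCount hM hk fun a ha => hJ.mem hM ha]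
  have h1 := wordSeries_mul (s := ccoef J) (finite_letters M) (finite_wordsOf M)
  rw [← hP, ← denomPoly_mul_invSeries hM] at h1
  rw [IsDenominator] at hb
  have h2 := prod_mul_invSeries (Finset.univ : Finset (Fin t))
  rw [← hb] at h2
  apply MvPolynomial.coe_injective
  set P := poincareSeries k (upperSet M)
  set U := invSeries (Finset.univ : Finset (Fin t))
  calc (b : MvPowerSeries (Option (Fin t)) ℤ) = b * (denomPoly M J * U * P) := by
        rw [h1, mul_one]
    _ = denomPoly M J * (b * P * U) := by ring
    _ = denomPoly M J := by rw [h2, mul_one]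

end Denominator

section Transport
variable {σ σ' : Type*} {M' : Finset (Mon σ')} {f : Mon σ → Mon σ'} {M S U C : Finset (Mon σ)}

/-- The image of a monomial set. -/
def mapSet (f : Mon σ → Mon σ') (S : Finset (Mon σ)) : Finset (Mon σ') := S.image f

theorem mem_mapSet {n : Mon σ'} : n ∈ mapSet f S ↔ ∃ m ∈ S, f m = n := Finset.mem_image

theorem mem_mapSet_of_mem {m : Mon σ} (h : m ∈ S) : f m ∈ mapSet f S := mem_mapSet.2 ⟨m, h, rfl⟩

theorem mapSet_mono (h : S ⊆ U) : mapSet f S ⊆ mapSet f U := Finset.image_subset_image h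

theorem mapSet_nonempty : (mapSet f S).Nonempty ↔ S.Nonempty := Finset.image_nonempty

/-- A map which induces an equivalence of the lcm-lattices of `M` and `M'`. -/
structure Transport (M : Finset (Mon σ)) (M' : Finset (Mon σ')) (f : Mon σ → Mon σ') :
    Prop where
  bij : Set.BijOn f M M'
  map_mlcm : ∀ S ⊆ M, f (mlcm S) = mlcm (mapSet f S)
  ncf : ∀ a ∈ M, ∀ b ∈ M, NCF (f a) (f b) ↔ NCF a b
  inj : ∀ S ⊆ M, ∀ U ⊆ M, f (mlcm S) = f (mlcm U) → mlcm S = mlcm U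

namespace Transport
theorem mapSet_subset (hf : Transport M M' f) (hS : S ⊆ M) : mapSet f S ⊆ M' := by
  intro n hn
  obtain ⟨m, hm, rfl⟩ := mem_mapSet.1 hn
  exact hf.bij.mapsTo (hS hm)

theorem mapSet_subset_iff (hf : Transport M M' f) (hS : S ⊆ M) (hU : U ⊆ M) :
    mapSet f S ⊆ mapSet f U ↔ S ⊆ U := by
  refine ⟨fun h m hm => ?_, mapSet_mono⟩
  obtain ⟨u, hu, h1⟩ := mem_mapSet.1 (h (mem_mapSet_of_mem hm))
  rwa [← hf.bij.injOn (hU hu) (hS hm) h1]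

theorem mapSet_inj (hf : Transport M M' f) (hS : S ⊆ M) (hU : U ⊆ M)
    (h : mapSet f S = mapSet f U) : S = U :=
  ((hf.mapSet_subset_iff hS hU).1 h.subset).antisymm ((hf.mapSet_subset_iff hU hS).1 h.symm.subset)

theorem exists_mapSet_eq {T : Finset (Mon σ')} (hT : T ⊆ mapSet f U) :
    ∃ S ⊆ U, mapSet f S = T := Finset.subset_image_iff.1 hT

theorem exists_mapSet_eq_of_subset (hf : Transport M M' f) {T : Finset (Mon σ')} (hT : T ⊆ M') :
    ∃ S ⊆ M, mapSet f S = T := by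
  refine exists_mapSet_eq fun n hn => ?_
  obtain ⟨m, hm, h⟩ := hf.bij.surjOn (hT hn)
  exact mem_mapSet.2 ⟨m, hm, h⟩

theorem card_mapSet (hf : Transport M M' f) (hS : S ⊆ M) : (mapSet f S).card = S.card :=
  Finset.card_image_of_injOn (hf.bij.injOn.mono hS)

theorem cop_iff (hf : Transport M M' f) (hS : S ⊆ M) (hU : U ⊆ M) :
    Cop (mapSet f S) (mapSet f U) ↔ Cop S U := by
  constructor
  · intro h s hs u hu hn
    exact h _ (mem_mapSet_of_mem hs) _ (mem_mapSet_of_mem hu)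
      ((hf.ncf _ (hS hs) _ (hU hu)).2 hn)
  · intro h s' hs' u' hu' hn
    obtain ⟨s, hs, rfl⟩ := mem_mapSet.1 hs'
    obtain ⟨u, hu, rfl⟩ := mem_mapSet.1 hu'
    exact h s hs u hu ((hf.ncf _ (hS hs) _ (hU hu)).1 hn)

theorem mapSet_sdiff (hf : Transport M M' f) (hS : S ⊆ M) (hU : U ⊆ M) :
    mapSet f (S \ U) = mapSet f S \ mapSet f U := by
  ext n
  simp only [mem_mapSet, Finset.mem_sdiff]
  constructor
  · rintro ⟨m, ⟨h1, h2⟩, rfl⟩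
    refine ⟨⟨m, h1, rfl⟩, ?_⟩
    rintro ⟨u, hu, h3⟩
    exact h2 (hf.bij.injOn (hU hu) (hS h1) h3 ▸ hu)
  · rintro ⟨⟨m, h1, rfl⟩, h2⟩
    exact ⟨m, ⟨h1, fun h => h2 ⟨m, h, rfl⟩⟩, rfl⟩

theorem cop_sdiff_iff (hf : Transport M M' f) (hS : S ⊆ M) (hC : C ⊆ S) :
    Cop (mapSet f C) (mapSet f S \ mapSet f C) ↔ Cop C (S \ C) := by
  rw [← hf.mapSet_sdiff hS (hC.trans hS),
    hf.cop_iff (hC.trans hS) (Finset.sdiff_subset.trans hS)]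

theorem conn_iff (hf : Transport M M' f) (hS : S ⊆ M) : Conn (mapSet f S) ↔ Conn S := by
  rw [Conn, Conn, mapSet_nonempty]
  refine and_congr_right fun _ => ⟨fun h C hC hne hcop => ?_, fun h T hT hne hcop => ?_⟩
  · exact hf.mapSet_inj (hC.trans hS) hS
      (h _ (mapSet_mono hC) (mapSet_nonempty.2 hne) ((hf.cop_sdiff_iff hS hC).2 hcop))
  · obtain ⟨C, hC, rfl⟩ := exists_mapSet_eq hT
    rw [h C hC (mapSet_nonempty.1 hne) ((hf.cop_sdiff_iff hS hC).1 hcop)]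

theorem comps_mapSet (hf : Transport M M' f) (hS : S ⊆ M) :
    comps (mapSet f S) = (comps S).image (mapSet f) := by
  ext T
  rw [mem_comps, Finset.mem_image]
  constructor
  · rintro ⟨h1, h2, h3⟩
    obtain ⟨C, hC, rfl⟩ := exists_mapSet_eq h1
    exact ⟨C, mem_comps.2 ⟨hC, (hf.conn_iff (hC.trans hS)).1 h2,
      (hf.cop_sdiff_iff hS hC).1 h3⟩, rfl⟩
  · rintro ⟨C, hC, rfl⟩
    rw [mem_comps] at hC
    exact ⟨mapSet_mono hC.1, (hf.conn_iff (hC.1.trans hS)).2 hC.2.1,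
      (hf.cop_sdiff_iff hS hC.1).2 hC.2.2⟩

theorem injOn_mapSet_comps (hf : Transport M M' f) (hS : S ⊆ M) : Set.InjOn (mapSet f) (comps S) := by
  intro C hC D hD h
  exact hf.mapSet_inj ((mem_comps.1 hC).1.trans hS) ((mem_comps.1 hD).1.trans hS) h

theorem sdeg_mapSet (hf : Transport M M' f) (hS : S ⊆ M) : sdeg (mapSet f S) = sdeg S := by
  rw [sdeg, sdeg, hf.card_mapSet hS, hf.comps_mapSet hS,
    Finset.card_image_of_injOn (hf.injOn_mapSet_comps hS)]

/-- The image of a letter. -/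
def mapLtr (f : Mon σ → Mon σ') (a : Ltr σ) : Ltr σ' := (f a.1, mapSet f a.2)

theorem scoef_mapSet (hf : Transport M M' f) {J : Set (Ltr σ)} {J' : Set (Ltr σ')}
    (hJ : ∀ C ⊆ M, C.Nonempty → (mapLtr f (mlcm C, C) ∈ J' ↔ (mlcm C, C) ∈ J)) (hS : S ⊆ M) :
    scoef J' (mapSet f S) = scoef J S := by
  rw [scoef, scoef, hf.comps_mapSet hS, Finset.prod_image (hf.injOn_mapSet_comps hS)]
  refine Finset.prod_congr rfl fun C hC => ?_
  rw [mem_comps] at hC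
  have h1 := hJ C (hC.1.trans hS) hC.2.1.1
  rw [mapLtr, hf.map_mlcm C (hC.1.trans hS)] at h1
  simp only [h1]

variable {j : ℕ} {a : Ltr σ}

theorem mapLtr_mem_pureL (hf : Transport M M' f) (hM' : Gens M') (ha : a ∈ pureL M)
    (hne : a.2 ≠ ∅) :
    mapLtr f a ∈ pureL M' := by
  have h1 : Pure (mapLtr f a) := by
    rcases ha.1 with h | h
    · exact absurd h.1 hne
    · refine .inr ⟨(hf.conn_iff ha.2.2.1).2 h.1, ?_⟩
      rw [mapLtr, h.2, hf.map_mlcm _ ha.2.2.1]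
  exact ⟨h1, h1.valid hM' (hf.mapSet_subset ha.2.2.1)⟩

theorem snd_ne_empty_of_mem_purePiece (hM : Gens M) (hS : S ⊆ M) (hc : Conn S)
    (ha : a ∈ purePiece M (mlcm S) j) : a.2 ≠ ∅ := by
  intro h
  rcases ha.1.1 with ⟨-, i, h1⟩ | h1
  · obtain ⟨s, hs⟩ := hc.1
    exact hM.not_le s (hS hs) i (h1 ▸ ha.2.1 ▸ le_mlcm hs)
  · exact h1.1.1.ne_empty h

theorem mapLtr_injOn (hf : Transport M M' f) (γ : Mon σ) :
    Set.InjOn (mapLtr f) {a | ∃ j, a ∈ purePiece M γ j} := by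
  rintro a ⟨i, ha⟩ b ⟨j, hb⟩ h
  exact Prod.ext (ha.2.1.trans hb.2.1.symm)
    (hf.mapSet_inj ha.1.2.2.1 hb.1.2.2.1 (Prod.ext_iff.1 h).2)

theorem image_purePiece (hf : Transport M M' f) (hM : Gens M) (hM' : Gens M')
    (hS : S ⊆ M) (hc : Conn S) (j : ℕ) :
    mapLtr f '' purePiece M (mlcm S) j = purePiece M' (mlcm (mapSet f S)) j := by
  ext b
  constructor
  · rintro ⟨a, ha, rfl⟩
    refine ⟨hf.mapLtr_mem_pureL hM' ha.1 (snd_ne_empty_of_mem_purePiece hM hS hc ha), ?_, ?_⟩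
    · rw [mapLtr, ha.2.1, hf.map_mlcm S hS]
    · rw [← ha.2.2, tdeg, tdeg, mapLtr, hf.card_mapSet ha.1.2.2.1]
  · intro hb
    obtain ⟨U, hU, hUb⟩ := hf.exists_mapSet_eq_of_subset hb.1.2.2.1
    have hne := snd_ne_empty_of_mem_purePiece hM' (hf.mapSet_subset hS) ((hf.conn_iff hS).2 hc) hb
    rcases hb.1.1 with h | h
    · exact absurd h.1 hne
    rw [← hUb, hf.conn_iff hU] at h
    have h1 : mlcm U = mlcm S := by
      refine hf.inj U hU S hS ?_
      rw [hf.map_mlcm U hU, hf.map_mlcm S hS, ← h.2, hb.2.1]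
    have h2 : Pure (mlcm U, U) := .inr ⟨h.1, rfl⟩
    refine ⟨(mlcm U, U), ⟨⟨h2, h2.valid hM hU⟩, h1, ?_⟩, ?_⟩
    · rw [← hb.2.2, tdeg, tdeg, ← hUb, hf.card_mapSet hU]
    · rw [mapLtr, hf.map_mlcm U hU, hUb]
      exact Prod.ext (by rw [h.2, hUb]) rfl

end Transport
end Transport

section TransportHomology
variable {k : Type*} [Field k] {σ σ' : Type*} {M S U : Finset (Mon σ)} {M' : Finset (Mon σ')}
  {f : Mon σ → Mon σ'} {o : Mon σ → ℕ} {o' : Mon σ' → ℕ} {j : ℕ} {a : Ltr σ}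
open BarData

theorem pureBar_d (ha : a ∈ pureL M) : (pureBar k M o).d a =
    ∑ s ∈ a.2, if (a.1, a.2.erase s) ∈ pureL M then
      Finsupp.single (a.1, a.2.erase s) ((-1 : k) ^ inv o {s} a.2) else 0 := by
  have h : (pureBar k M o).d a = Finsupp.filterAddHom (· ∈ pureL M) ((taylor k o).d a) :=
    if_pos ha
  rw [h, taylor_d, map_sum]
  refine Finset.sum_congr rfl fun s _ => ?_
  split_ifs with h1
  · exact Finsupp.filter_single_of_pos _ h1
  · exact Finsupp.filter_single_of_neg _ h1

theorem dL_mem_purePiece {x : Ltr σ →₀ k} {γ : Mon σ}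
    (hx : x ∈ Finsupp.supported k k (purePiece M γ (j + 1))) :
    (pureBar k M o).dL x ∈ Finsupp.supported k k (purePiece M γ j) := by
  rw [dL, Finsupp.linearCombination_apply]
  refine Submodule.sum_mem _ fun a ha => Submodule.smul_mem _ _ ?_
  have h1 := (Finsupp.mem_supported k x).1 hx ha
  rw [Finsupp.mem_supported]
  intro b hb
  rw [Finset.mem_coe, Finsupp.mem_support_iff] at hb
  obtain ⟨h2, h3, h4⟩ := pureBar_d_ne hb
  obtain ⟨s, hs, rfl⟩ := taylor_d_ne h2
  refine ⟨h4, h1.2.1, ?_⟩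
  have h5 := h1.2.2
  have h6 := Finset.card_erase_add_one hs
  rw [tdeg] at h5
  change (a.2.erase s).card + 1 = j
  omega

namespace Transport

theorem inv_mapSet (hf : Transport M M' f)
    (ho : ∀ s ∈ M, ∀ u ∈ M, o' (f u) < o' (f s) ↔ o u < o s) (hS : S ⊆ M) (hU : U ⊆ M) :
    inv o' (mapSet f S) (mapSet f U) = inv o S U := by
  rw [inv, inv, mapSet, mapSet, Finset.sum_image (hf.bij.injOn.mono hS)]
  refine Finset.sum_congr rfl fun s hs => ?_
  rw [Finset.sum_image (hf.bij.injOn.mono hU)]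
  refine Finset.sum_congr rfl fun u hu => ?_
  simp only [ho s (hS hs) u (hU hu)]

theorem mapSet_singleton (f : Mon σ → Mon σ') (s : Mon σ) : mapSet f {s} = {f s} :=
  Finset.image_singleton f s

theorem mapSet_erase (hf : Transport M M' f) {s : Mon σ} (hU : U ⊆ M) (hs : s ∈ U) :
    mapSet f (U.erase s) = (mapSet f U).erase (f s) := by
  rw [Finset.erase_eq, Finset.erase_eq, ← mapSet_singleton, ← hf.mapSet_sdiff hU]
  exact Finset.singleton_subset_iff.2 (hU hs)

theorem mapLtr_mem_iff (hf : Transport M M' f) (hM : Gens M) (hM' : Gens M') (hS : S ⊆ M)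
    (hc : Conn S) (hU : U ⊆ M) :
    mapLtr f (mlcm S, U) ∈ pureL M' ↔ (mlcm S, U) ∈ pureL M := by
  constructor
  · intro h
    have h1 : mapLtr f (mlcm S, U) ∈ purePiece M' (mlcm (mapSet f S))
        (tdeg (mapLtr f (mlcm S, U))) := ⟨h, hf.map_mlcm S hS, rfl⟩
    rw [← hf.image_purePiece hM hM' hS hc] at h1
    obtain ⟨⟨γ, V⟩, h2, h3⟩ := h1
    have h4 : V = U := hf.mapSet_inj h2.1.2.2.1 hU (Prod.ext_iff.1 h3).2
    have h5 : γ = mlcm S := h2.2.1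
    rw [← h4, ← h5]
    exact h2.1
  · intro h
    exact hf.mapLtr_mem_pureL hM' h
      (snd_ne_empty_of_mem_purePiece (j := tdeg (mlcm S, U)) hM hS hc ⟨h, rfl, rfl⟩)

theorem mapDomain_pureBar_d (hf : Transport M M' f) (hM : Gens M) (hM' : Gens M') (hS : S ⊆ M)
    (hc : Conn S) (ho : ∀ s ∈ M, ∀ u ∈ M, o' (f u) < o' (f s) ↔ o u < o s)
    (ha : a ∈ purePiece M (mlcm S) j) :
    Finsupp.lmapDomain k k (mapLtr f) ((pureBar k M o).d a) =
      (pureBar k M' o').d (mapLtr f a) := by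
  have hsub := ha.1.2.2.1
  have hne := snd_ne_empty_of_mem_purePiece hM hS hc ha
  rw [pureBar_d ha.1, pureBar_d (hf.mapLtr_mem_pureL hM' ha.1 hne), map_sum]
  have h2 : (mapLtr f a).2 = a.2.image f := rfl
  rw [h2, Finset.sum_image (hf.bij.injOn.mono hsub)]
  refine Finset.sum_congr rfl fun s hs => ?_
  have h3 : ((mapLtr f a).1, (a.2.image f).erase (f s)) = mapLtr f (mlcm S, a.2.erase s) := by
    rw [← ha.2.1]
    exact Prod.ext rfl (hf.mapSet_erase hsub hs).symm
  have h4 : inv o' {f s} (a.2.image f) = inv o {s} a.2 := by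
    rw [← hf.inv_mapSet ho (Finset.singleton_subset_iff.2 (hsub hs)) hsub, mapSet_singleton]
    rfl
  rw [h3, h4, ha.2.1]
  simp only [hf.mapLtr_mem_iff hM hM' hS hc ((Finset.erase_subset s a.2).trans hsub)]
  split_ifs
  · rw [Finsupp.lmapDomain_apply, Finsupp.mapDomain_single]
  · rw [map_zero]

theorem homDim_purePiece (hf : Transport M M' f) (hM : Gens M) (hM' : Gens M') (hS : S ⊆ M)
    (hc : Conn S) (hoi : Function.Injective o)
    (ho : ∀ s ∈ M, ∀ u ∈ M, o' (f u) < o' (f s) ↔ o u < o s) (j : ℕ) :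
    homDim (fun j => Finsupp.supported k k (purePiece M (mlcm S) j)) (pureBar k M o).dL j =
      homDim (fun j => Finsupp.supported k k (purePiece M' (mlcm (mapSet f S)) j))
        (pureBar k M' o').dL j := by
  refine homDim_eq_of_exact (Finsupp.lmapDomain k k (mapLtr f))
    (fun j => finiteDimensional_supported (finite_purePiece M _ j))
    (fun j c hc => dL_mem_purePiece hc) (fun c hc => ?_) (fun j c _ => pureBar_dd hM hoi c)
    (fun j => ?_) (fun j c hx => ?_) (fun j c hx _ hpc => ?_) j
  · refine dL_eq_zero (fun a ha => ?_) hc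
    exact absurd ha.2.2 (Nat.succ_ne_zero _)
  · rw [Finsupp.lmapDomain_supported, hf.image_purePiece hM hM' hS hc]
  · have h : Finsupp.lmapDomain k k (mapLtr f) c = Finsupp.mapDomain (mapLtr f) c := rfl
    rw [dL, dL, h, Finsupp.linearCombination_mapDomain,
      Finsupp.linearCombination_apply, Finsupp.linearCombination_apply, Finsupp.sum, map_sum]
    refine Finset.sum_congr rfl fun a ha => ?_
    rw [map_smul, hf.mapDomain_pureBar_d hM hM' hS hc ho ((Finsupp.mem_supported k c).1 hx ha)]
    rfl
  · have h1 : c = 0 := by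
      refine Finsupp.mapDomain_injOn _ (hf.mapLtr_injOn (mlcm S)) (fun a ha => ?_) ?_
        (hpc.trans (map_zero (Finsupp.lmapDomain k k (mapLtr f))).symm)
      · exact ⟨j, (Finsupp.mem_supported k c).1 hx ha⟩
      · simp
    exact ⟨0, Submodule.zero_mem _, map_zero _, by rw [map_zero, h1]⟩

/-- The transport of a set of letters. -/
def mapLtrs (M : Finset (Mon σ)) (f : Mon σ → Mon σ') (J : Set (Ltr σ)) : Set (Ltr σ') :=
  {b | b.2 = ∅ ∨ ∃ C ⊆ M, (mlcm C, C) ∈ J ∧ mapLtr f (mlcm C, C) = b}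

variable {J : Set (Ltr σ)}

theorem mapLtr_mem_mapLtrs (hf : Transport M M' f) (hS : S ⊆ M) (hne : S.Nonempty) :
    mapLtr f (mlcm S, S) ∈ mapLtrs M f J ↔ (mlcm S, S) ∈ J := by
  constructor
  · rintro (h | ⟨C, hC, h1, h2⟩)
    · exact absurd h (mapSet_nonempty.2 hne).ne_empty
    · rwa [← hf.mapSet_inj hC hS (Prod.ext_iff.1 h2).2]
  · exact fun h => .inr ⟨S, hS, h, rfl⟩

theorem admissible_mapLtrs (hf : Transport M M' f) (hM : Gens M) (hM' : Gens M')
    (hoi : Function.Injective o) (ho : ∀ s ∈ M, ∀ u ∈ M, o' (f u) < o' (f s) ↔ o u < o s)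
    (hJ : Admissible k M o J) : Admissible k M' o' (mapLtrs M f J) := by
  intro γ j
  by_cases hγ : ∀ T ⊆ M', Conn T → mlcm T ≠ γ
  · rw [homDim_purePiece_of_not_conn hγ, Set.inter_eq_right.2]
    exact fun b hb => .inl (snd_eq_empty_of_mem_purePiece hγ hb)
  · push Not at hγ
    obtain ⟨T, hT, hc, rfl⟩ := hγ
    obtain ⟨S, hS, rfl⟩ := hf.exists_mapSet_eq_of_subset hT
    rw [hf.conn_iff hS] at hc
    rw [← hf.homDim_purePiece hM hM' hS hc hoi ho, ← hJ, ← hf.image_purePiece hM hM' hS hc]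
    have h1 : mapLtrs M f J ∩ mapLtr f '' purePiece M (mlcm S) j =
        mapLtr f '' (J ∩ purePiece M (mlcm S) j) := by
      have key : ∀ a ∈ purePiece M (mlcm S) j, mapLtr f a ∈ mapLtrs M f J ↔ a ∈ J := by
        intro a ha
        have hne := snd_ne_empty_of_mem_purePiece hM hS hc ha
        have h2 : a = (mlcm a.2, a.2) := by
          rcases ha.1.1 with h | h
          · exact absurd h.1 hne
          · exact Prod.ext h.2 rfl
        rw [h2]
        exact hf.mapLtr_mem_mapLtrs ha.1.2.2.1 (Finset.nonempty_iff_ne_empty.2 hne)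
      ext b
      constructor
      · rintro ⟨h2, a, ha, rfl⟩
        exact ⟨a, ⟨(key a ha).1 h2, ha⟩, rfl⟩
      · rintro ⟨a, ⟨h2, ha⟩, rfl⟩
        exact ⟨(key a ha).2 h2, a, ha, rfl⟩
    rw [h1]
    exact Set.InjOn.ncard_image
      ((hf.mapLtr_injOn (mlcm S)).mono fun a ha => (⟨j, ha.2⟩ : ∃ j, a ∈ purePiece M (mlcm S) j))

end Transport
end TransportHomology

section Equivalence
variable {σ σ' : Type*} {M S : Finset (Mon σ)} {M' : Finset (Mon σ')} {f : Mon σ → Mon σ'}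

theorem mem_lcmLattice {a : Mon σ} : a ∈ lcmLattice M ↔ ∃ S ⊆ M, mlcm S = a := by
  simp only [lcmLattice, Finset.mem_image, Finset.mem_powerset]

theorem mlcm_mem_lcmLattice (hS : S ⊆ M) : mlcm S ∈ lcmLattice M :=
  mem_lcmLattice.2 ⟨S, hS, rfl⟩

theorem mem_lcmLattice_of_mem {m : Mon σ} (hm : m ∈ M) : m ∈ lcmLattice M :=
  mem_lcmLattice.2 ⟨{m}, Finset.singleton_subset_iff.2 hm, Finset.sup_singleton (f := id)⟩

theorem exists_le_of_mem_lcmLattice {a : Mon σ} (ha : a ∈ lcmLattice M) (h : a ≠ 0) :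
    ∃ s ∈ M, s ≤ a := by
  obtain ⟨S, hS, rfl⟩ := mem_lcmLattice.1 ha
  obtain rfl | ⟨s, hs⟩ := S.eq_empty_or_nonempty
  · exact absurd mlcm_empty h
  · exact ⟨s, hS hs, le_mlcm hs⟩

namespace IsEquivalence

theorem map_zero (hf : IsEquivalence M M' f) : f 0 = 0 := by
  have h0 : (0 : Mon σ) ∈ lcmLattice M := mlcm_mem_lcmLattice (Finset.empty_subset M)
  have h0' : (0 : Mon σ') ∈ lcmLattice M' := mlcm_mem_lcmLattice (Finset.empty_subset M')
  obtain ⟨a, ha, h⟩ := hf.1.surjOn h0'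
  refine le_antisymm ?_ zero_le
  rw [← h]
  exact (hf.2.1 0 h0 a ha).1 zero_le

theorem map_ne_zero (hf : IsEquivalence M M' f) {a : Mon σ} (ha : a ∈ lcmLattice M)
    (h : a ≠ 0) : f a ≠ 0 := by
  intro h1
  rw [← hf.map_zero] at h1
  exact h (hf.1.injOn ha (mlcm_mem_lcmLattice (Finset.empty_subset M)) h1)

theorem mapsTo (hf : IsEquivalence M M' f) (hM : Gens M) (hM' : Gens M') (hmin : IsAntichain' M)
    {m : Mon σ} (hm : m ∈ M) : f m ∈ M' := by
  have hmL := mem_lcmLattice_of_mem hm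
  obtain ⟨n, hn, hle⟩ := exists_le_of_mem_lcmLattice (hf.1.mapsTo hmL)
    (hf.map_ne_zero hmL (hM.ne_zero m hm))
  obtain ⟨a, ha, rfl⟩ := hf.1.surjOn (mem_lcmLattice_of_mem hn)
  have ham : a ≤ m := (hf.2.1 a ha m hmL).2 hle
  have ha0 : a ≠ 0 := by
    rintro rfl
    exact hM'.ne_zero _ hn hf.map_zero
  obtain ⟨s, hs, hsa⟩ := exists_le_of_mem_lcmLattice ha ha0
  rw [hmin s hs m hm (hsa.trans ham)] at hsa
  rwa [ham.antisymm hsa] at hn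

theorem transport (hf : IsEquivalence M M' f) (hM : Gens M) (hM' : Gens M')
    (hmin : IsAntichain' M) (hmin' : IsAntichain' M') : Transport M M' f where
  bij := by
    refine ⟨fun m hm => hf.mapsTo hM hM' hmin hm, fun a ha b hb h => ?_, fun n hn => ?_⟩
    · exact hf.1.injOn (mem_lcmLattice_of_mem ha) (mem_lcmLattice_of_mem hb) h
    · obtain ⟨a, ha, rfl⟩ := hf.1.surjOn (mem_lcmLattice_of_mem hn)
      have ha0 : a ≠ 0 := by
        rintro rfl
        exact hM'.ne_zero _ hn hf.map_zero
      obtain ⟨s, hs, hsa⟩ := exists_le_of_mem_lcmLattice ha ha0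
      refine ⟨s, hs, hmin' _ (hf.mapsTo hM hM' hmin hs) _ hn ?_⟩
      exact (hf.2.1 s (mem_lcmLattice_of_mem hs) a ha).1 hsa
  map_mlcm S hS := by
    refine le_antisymm ?_ (mlcm_le_iff.2 fun n hn => ?_)
    · have h : mlcm (mapSet f S) ∈ lcmLattice M' := by
        refine mlcm_mem_lcmLattice fun n hn => ?_
        obtain ⟨m, hm, rfl⟩ := mem_mapSet.1 hn
        exact hf.mapsTo hM hM' hmin (hS hm)
      obtain ⟨a, ha, h1⟩ := hf.1.surjOn h
      rw [← h1]
      refine (hf.2.1 _ (mlcm_mem_lcmLattice hS) a ha).1 (mlcm_le_iff.2 fun s hs => ?_)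
      refine (hf.2.1 s (mem_lcmLattice_of_mem (hS hs)) a ha).2 ?_
      rw [h1]
      exact le_mlcm (mem_mapSet_of_mem hs)
    · obtain ⟨s, hs, rfl⟩ := mem_mapSet.1 hn
      exact (hf.2.1 s (mem_lcmLattice_of_mem (hS hs)) _ (mlcm_mem_lcmLattice hS)).1 (le_mlcm hs)
  ncf a ha b hb := by
    by_cases h : a = b
    · subst h
      exact iff_of_true (ncf_self (hM'.ne_zero _ (hf.mapsTo hM hM' hmin ha)))
        (ncf_self (hM.ne_zero a ha))
    · have haL := mem_lcmLattice_of_mem ha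
      have hbL := mem_lcmLattice_of_mem hb
      have h1 := hf.2.2 a haL b hbL
      rw [mAdj, mAdj, and_iff_right h, and_iff_right fun h2 => h (hf.1.injOn haL hbL h2)] at h1
      exact h1.symm
  inj S hS U hU h := hf.1.injOn (mlcm_mem_lcmLattice hS) (mlcm_mem_lcmLattice hU) h

end IsEquivalence

theorem Transport.exists_order [Encodable (Mon σ)] [Encodable (Mon σ')]
    (hf : Transport M M' f) : ∃ (o : Mon σ → ℕ) (o' : Mon σ' → ℕ), Function.Injective o ∧
      Function.Injective o' ∧ ∀ s ∈ M, ∀ u ∈ M, o' (f u) < o' (f s) ↔ o u < o s := by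
  refine ⟨fun m => if m ∈ M then 2 * Encodable.encode (f m) else 2 * Encodable.encode m + 1,
    Encodable.encode, fun a b h => ?_, Encodable.encode_injective, fun s hs u hu => ?_⟩
  · simp only at h
    split_ifs at h with ha hb hb
    · exact hf.bij.injOn ha hb (Encodable.encode_injective (by omega))
    · omega
    · omega
    · exact Encodable.encode_injective (by omega)
  · simp only [if_pos hs, if_pos hu]
    omega

end Equivalence

section Degrees
variable {t : ℕ} {M : Finset (Mon (Fin t))}

theorem gens_of_mdeg (h : ∀ m ∈ M, 2 ≤ mdeg m) : Gens M where
  ne_zero m hm h0 := by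
    have := h m hm
    rw [h0, mdeg] at this
    simp at this
  not_le m hm i hi := by
    have h1 := h m hm
    have h2 : mdeg m ≤ ∑ j, (Pi.single i 1 : Mon (Fin t)) j := by
      refine Finset.sum_le_sum fun j _ => ?_
      refine (hi j).trans_eq ?_
      congr
    rw [Finset.sum_pi_single'] at h2
    simp at h2
    omega

theorem expSet_eq_upperSet {k : Type*} [Field k] {I : Ideal (MvPolynomial (Fin t) k)}
    (h : IsMonomialIdealOf M I) : expSet I = upperSet M := by
  ext β
  have h1 : (fun m : Mon (Fin t) =>
      MvPolynomial.monomial (Finsupp.equivFunOnFinite.symm m) (1 : k)) '' (M : Set (Mon (Fin t))) =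
      (fun s => MvPolynomial.monomial s (1 : k)) ''
        (Finsupp.equivFunOnFinite.symm '' (M : Set (Mon (Fin t)))) := by
    rw [Set.image_image]
  rw [expSet, Set.mem_ofPred_eq, h, h1, MvPolynomial.mem_ideal_span_monomial_image,
    MvPolynomial.support_monomial, if_neg one_ne_zero]
  simp only [Finset.mem_singleton, forall_eq, Set.exists_mem_image]
  rfl

end Degrees

section ApplyEquiv
variable {t t' : ℕ} {f : Mon (Fin t) → Mon (Fin t')}

theorem applyEquiv_sum {ι : Type*} (P : Finset ι) (α : ι → Mon (Fin t)) (d : ι → ℕ) (c : ι → ℤ) :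
    applyEquiv f (∑ i ∈ P, MvPolynomial.monomial (expOf (α i) (d i)) (c i)) =
      ∑ i ∈ P, MvPolynomial.monomial (expOf (f (α i)) (d i)) (c i) := by
  set b := ∑ i ∈ P, MvPolynomial.monomial (expOf (α i) (d i)) (c i) with hb
  have h : applyEquiv f b = ∑ e ∈ b.support ∪ P.image (fun i => expOf (α i) (d i)),
      MvPolynomial.monomial (expOf (f (fun i => e (some i))) (e none)) (b.coeff e) := by
    refine Finset.sum_subset Finset.subset_union_left fun e _ he => ?_
    rw [MvPolynomial.notMem_support_iff.1 he, map_zero]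
  rw [h]
  have h1 : ∀ e, b.coeff e = ∑ i ∈ P, if expOf (α i) (d i) = e then c i else 0 := by
    intro e
    rw [hb, MvPolynomial.coeff_sum]
    exact Finset.sum_congr rfl fun i _ => MvPolynomial.coeff_monomial _ _ _
  simp only [h1, map_sum]
  rw [Finset.sum_comm]
  refine Finset.sum_congr rfl fun i hi => ?_
  rw [Finset.sum_eq_single (expOf (α i) (d i))]
  · rw [if_pos rfl]
    rfl
  · intro e _ he
    rw [if_neg he.symm, map_zero]
  · intro he
    exact absurd (Finset.mem_union_right _ (Finset.mem_image_of_mem _ hi)) he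

theorem denomPoly_mapLtrs {M : Finset (Mon (Fin t))} {M' : Finset (Mon (Fin t'))}
    (hf : Transport M M' f) (J : Set (Ltr (Fin t))) :
    denomPoly M' (Transport.mapLtrs M f J) = applyEquiv f (denomPoly M J) := by
  rw [denomPoly, denomPoly, applyEquiv_sum]
  symm
  refine Finset.sum_bij (fun S _ => mapSet f S) (fun S hS => ?_) (fun S hS U hU h => ?_)
    (fun T hT => ?_) fun S hS => ?_
  · exact Finset.mem_powerset.2 (hf.mapSet_subset (Finset.mem_powerset.1 hS))
  · exact hf.mapSet_inj (Finset.mem_powerset.1 hS) (Finset.mem_powerset.1 hU) h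
  · obtain ⟨S, hS, h⟩ := hf.exists_mapSet_eq_of_subset (Finset.mem_powerset.1 hT)
    exact ⟨S, Finset.mem_powerset.2 hS, h⟩
  · rw [Finset.mem_powerset] at hS
    rw [hf.map_mlcm S hS, hf.sdeg_mapSet hS,
      hf.scoef_mapSet (fun C hC hne => hf.mapLtr_mem_mapLtrs hC hne) hS]

end ApplyEquiv

end MonomialRings
open MonomialRings

/-- **Corollary (invariance of the denominator under equivalence of lcm-lattices).**
If `I ⊆ k[x]`, `I' ⊆ k[x']` are ideals generated by monomials of degree at least 2 and
`f : L_I → L_{I'}` is an isomorphism of partially ordered graphs, then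
`b_{R'}(x',z) = f(b_R(x,z))`, where `f` is applied to the coefficients of `b_R(x,z)`
regarded as a polynomial in `z`. -/
theorem denominator_equivalence
    (t t' : ℕ) (k : Type) [Field k]
    (M : Finset (Mon (Fin t))) (M' : Finset (Mon (Fin t')))
    (I : Ideal (MvPolynomial (Fin t) k)) (I' : Ideal (MvPolynomial (Fin t') k))
    (hgen : IsMonomialIdealOf M I) (hgen' : IsMonomialIdealOf M' I')
    (hmin : IsAntichain' M) (hmin' : IsAntichain' M')
    (hdeg : ∀ m ∈ M, 2 ≤ mdeg m) (hdeg' : ∀ m ∈ M', 2 ≤ mdeg m)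
    (b : MvPolynomial (Option (Fin t)) ℤ)
    (b' : MvPolynomial (Option (Fin t')) ℤ)
    (hb : IsDenominator k (expSet I) b)
    (hb' : IsDenominator k (expSet I') b')
    (f : Mon (Fin t) → Mon (Fin t'))
    (hf : IsEquivalence M M' f) :
    b' = applyEquiv f b := by
  have hM := gens_of_mdeg hdeg
  have hM' := gens_of_mdeg hdeg'
  have ht := hf.transport hM hM' hmin hmin'
  obtain ⟨o, o', ho, ho', hoo⟩ := ht.exists_order
  obtain ⟨J, hJ⟩ := exists_admissible k M o
  rw [expSet_eq_upperSet hgen] at hb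
  rw [expSet_eq_upperSet hgen'] at hb'
  rw [hb.eq_denomPoly hM ho hJ, hb'.eq_denomPoly hM' ho' (ht.admissible_mapLtrs hM hM' ho hoo hJ)]
  exact denomPoly_mapLtrs ht J
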